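/- arXiv:2509.00409 — 9 statements merged into one kernel-verified Lean document; each statement's English description precedes it below -/
import Mathlib

section
/- Let E be a nonzero separable complex Banach space, let d ≥ 1 be a natural number, and let T = (T_t)_{t ∈ ℝ₊^d} be a semigroup of bounded linear operators on E (i.e. T_0 = 1 and T_{s+t} = T_s T_t for all s, t ∈ ℝ₊^d) which is weakly continuous (for every continuous linear functional φ on E and every ξ ∈ E, the map ℝ₊^d ∋ t ↦ φ(T_t ξ) ∈ ℂ is continuous) and ℕ^d-periodic (T_{t+n} = T_t for all t ∈ ℝ₊^d and all n ∈ ℕ^d). For n ∈ ℤ^d let E_n := {ξ ∈ E : T_t ξ = e^{2πi⟨n,t⟩} ξ for all t ∈ ℝ₊^d}, where ⟨n,t⟩ = Σ_{i=1}^d n_i t_i. Then the linear span of ⋃_{n ∈ ℤ^d} E_n is dense in E; in particular, E_n ≠ {0} for some n ∈ ℤ^d. -/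
open Filter Topology MeasureTheory

section WeaklyContinuous

variable {X E : Type*} [TopologicalSpace X] [NormedAddCommGroup E] [NormedSpace ℂ E]

/-- The preimage of a closed ball under a weakly continuous map is closed. -/
theorem isClosed_preimage_closedBall_of_weaklyContinuous {f : X → E}
    (hf : ∀ φ : E →L[ℂ] ℂ, Continuous fun x => φ (f x)) (c : E) {r : ℝ} (hr : 0 ≤ r) :
    IsClosed (f ⁻¹' Metric.closedBall c r) := by
  have h : f ⁻¹' Metric.closedBall c r =
      ⋂ φ : E →L[ℂ] ℂ, {x | ‖φ (f x) - φ c‖ ≤ r * ‖φ‖} := by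
    ext x
    simp only [Set.mem_preimage, mem_closedBall_iff_norm, Set.mem_iInter, Set.mem_ofPred_eq,
      ← map_sub]
    refine ⟨fun hx φ => ?_, fun hx => ?_⟩
    · rw [mul_comm]
      exact φ.le_opNorm_of_le hx
    · exact NormedSpace.norm_le_dual_bound ℂ _ hr hx
  rw [h]
  exact isClosed_iInter fun φ => isClosed_le ((hf φ).sub continuous_const).norm continuous_const

/-- A weakly continuous map into a separable normed space is strongly measurable. -/
theorem stronglyMeasurable_of_weaklyContinuous [MeasurableSpace X] [BorelSpace X]
    [TopologicalSpace.SeparableSpace E] {f : X → E}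
    (hf : ∀ φ : E →L[ℂ] ℂ, Continuous fun x => φ (f x)) : StronglyMeasurable f := by
  borelize E
  have := UniformSpace.secondCountable_of_separable E
  refine Measurable.stronglyMeasurable (measurable_of_isOpen fun O hO => ?_)
  choose! r hr hrO using fun p (hp : p ∈ O) =>
    Metric.nhds_basis_closedBall.mem_iff.1 (hO.mem_nhds hp)
  obtain ⟨t, htO, ht, hcover⟩ := TopologicalSpace.countable_cover_nhdsWithin
    (f := fun p => Metric.closedBall p (r p)) (s := O)
    fun p hp => mem_nhdsWithin_of_mem_nhds (Metric.closedBall_mem_nhds p (hr p hp))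
  have hO' : O = ⋃ p ∈ t, Metric.closedBall p (r p) :=
    hcover.antisymm (Set.iUnion₂_subset fun p hp => hrO p (htO hp))
  rw [hO', Set.preimage_iUnion₂]
  exact MeasurableSet.biUnion ht fun p hp =>
    (isClosed_preimage_closedBall_of_weaklyContinuous hf p (hr p (htO hp)).le).measurableSet

/-- A weakly continuous map on a compact space is bounded. -/
theorem exists_norm_le_of_weaklyContinuous [CompactSpace X] {f : X → E}
    (hf : ∀ φ : E →L[ℂ] ℂ, Continuous fun x => φ (f x)) : ∃ C, ∀ x, ‖f x‖ ≤ C := by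
  obtain ⟨C, hC⟩ := banach_steinhaus
    (g := fun x => NormedSpace.inclusionInDoubleDual ℂ E (f x)) fun φ => by
      obtain ⟨C, hC⟩ := isCompact_univ.exists_bound_of_continuousOn (hf φ).continuousOn
      exact ⟨C, fun x => hC x (Set.mem_univ x)⟩
  refine ⟨C, fun x => ?_⟩
  rw [← (NormedSpace.inclusionInDoubleDualLi ℂ (E := E)).norm_map (f x)]
  exact hC x

/-- A weakly continuous map on a compact space into a separable normed space is integrable with
respect to every finite measure. -/
theorem integrable_of_weaklyContinuous [CompactSpace X] [MeasurableSpace X] [BorelSpace X]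
    [TopologicalSpace.SeparableSpace E] {μ : Measure X} [IsFiniteMeasure μ] {f : X → E}
    (hf : ∀ φ : E →L[ℂ] ℂ, Continuous fun x => φ (f x)) : Integrable f μ := by
  obtain ⟨C, hC⟩ := exists_norm_le_of_weaklyContinuous hf
  exact .of_bound (stronglyMeasurable_of_weaklyContinuous hf).aestronglyMeasurable C (.of_forall hC)

end WeaklyContinuous

/-- A subspace is dense as soon as the only continuous functional vanishing on it is zero. -/
theorem Submodule.dense_of_forall_dual_eq_zero {E : Type*} [NormedAddCommGroup E]
    [NormedSpace ℂ E] (S : Submodule ℂ E)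
    (h : ∀ φ : E →L[ℂ] ℂ, (∀ x ∈ S, φ x = 0) → φ = 0) : Dense (S : Set E) := by
  rw [Submodule.dense_iff_topologicalClosure_eq_top, Submodule.eq_top_iff']
  intro x
  have : IsClosed (S.topologicalClosure : Set E) := S.isClosed_topologicalClosure
  rw [← Submodule.Quotient.mk_eq_zero]
  refine SeparatingDual.eq_zero_of_forall_dual_eq_zero (R := ℂ) fun g => ?_
  have hg := h (g.comp S.topologicalClosure.mkQL) fun y hy => by
    have : S.topologicalClosure.mkQ y = 0 :=
      (Submodule.Quotient.mk_eq_zero _).2 (S.le_topologicalClosure hy)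
    simp [this]
  simpa using DFunLike.congr_fun hg x

namespace UnitAddTorus

attribute [local instance] instMeasureSpaceUnitAddCircle

local instance : Measure.IsAddHaarMeasure (volume : Measure UnitAddCircle) :=
  inferInstanceAs (Measure.IsAddHaarMeasure AddCircle.haarAddCircle)

local instance : IsProbabilityMeasure (volume : Measure UnitAddCircle) :=
  inferInstanceAs (IsProbabilityMeasure AddCircle.haarAddCircle)

variable {d : Type*} [Fintype d]

theorem mFourier_apply_add (n : d → ℤ) (x y : UnitAddTorus d) :
    mFourier n (x + y) = mFourier n x * mFourier n y := by
  simp only [mFourier, ContinuousMap.coe_mk, Pi.add_apply, fourier_apply, smul_add,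
    AddCircle.toCircle_add, Circle.coe_mul, Finset.prod_mul_distrib]

theorem mFourier_coe (n : d → ℤ) (t : d → ℝ) :
    mFourier n (fun i => (t i : UnitAddCircle)) =
      Complex.exp (2 * Real.pi * Complex.I * ∑ i, (n i : ℂ) * (t i : ℂ)) := by
  simp only [mFourier, ContinuousMap.coe_mk, fourier_coe_apply, Finset.mul_sum, Complex.exp_sum]
  refine Finset.prod_congr rfl fun i _ => ?_
  congr 1
  push_cast
  ring

/-- A continuous function on the torus whose Fourier coefficients vanish is zero. -/
theorem eq_zero_of_mFourierCoeff_eq_zero {f : UnitAddTorus d → ℂ} (hf : Continuous f)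
    (h : ∀ n, mFourierCoeff f n = 0) (x : UnitAddTorus d) : f x = 0 := by
  have h0 : mFourierCoeff (⟨f, hf⟩ : C(UnitAddTorus d, ℂ)) = 0 := funext h
  have hs := hasSum_mFourier_series_apply_of_summable (f := ⟨f, hf⟩) (h0 ▸ summable_zero) x
  simp only [h0, Pi.zero_apply, zero_smul] at hs
  exact hs.unique hasSum_zero

variable {E : Type*} [NormedAddCommGroup E] [NormedSpace ℂ E]
  [TopologicalSpace.SeparableSpace E] {S : UnitAddTorus d → E →L[ℂ] E}

theorem integrable_mFourier_smul_of_weaklyContinuous {f : UnitAddTorus d → E}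
    (hf : ∀ φ : E →L[ℂ] ℂ, Continuous fun x => φ (f x)) (n : d → ℤ) :
    Integrable fun x => mFourier n x • f x := by
  refine integrable_of_weaklyContinuous fun φ => ?_
  simp only [map_smul]
  exact (mFourier n).continuous.smul (hf φ)

variable [CompleteSpace E]

theorem apply_mFourierCoeff (hadd : ∀ x y, S (x + y) = S x * S y)
    (hS : ∀ (φ : E →L[ℂ] ℂ) (ξ : E), Continuous fun x => φ (S x ξ)) (ξ : E) (n : d → ℤ)
    (y : UnitAddTorus d) :
    S y (mFourierCoeff (fun x => S x ξ) n) =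
      mFourier n y • mFourierCoeff (fun x => S x ξ) n := by
  have hone : mFourier n y * mFourier (-n) y = 1 := by
    rw [← mFourier_add, add_neg_cancel, mFourier_zero, ContinuousMap.one_apply]
  unfold mFourierCoeff
  rw [← ContinuousLinearMap.integral_comp_comm _
    (integrable_mFourier_smul_of_weaklyContinuous (fun φ => hS φ ξ) (-n)),
    ← integral_add_left_eq_self (fun x => mFourier (-n) x • S x ξ) y, ← integral_smul]
  congr 1 with x
  simp only [map_smul, hadd, mFourier_apply_add, smul_smul, ← mul_assoc, hone, one_mul,
    mul_apply_eq_comp]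

/-- The eigenvectors of a weakly continuous representation of the torus have dense span. -/
theorem dense_span_eigenvectors (hzero : S 0 = 1) (hadd : ∀ x y, S (x + y) = S x * S y)
    (hS : ∀ (φ : E →L[ℂ] ℂ) (ξ : E), Continuous fun x => φ (S x ξ)) :
    Dense (Submodule.span ℂ (⋃ n : d → ℤ,
      {ξ : E | ∀ x, S x ξ = mFourier n x • ξ}) : Set E) := by
  refine Submodule.dense_of_forall_dual_eq_zero _ fun φ hφ => ContinuousLinearMap.ext fun ξ => ?_
  have hcoeff (n : d → ℤ) : mFourierCoeff (fun x => φ (S x ξ)) n = 0 := by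
    rw [← hφ _ (Submodule.subset_span (Set.mem_iUnion.2
      ⟨n, fun y => apply_mFourierCoeff hadd hS ξ n y⟩))]
    unfold mFourierCoeff
    rw [← ContinuousLinearMap.integral_comp_comm _
      (integrable_mFourier_smul_of_weaklyContinuous (fun φ => hS φ ξ) (-n))]
    simp only [map_smul]
  simpa [hzero] using eq_zero_of_mFourierCoeff_eq_zero (hS φ ξ) hcoeff 0

end UnitAddTorus

section Periodic

variable {ι : Type*}

/-- The class in the torus of a tuple of nonnegative reals. -/
def nnrealToTorus (t : ι → NNReal) : UnitAddTorus ι := fun i => ((t i : ℝ) : UnitAddCircle)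

theorem mFourier_nnrealToTorus [Fintype ι] (n : ι → ℤ) (t : ι → NNReal) :
    UnitAddTorus.mFourier n (nnrealToTorus t) =
      Complex.exp (2 * Real.pi * Complex.I * ∑ i, (n i : ℂ) * ((t i : ℝ) : ℂ)) :=
  UnitAddTorus.mFourier_coe n fun i => t i

theorem nnrealToTorus_add (s t : ι → NNReal) :
    nnrealToTorus (s + t) = nnrealToTorus s + nnrealToTorus t := by
  ext i
  simp [nnrealToTorus]

theorem UnitAddCircle.coe_natCast (n : ℕ) : ((n : ℝ) : UnitAddCircle) = 0 :=
  (AddCircle.coe_eq_zero_iff 1).2 ⟨n, by simp⟩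

theorem nnrealToTorus_toNNReal_add_natCast {s : ι → ℝ} {N : ι → ℕ} (h : ∀ i, -s i ≤ N i) :
    nnrealToTorus (fun i => (s i + N i).toNNReal) = fun i => (s i : UnitAddCircle) := by
  ext i
  have hi : 0 ≤ s i + N i := by linarith [h i]
  simp [nnrealToTorus, Real.coe_toNNReal _ hi, UnitAddCircle.coe_natCast]

theorem nnrealToTorus_surjective : Function.Surjective (nnrealToTorus (ι := ι)) := by
  intro x
  choose s hs using fun i => QuotientAddGroup.mk_surjective (x i)
  choose N hN using fun i => exists_nat_ge (-s i)
  exact ⟨_, (nnrealToTorus_toNNReal_add_natCast hN).trans (funext hs)⟩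

theorem eq_of_nnrealToTorus_eq {α : Type*} {T : (ι → NNReal) → α}
    (hper : ∀ (t : ι → NNReal) (n : ι → ℕ), T (t + fun i => (n i : NNReal)) = T t)
    {s t : ι → NNReal} (h : nnrealToTorus s = nnrealToTorus t) : T s = T t := by
  have hz (i : ι) : ∃ z : ℤ, (z : ℝ) = s i - t i := by
    obtain ⟨z, hz⟩ := (AddCircle.coe_eq_zero_iff 1 (x := (s i : ℝ) - t i)).1 (by
      rw [AddCircle.coe_sub, sub_eq_zero]
      exact congr_fun h i)
    exact ⟨z, by simpa using hz⟩
  choose z hz using hz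
  rw [← hper s fun i => (-z i).toNat, ← hper t fun i => (z i).toNat]
  congr 1
  ext i
  have hzi : (((z i).toNat : ℤ) : ℝ) - ((-z i).toNat : ℤ) = s i - t i := by
    rw [← hz i, ← Int.cast_sub, Int.toNat_sub_toNat_neg]
  push_cast at hzi
  simp only [Pi.add_apply, NNReal.coe_add, NNReal.coe_natCast]
  linarith

/-- A map on the torus is continuous if its pullback to nonnegative tuples is. -/
theorem continuous_of_comp_nnrealToTorus [Finite ι] {Y : Type*} [TopologicalSpace Y]
    {f : UnitAddTorus ι → Y} (hf : Continuous fun t => f (nnrealToTorus t)) : Continuous f := by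
  have hq : IsOpenQuotientMap (Pi.map fun (_ : ι) (s : ℝ) => (s : UnitAddCircle)) :=
    .piMap fun _ => QuotientAddGroup.isOpenQuotientMap_mk
  rw [← hq.continuous_comp_iff, continuous_iff_continuousAt]
  intro s
  choose N hN using fun i => exists_nat_gt (-s i)
  have hg : Continuous fun r : ι → ℝ =>
      f (nnrealToTorus fun i => (r i + N i).toNNReal) :=
    hf.comp (by fun_prop)
  refine hg.continuousAt.congr ?_
  have hmem : ∀ᶠ r : ι → ℝ in 𝓝 s, ∀ i, -r i < N i :=
    eventually_all.2 fun i =>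
      (continuous_apply i).neg.continuousAt.eventually_lt continuousAt_const (hN i)
  filter_upwards [hmem] with r hr
  exact congr_arg f (nnrealToTorus_toNNReal_add_natCast fun i => (hr i).le)

end Periodic



/-- For a weakly continuous, `ℕ^d`-periodic semigroup of bounded operators on a
nonzero separable complex Banach space, the span of the joint eigenspaces
`E_n = {ξ : T_t ξ = e^{2πi⟨n,t⟩} ξ}`, `n ∈ ℤ^d`, is dense; in particular some `E_n` is nonzero. -/
theorem stmt_0 (d : ℕ) (hd : 1 ≤ d)
    (E : Type*) [NormedAddCommGroup E] [NormedSpace ℂ E] [CompleteSpace E]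
    [TopologicalSpace.SeparableSpace E] [Nontrivial E]
    (T : (Fin d → NNReal) → E →L[ℂ] E)
    (hT0 : T 0 = 1)
    (hTadd : ∀ s t : Fin d → NNReal, T (s + t) = T s * T t)
    (hweak : ∀ (φ : E →L[ℂ] ℂ) (ξ : E), Continuous fun t : Fin d → NNReal => φ (T t ξ))
    (hper : ∀ (t : Fin d → NNReal) (n : Fin d → ℕ),
      T (t + fun i => (n i : NNReal)) = T t) :
    Dense (Submodule.span ℂ (⋃ n : Fin d → ℤ,
        {ξ : E | ∀ t : Fin d → NNReal,
          T t ξ = Complex.exp (2 * Real.pi * Complex.I *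
            ∑ i, (n i : ℂ) * ((t i : ℝ) : ℂ)) • ξ}) : Set E) ∧
    ∃ (n : Fin d → ℤ) (ξ : E), ξ ≠ 0 ∧ ∀ t : Fin d → NNReal,
      T t ξ = Complex.exp (2 * Real.pi * Complex.I *
        ∑ i, (n i : ℂ) * ((t i : ℝ) : ℂ)) • ξ := by
  let S : UnitAddTorus (Fin d) → E →L[ℂ] E :=
    fun x => T (Function.surjInv nnrealToTorus_surjective x)
  have hST (t : Fin d → NNReal) : S (nnrealToTorus t) = T t :=
    eq_of_nnrealToTorus_eq hper (Function.surjInv_eq nnrealToTorus_surjective _)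
  have hzero : S 0 = 1 := by
    rw [← hT0, ← hST 0]
    congr 1
  have hadd (x y) : S (x + y) = S x * S y := by
    obtain ⟨s, rfl⟩ := nnrealToTorus_surjective x
    obtain ⟨t, rfl⟩ := nnrealToTorus_surjective y
    rw [← nnrealToTorus_add, hST, hST, hST, hTadd]
  have hS (φ : E →L[ℂ] ℂ) (ξ : E) : Continuous fun x => φ (S x ξ) :=
    continuous_of_comp_nnrealToTorus (by simpa only [hST] using hweak φ ξ)
  have hdense := UnitAddTorus.dense_span_eigenvectors hzero hadd hS
  have heig (n : Fin d → ℤ) (ξ : E) : (∀ x, S x ξ = UnitAddTorus.mFourier n x • ξ) ↔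
      ∀ t : Fin d → NNReal, T t ξ = Complex.exp (2 * Real.pi * Complex.I *
        ∑ i, (n i : ℂ) * ((t i : ℝ) : ℂ)) • ξ := by
    rw [nnrealToTorus_surjective.forall]
    simp only [hST, mFourier_nnrealToTorus]
  simp only [heig] at hdense
  refine ⟨hdense, ?_⟩
  by_contra! hne
  rw [Submodule.span_eq_bot.2, Submodule.bot_coe, dense_iff_closure_eq, closure_singleton] at hdense
  · obtain ⟨ξ, hξ⟩ := exists_ne (0 : E)
    exact hξ (hdense.symm ▸ Set.mem_univ ξ : ξ ∈ ({0} : Set E))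
  · intro ξ hξ
    obtain ⟨n, hn⟩ := Set.mem_iUnion.1 hξ
    by_contra h0
    obtain ⟨t, ht⟩ := hne n ξ h0
    exact ht (hn t)
end

section
/- Let V be a doubly commuting isometric representation of ℝ₊^d on a complex Hilbert space H, let z ∈ ℍ₊^d, and let ξ, η ∈ K_z. Then for all s, t ∈ ℝ₊^d, with p_i := max(t_i − s_i, 0) and q_i := max(s_i − t_i, 0), one has ⟨V_s ξ, V_t η⟩ = exp(−conj(⟨z,p⟩)) · exp(−⟨z,q⟩) · ⟨ξ, η⟩, where the inner product ⟨·,·⟩ on H is conjugate-linear in the first variable. -/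
open ContinuousLinearMap
open scoped InnerProductSpace

/-- For a doubly commuting representation, `V q` and `(V p)*` commute whenever `p` and `q`
have disjoint supports. -/
theorem commute_adjoint_of_disjoint_support {d : ℕ} {H : Type*} [NormedAddCommGroup H]
    [InnerProductSpace ℂ H] [CompleteSpace H] {V : (Fin d → NNReal) → H →L[ℂ] H}
    (hV0 : V 0 = 1) (hVadd : ∀ s t : Fin d → NNReal, V (s + t) = V s * V t)
    (hdc : ∀ i j : Fin d, i ≠ j → ∀ s t : NNReal,
      V (Pi.single i s) * adjoint (V (Pi.single j t))
        = adjoint (V (Pi.single j t)) * V (Pi.single i s))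
    {p q : Fin d → NNReal} (hpq : ∀ i, p i = 0 ∨ q i = 0) :
    Commute (V q) (adjoint (V p)) := by
  simp only [← star_eq_adjoint] at hdc ⊢
  have key : ∀ i j, Commute (V (Pi.single i (q i))) (star (V (Pi.single j (p j)))) := by
    intro i j
    by_cases hij : i = j
    · subst hij
      rcases hpq i with h | h <;> simp [h, hV0]
    · exact hdc i j hij _ _
  rw [← Finset.univ_sum_single q]
  refine Finset.sum_induction _ (fun x => Commute (V x) (star (V p))) ?_ (by simp [hV0]) ?_
  · intro a b ha hb
    rw [hVadd]
    exact ha.mul_left hb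
  · intro i _
    rw [← Finset.univ_sum_single p]
    refine Finset.sum_induction _ (fun y => Commute (V (Pi.single i (q i))) (star (V y))) ?_
      (by simp [hV0]) (fun j _ => key i j)
    intro a b ha hb
    rw [hVadd, star_mul]
    exact hb.mul_right ha

/-- inner products of vectors `V_s ξ, V_t η` with `ξ, η` in the joint eigenspace
`K_z = {ξ : V_t* ξ = e^{-⟨z,t⟩} ξ}`: with `p_i = max(t_i - s_i, 0)`, `q_i = max(s_i - t_i, 0)`,
`⟨V_s ξ, V_t η⟩ = exp(-conj⟨z,p⟩) exp(-⟨z,q⟩) ⟨ξ, η⟩`. -/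
theorem stmt_2 (d : ℕ) (hd : 1 ≤ d)
    (H : Type*) [NormedAddCommGroup H] [InnerProductSpace ℂ H] [CompleteSpace H]
    (V : (Fin d → NNReal) → H →L[ℂ] H)
    (hV0 : V 0 = 1)
    (hVadd : ∀ s t : Fin d → NNReal, V (s + t) = V s * V t)
    (hiso : ∀ (t : Fin d → NNReal) (x : H), ‖V t x‖ = ‖x‖)
    (hdc : ∀ i j : Fin d, i ≠ j → ∀ s t : NNReal,
      V (Pi.single i s) * adjoint (V (Pi.single j t))
        = adjoint (V (Pi.single j t)) * V (Pi.single i s))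
    (z : Fin d → ℂ) (hz : ∀ i, 0 < (z i).re)
    (ξ η : H)
    (hξ : ∀ t : Fin d → NNReal,
      adjoint (V t) ξ = Complex.exp (-∑ i, z i * ((t i : ℝ) : ℂ)) • ξ)
    (hη : ∀ t : Fin d → NNReal,
      adjoint (V t) η = Complex.exp (-∑ i, z i * ((t i : ℝ) : ℂ)) • η)
    (s t : Fin d → NNReal) :
    ⟪V s ξ, V t η⟫_ℂ
      = Complex.exp (-(starRingEnd ℂ) (∑ i, z i * (((t i - s i : NNReal) : ℝ) : ℂ)))
        * Complex.exp (-∑ i, z i * (((s i - t i : NNReal) : ℝ) : ℂ))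
        * ⟪ξ, η⟫_ℂ := by
  have hs : s = s ⊓ t + (s - t) := by
    ext i
    simp only [Pi.add_apply, Pi.inf_apply, Pi.sub_apply]
    rcases le_total (s i) (t i) with h | h <;> simp [h, tsub_eq_zero_of_le]
  have ht : t = s ⊓ t + (t - s) := by
    ext i
    simp only [Pi.add_apply, Pi.inf_apply, Pi.sub_apply]
    rcases le_total (s i) (t i) with h | h <;> simp [h, tsub_eq_zero_of_le]
  have hcomm : Commute (V (s - t)) (adjoint (V (t - s))) := by
    refine commute_adjoint_of_disjoint_support hV0 hVadd hdc fun i => ?_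
    rcases le_total (s i) (t i) with h | h
    · exact Or.inr (tsub_eq_zero_of_le h)
    · exact Or.inl (tsub_eq_zero_of_le h)
  have hinner : ∀ (r : Fin d → NNReal) (x y : H), ⟪V r x, V r y⟫_ℂ = ⟪x, y⟫_ℂ := fun r =>
    (LinearMap.norm_map_iff_inner_map_map (V r)).1 (hiso r)
  have hred : ⟪V s ξ, V t η⟫_ℂ = ⟪V (s - t) ξ, V (t - s) η⟫_ℂ := by
    have hsV : V s = V (s ⊓ t) * V (s - t) := by rw [← hVadd, ← hs]
    have htV : V t = V (s ⊓ t) * V (t - s) := by rw [← hVadd, ← ht]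
    rw [hsV, htV]
    exact hinner _ _ _
  have hswap : adjoint (V (t - s)) (V (s - t) ξ) = V (s - t) (adjoint (V (t - s)) ξ) :=
    (DFunLike.congr_fun hcomm.eq ξ).symm
  rw [hred, ← adjoint_inner_left, hswap, hξ, map_smul, inner_smul_left, ← adjoint_inner_right, hη,
    inner_smul_right, ← Complex.exp_conj, map_neg, mul_assoc]
  rfl
end

section
/- Let V be a strongly continuous, doubly commuting isometric representation of ℝ₊^d on a separable complex Hilbert space H. If K_{z₀} ≠ {0} for some z₀ ∈ ℍ₊^d, then K_z ≠ {0} for every z ∈ ℍ₊^d. -/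
open ContinuousLinearMap

open MeasureTheory Set in
/-- An eigenvector `ξ` of the adjoints of a one-parameter isometric semigroup `S` with eigenvalues
`exp (-a t)` yields, for each `w` with positive real part, one with eigenvalues `exp (-w t)`, namely
`ξ + (a - w) ∫ exp (-w u) S u ξ`. It remains an eigenvector of every operator commuting with `S`
of which `ξ` is an eigenvector. -/
theorem exists_adjoint_semigroup_eigenvector
    {H : Type*} [NormedAddCommGroup H] [InnerProductSpace ℂ H] [CompleteSpace H]
    (S : NNReal → H →L[ℂ] H)
    (hadd : ∀ s t, S (s + t) = S s * S t)
    (hiso : ∀ t x, ‖S t x‖ = ‖x‖)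
    (hcont : ∀ ξ : H, Continuous fun t => S t ξ)
    (a w : ℂ) (ha : 0 < a.re) (hw : 0 < w.re) (ξ : H) (hξ : ξ ≠ 0)
    (hS : ∀ t : NNReal, adjoint (S t) ξ = Complex.exp (-(a * ((t : ℝ) : ℂ))) • ξ) :
    ∃ η : H, η ≠ 0 ∧
      (∀ t : NNReal, adjoint (S t) η = Complex.exp (-(w * ((t : ℝ) : ℂ))) • η) ∧
      ∀ (T : H →L[ℂ] H) (c : ℂ), (∀ u, S u * T = T * S u) → T ξ = c • ξ → T η = c • η := by
  set f : ℝ → H := fun u => Complex.exp (-(w * (u : ℂ))) • S u.toNNReal ξ with hf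
  have hfc : Continuous f := by
    have := (hcont ξ).comp continuous_real_toNNReal
    exact (by fun_prop : Continuous fun u : ℝ => Complex.exp (-(w * (u : ℂ)))).smul this
  have hfi : IntegrableOn f (Ioi 0) := by
    have h1 : IntegrableOn (fun u : ℝ => Real.exp (-w.re * u) * ‖ξ‖) (Ioi 0) :=
      (exp_neg_integrableOn_Ioi 0 hw).mul_const _
    refine Integrable.mono' h1 hfc.aestronglyMeasurable (ae_of_all _ fun u => ?_)
    simp [hf, norm_smul, hiso, Complex.norm_exp]
  have hadj : ∀ t x, adjoint (S t) (S t x) = x := fun t x => by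
    have := (norm_map_iff_adjoint_comp_self (S t)).1 (hiso t)
    exact congrArg (fun L : H →L[ℂ] H => L x) this
  set J : H := ∫ u in Ioi 0, f u with hJ
  have hcomm : ∀ (T : H →L[ℂ] H), T J = ∫ u in Ioi 0, T (f u) := fun T =>
    (T.integral_comp_comm hfi).symm
  refine ⟨ξ + (a - w) • J, fun h0 => ?_, fun t => ?_, fun T c hT hTξ => ?_⟩
  · have hinner : inner ℂ ξ J = (w + starRingEnd ℂ a)⁻¹ * inner ℂ ξ ξ := by
      have h1 : inner ℂ ξ J = ∫ u in Ioi 0, inner ℂ ξ (f u) := (integral_inner hfi ξ).symm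
      have h2 : ∀ u ∈ Ioi (0 : ℝ), inner ℂ ξ (f u)
          = Complex.exp (-(w + starRingEnd ℂ a) * u) * inner ℂ ξ ξ := fun u hu => by
        rw [hf, inner_smul_right, ← adjoint_inner_left, hS, inner_smul_left, ← mul_assoc,
          ← Complex.exp_conj, ← Complex.exp_add, Real.coe_toNNReal u (le_of_lt hu)]
        simp only [map_neg, map_mul, Complex.conj_ofReal]
        ring_nf
      rw [h1, setIntegral_congr_fun measurableSet_Ioi h2, integral_mul_const,
        integral_exp_mul_complex_Ioi (by simp; linarith)]
      rw [Complex.ofReal_zero, mul_zero, Complex.exp_zero, neg_div_neg_eq, one_div]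
    have h3 : inner ℂ ξ (ξ + (a - w) • J) = 0 := by rw [h0, inner_zero_right]
    rw [inner_add_right, inner_smul_right, hinner] at h3
    have hne : w + starRingEnd ℂ a ≠ 0 := fun h => by
      have := congrArg Complex.re h
      simp at this; linarith
    have hξξ : inner ℂ ξ ξ ≠ 0 := inner_self_ne_zero.2 hξ
    have h4 : (a + starRingEnd ℂ a) * inner ℂ ξ ξ = 0 := by
      field_simp at h3
      linear_combination h3
    have h5 := (mul_eq_zero.1 h4).resolve_right hξξ
    have := congrArg Complex.re h5
    simp at this; linarith
  · have hsplit : J = (∫ u in (0 : ℝ)..t, f u) + ∫ u in Ioi (t : ℝ), f u :=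
      (intervalIntegral.integral_interval_add_Ioi hfi
        (hfi.mono_set (Ioi_subset_Ioi t.coe_nonneg))).symm
    have htail : ∫ u in Ioi (t : ℝ), f u = Complex.exp (-(w * ((t : ℝ) : ℂ))) • S t J := by
      have hshift := (measurePreserving_add_right volume (t : ℝ)).setIntegral_preimage_emb
        (measurableEmbedding_addRight (t : ℝ)) f (Ioi (t : ℝ))
      rw [preimage_add_const_Ioi, sub_self] at hshift
      rw [hcomm, ← integral_smul, ← hshift]
      refine setIntegral_congr_fun measurableSet_Ioi fun u hu => ?_
      simp only [hf]
      rw [Real.toNNReal_add (le_of_lt hu) t.coe_nonneg, Real.toNNReal_coe,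
        add_comm u.toNNReal, hadd, map_smul, smul_smul, ← Complex.exp_add, mul_apply_eq_comp, Complex.ofReal_add, add_comm (u : ℂ),
        mul_add, neg_add]
    have hhead : (a - w) • adjoint (S t) (∫ u in (0 : ℝ)..t, f u)
        = (Complex.exp (-(w * ((t : ℝ) : ℂ))) - Complex.exp (-(a * ((t : ℝ) : ℂ)))) • ξ := by
      rw [← ContinuousLinearMap.intervalIntegral_comp_comm _ (hfc.intervalIntegrable _ _)]
      have h1 : ∀ u ∈ uIcc (0 : ℝ) t, adjoint (S t) (f u)
          = Complex.exp (-(w * u) - a * (((t : ℝ) : ℂ) - u)) • ξ := fun u hu => by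
        rw [uIcc_of_le t.coe_nonneg] at hu
        have h2 : t = (t - u.toNNReal) + u.toNNReal :=
          (tsub_add_cancel_of_le (Real.toNNReal_le_iff_le_coe.2 hu.2)).symm
        have h3 : adjoint (S t) = adjoint (S (t - u.toNNReal)) * adjoint (S u.toNNReal) := by
          conv_lhs => rw [h2, add_comm, hadd]
          exact adjoint_comp _ _
        rw [h3, hf, map_smul, mul_apply_eq_comp, hadj, hS, smul_smul, ← Complex.exp_add,
          NNReal.coe_sub (Real.toNNReal_le_iff_le_coe.2 hu.2), Real.coe_toNNReal u hu.1]
        push_cast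
        ring_nf
      rw [intervalIntegral.integral_congr h1, intervalIntegral.integral_smul_const, smul_smul,
        ← intervalIntegral.integral_const_mul]
      congr 1
      have h4 : ∀ u ∈ uIcc (0 : ℝ) t, HasDerivAt
          (fun u : ℝ => Complex.exp (-(w * u) - a * (((t : ℝ) : ℂ) - u)))
          ((a - w) * Complex.exp (-(w * u) - a * (((t : ℝ) : ℂ) - u))) u := fun u _ => by
        have h5 : HasDerivAt (fun u : ℝ => (u : ℂ)) 1 u := Complex.ofRealCLM.hasDerivAt
        have h6 : HasDerivAt (fun u : ℝ => -(w * (u : ℂ)) - a * (((t : ℝ) : ℂ) - u)) (a - w) u :=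
          (((h5.const_mul w).neg).sub ((h5.const_sub ((t : ℝ) : ℂ)).const_mul a)).congr_deriv
            (by ring)
        exact h6.cexp.congr_deriv (mul_comm _ _)
      rw [intervalIntegral.integral_eq_sub_of_hasDerivAt h4
        (Continuous.intervalIntegrable (by fun_prop) _ _)]
      simp
    rw [map_add, map_smul, hS, hsplit, map_add, smul_add, hhead, ← hsplit, htail, map_smul, hadj]
    module
  · have hTJ : T J = c • J := by
      rw [hcomm, hJ, ← integral_smul]
      refine setIntegral_congr_fun measurableSet_Ioi fun u _ => ?_
      have := congrArg (fun L : H →L[ℂ] H => L ξ) (hT u.toNNReal)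
      simp only [mul_apply_eq_comp, hTξ, map_smul] at this
      simp only [hf, map_smul, ← this]
      rw [smul_comm]
    rw [map_add, map_smul, hTξ, hTJ, smul_add, smul_comm]


/-- for a strongly continuous, doubly commuting isometric representation of `ℝ₊^d`
on a separable Hilbert space, if `K_{z₀} ≠ 0` for some `z₀ ∈ ℍ₊^d`, then `K_z ≠ 0` for all
`z ∈ ℍ₊^d`, where `K_z = {ξ : V_t* ξ = e^{-⟨z,t⟩} ξ for all t}`. -/
theorem stmt_3 (d : ℕ) (hd : 1 ≤ d)
    (H : Type*) [NormedAddCommGroup H] [InnerProductSpace ℂ H] [CompleteSpace H]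
    [TopologicalSpace.SeparableSpace H]
    (V : (Fin d → NNReal) → H →L[ℂ] H)
    (hV0 : V 0 = 1)
    (hVadd : ∀ s t : Fin d → NNReal, V (s + t) = V s * V t)
    (hiso : ∀ (t : Fin d → NNReal) (x : H), ‖V t x‖ = ‖x‖)
    (hcont : ∀ ξ : H, Continuous fun t : Fin d → NNReal => V t ξ)
    (hdc : ∀ i j : Fin d, i ≠ j → ∀ s t : NNReal,
      V (Pi.single i s) * adjoint (V (Pi.single j t))
        = adjoint (V (Pi.single j t)) * V (Pi.single i s))
    (z₀ : Fin d → ℂ) (hz₀ : ∀ i, 0 < (z₀ i).re)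
    (hK₀ : ∃ ξ : H, ξ ≠ 0 ∧ ∀ t : Fin d → NNReal,
      adjoint (V t) ξ = Complex.exp (-∑ i, z₀ i * ((t i : ℝ) : ℂ)) • ξ)
    (z : Fin d → ℂ) (hz : ∀ i, 0 < (z i).re) :
    ∃ ξ : H, ξ ≠ 0 ∧ ∀ t : Fin d → NNReal,
      adjoint (V t) ξ = Complex.exp (-∑ i, z i * ((t i : ℝ) : ℂ)) • ξ := by
  obtain ⟨ξ₀, hξ₀, hξ₀'⟩ := hK₀
  have key : ∀ s : Finset (Fin d), ∃ ξ : H, ξ ≠ 0 ∧ ∀ (i : Fin d) (t : NNReal),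
      adjoint (V (Pi.single i t)) ξ
        = Complex.exp (-((if i ∈ s then z i else z₀ i) * ((t : ℝ) : ℂ))) • ξ := fun s => by
    induction s using Finset.induction_on with
    | empty =>
      refine ⟨ξ₀, hξ₀, fun i t => ?_⟩
      rw [hξ₀', Finset.sum_eq_single i (fun j _ hj => by simp [Pi.single_eq_of_ne hj])
        (fun h => absurd (Finset.mem_univ i) h)]
      simp
    | insert k s hk ih =>
      obtain ⟨ξ, hξ, hξ'⟩ := ih
      obtain ⟨η, hη, hηk, hηT⟩ := exists_adjoint_semigroup_eigenvector
        (fun t => V (Pi.single k t)) (fun s t => by rw [Pi.single_add, hVadd])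
        (fun t => hiso _) (fun x => (hcont x).comp
          (continuous_single (A := fun _ : Fin d => NNReal) k))
        (z₀ k) (z k) (hz₀ k) (hz k) ξ hξ (fun t => by simpa [hk] using hξ' k t)
      refine ⟨η, hη, fun i t => ?_⟩
      by_cases hik : i = k
      · subst hik
        simpa using hηk t
      · simpa [Finset.mem_insert, hik] using
          hηT _ _ (fun u => hdc k i (Ne.symm hik) u t) (hξ' i t)
  obtain ⟨ξ, hξ, hξ'⟩ := key Finset.univ
  refine ⟨ξ, hξ, fun t => ?_⟩
  have hsum : ∀ s : Finset (Fin d), adjoint (V (∑ i ∈ s, Pi.single i (t i))) ξ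
      = Complex.exp (-∑ i ∈ s, z i * ((t i : ℝ) : ℂ)) • ξ := fun s => by
    induction s using Finset.induction_on with
    | empty => simp [hV0, ← star_eq_adjoint]
    | insert k s hk ih =>
      have hmul : adjoint (V (Pi.single k (t k) + ∑ i ∈ s, Pi.single i (t i)))
          = adjoint (V (∑ i ∈ s, Pi.single i (t i))) * adjoint (V (Pi.single k (t k))) := by
        rw [hVadd]
        exact adjoint_comp _ _
      rw [Finset.sum_insert hk, Finset.sum_insert hk, hmul, mul_apply_eq_comp, hξ', map_smul, ih,
        smul_smul, ← Complex.exp_add]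
      simp [add_comm]
  simpa [Finset.univ_sum_single] using hsum Finset.univ
end

section
/- Let V be a strongly continuous, doubly commuting, strongly pure isometric representation of ℝ₊^d on a nonzero separable complex Hilbert space H. Then K_z ≠ {0} for every z ∈ ℍ₊^d. -/
open ContinuousLinearMap Filter Topology

open MeasureTheory Set ComplexConjugate

/-- A strongly continuous one-parameter semigroup of contractions. -/
structure IsContractionSemigroup {H : Type*} [NormedAddCommGroup H] [InnerProductSpace ℂ H]
    (T : NNReal → H →L[ℂ] H) : Prop where
  map_zero : T 0 = 1
  map_add : ∀ s t, T (s + t) = T s * T t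
  norm_le : ∀ t x, ‖T t x‖ ≤ ‖x‖
  continuous : ∀ x, Continuous fun t => T t x

/-- The Laplace transform of the orbit of `x` under `T`, evaluated at `w`. -/
noncomputable def orbitLaplace {H : Type*} [NormedAddCommGroup H] [InnerProductSpace ℂ H]
    (T : NNReal → H →L[ℂ] H) (w : ℂ) (x : H) : H :=
  ∫ t in Ioi (0 : ℝ), Complex.exp (-(w * t)) • T t.toNNReal x

namespace IsContractionSemigroup

variable {H : Type*} [NormedAddCommGroup H] [InnerProductSpace ℂ H]
  {T : NNReal → H →L[ℂ] H} {w : ℂ}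

theorem continuous_integrand (hT : IsContractionSemigroup T) (w : ℂ) (x : H) :
    Continuous fun t : ℝ => Complex.exp (-(w * t)) • T t.toNNReal x :=
  Continuous.smul (by fun_prop) ((hT.continuous x).comp continuous_real_toNNReal)

theorem norm_integrand_le (hT : IsContractionSemigroup T) (w : ℂ) (x : H) (t : ℝ) :
    ‖Complex.exp (-(w * t)) • T t.toNNReal x‖ ≤ Real.exp (-w.re * t) * ‖x‖ := by
  rw [norm_smul, Complex.norm_exp]
  gcongr
  · simp
  · exact hT.norm_le _ _

theorem integrableOn (hT : IsContractionSemigroup T) (hw : 0 < w.re) (x : H) :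
    IntegrableOn (fun t : ℝ => Complex.exp (-(w * t)) • T t.toNNReal x) (Ioi 0) := by
  refine Integrable.mono' ((integrableOn_exp_mul_Ioi (neg_lt_zero.2 hw) 0).mul_const ‖x‖)
    (hT.continuous_integrand w x).aestronglyMeasurable (ae_of_all _ fun t => ?_)
  exact hT.norm_integrand_le w x t

theorem norm_orbitLaplace_le (hT : IsContractionSemigroup T) (hw : 0 < w.re) (x : H) :
    ‖orbitLaplace T w x‖ ≤ (∫ t in Ioi (0 : ℝ), Real.exp (-w.re * t)) * ‖x‖ := by
  rw [← integral_mul_const]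
  exact norm_integral_le_of_norm_le
    ((integrableOn_exp_mul_Ioi (neg_lt_zero.2 hw) 0).mul_const ‖x‖)
    (ae_of_all _ fun t => hT.norm_integrand_le w x t)

/-- The resolvent of a contraction semigroup as a bounded operator. -/
noncomputable def resolvent (hT : IsContractionSemigroup T) (hw : 0 < w.re) : H →L[ℂ] H :=
  LinearMap.mkContinuous
    { toFun := orbitLaplace T w
      map_add' := fun x y => by
        simp only [orbitLaplace, _root_.map_add, smul_add]
        exact integral_add (hT.integrableOn hw x) (hT.integrableOn hw y)
      map_smul' := fun c x => by
        simp only [orbitLaplace, map_smul, RingHom.id_apply]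
        rw [← integral_smul]
        simp only [smul_comm c] }
    _ (hT.norm_orbitLaplace_le hw)

theorem resolvent_apply (hT : IsContractionSemigroup T) (hw : 0 < w.re) (x : H) :
    hT.resolvent hw x = orbitLaplace T w x := rfl

variable [CompleteSpace H]

theorem apply_orbitLaplace (hT : IsContractionSemigroup T) (hw : 0 < w.re) (x : H)
    {s : ℝ} (hs : 0 ≤ s) :
    T s.toNNReal (orbitLaplace T w x) = Complex.exp (w * s) •
      (orbitLaplace T w x - ∫ t in (0 : ℝ)..s, Complex.exp (-(w * t)) • T t.toNNReal x) := by
  have hi := hT.integrableOn hw x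
  have h1 : (∫ t in Ioi s, Complex.exp (-(w * t)) • T t.toNNReal x)
      = orbitLaplace T w x - ∫ t in (0 : ℝ)..s, Complex.exp (-(w * t)) • T t.toNNReal x := by
    rw [eq_sub_iff_add_eq', orbitLaplace]
    exact intervalIntegral.integral_interval_add_Ioi hi (hi.mono_set (Ioi_subset_Ioi hs))
  have h2 := (measurePreserving_add_right volume s).setIntegral_preimage_emb
    (measurableEmbedding_addRight s) (fun t : ℝ => Complex.exp (-(w * t)) • T t.toNNReal x) (Ioi s)
  have h3 : (fun t : ℝ => t + s) ⁻¹' Ioi s = Ioi 0 := by ext; simp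
  rw [← h1, ← h2, h3, orbitLaplace, ← integral_comp_comm _ hi, ← integral_smul]
  refine setIntegral_congr_fun measurableSet_Ioi fun t ht => ?_
  have ht' : 0 ≤ t := le_of_lt ht
  rw [add_comm t s, Real.toNNReal_add hs ht', hT.map_add, map_smul, smul_smul, ← Complex.exp_add]
  congr 2
  push_cast
  ring

theorem hasDerivWithinAt_orbitLaplace (hT : IsContractionSemigroup T) (hw : 0 < w.re) (x : H)
    {s : ℝ} (hs : 0 ≤ s) :
    HasDerivWithinAt (fun t : ℝ => T t.toNNReal (orbitLaplace T w x))
      (w • T s.toNNReal (orbitLaplace T w x) - T s.toNNReal x) (Ici s) s := by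
  have hI : HasDerivAt
      (fun u : ℝ => ∫ t in (0 : ℝ)..u, Complex.exp (-(w * t)) • T t.toNNReal x)
      (Complex.exp (-(w * s)) • T s.toNNReal x) s :=
    intervalIntegral.integral_hasDerivAt_right
      ((hT.continuous_integrand w x).intervalIntegrable _ _)
      (hT.continuous_integrand w x).stronglyMeasurable.stronglyMeasurableAtFilter
      (hT.continuous_integrand w x).continuousAt
  have hE : HasDerivAt (fun u : ℝ => Complex.exp (w * u)) (Complex.exp (w * s) * w) s := by
    have := ((Complex.ofRealCLM.hasDerivAt (x := s)).const_mul w).cexp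
    simpa using this
  have h := (hE.smul (hI.const_sub (orbitLaplace T w x))).hasDerivWithinAt (s := Ici s)
  refine (h.congr (fun u hu => hT.apply_orbitLaplace hw x (hs.trans hu))
    (hT.apply_orbitLaplace hw x hs)).congr_deriv ?_
  rw [hT.apply_orbitLaplace hw x hs, smul_neg, smul_smul, smul_smul, ← Complex.exp_add, add_comm,
    ← sub_eq_add_neg]
  simp [mul_comm]

theorem hasDerivWithinAt_norm_sq (hT : IsContractionSemigroup T) (hw : 0 < w.re) (x : H)
    {s : ℝ} (hs : 0 ≤ s) :
    HasDerivWithinAt (fun t : ℝ => ‖T t.toNNReal (orbitLaplace T w x)‖ ^ 2)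
      (2 * (w.re * ‖T s.toNNReal (orbitLaplace T w x)‖ ^ 2
        - (inner ℂ (T s.toNNReal (orbitLaplace T w x)) (T s.toNNReal x)).re)) (Ici s) s := by
  let _ := InnerProductSpace.complexToReal (G := H)
  refine (hT.hasDerivWithinAt_orbitLaplace hw x hs).norm_sq.congr_deriv ?_
  rw [real_inner_eq_re_inner ℂ, inner_sub_right, inner_smul_right, inner_self_eq_norm_sq_to_K]
  simp [← Complex.ofReal_pow]

/-- If `re ⟪R y, y⟫ = re w * ‖R y‖ ^ 2` for all `y`, where `R` is the resolvent at `w`, then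
orbits starting in the range of `R` have constant norm. -/
theorem norm_apply_orbitLaplace (hT : IsContractionSemigroup T) (hw : 0 < w.re)
    (h : ∀ y, (inner ℂ (orbitLaplace T w y) y).re = w.re * ‖orbitLaplace T w y‖ ^ 2)
    (x : H) (s : NNReal) : ‖T s (orbitLaplace T w x)‖ = ‖orbitLaplace T w x‖ := by
  have hcomm : ∀ t : NNReal, T t (orbitLaplace T w x) = orbitLaplace T w (T t x) := by
    intro t
    rw [orbitLaplace, ← integral_comp_comm _ (hT.integrableOn hw x), orbitLaplace]
    congr 1 with r
    rw [map_smul, ← mul_apply_eq_comp, ← mul_apply_eq_comp, ← hT.map_add, ← hT.map_add, add_comm]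
  have hd : ∀ r ∈ Ico (0 : ℝ) s, HasDerivWithinAt
      (fun t : ℝ => ‖T t.toNNReal (orbitLaplace T w x)‖ ^ 2) 0 (Ici r) r := by
    intro r hr
    refine (hT.hasDerivWithinAt_norm_sq hw x hr.1).congr_deriv ?_
    rw [hcomm, h]
    ring
  have hc : Continuous fun t : ℝ => ‖T t.toNNReal (orbitLaplace T w x)‖ ^ 2 :=
    (((hT.continuous _).comp continuous_real_toNNReal).norm).pow 2
  have := constant_of_has_deriv_right_zero hc.continuousOn hd s ⟨s.2, le_rfl⟩
  simp only [Real.toNNReal_coe, Real.toNNReal_zero, hT.map_zero, one_apply_eq_self] at this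
  exact (sq_eq_sq₀ (norm_nonneg _) (norm_nonneg _)).1 this

theorem re_inner_orbitLaplace_self (hT : IsContractionSemigroup T) (hw : 0 < w.re)
    (hiso : ∀ t x, ‖T t x‖ = ‖x‖) (x : H) :
    (inner ℂ (orbitLaplace T w x) x).re = w.re * ‖orbitLaplace T w x‖ ^ 2 := by
  have h1 := hT.hasDerivWithinAt_norm_sq hw x le_rfl
  simp only [hiso, Real.toNNReal_zero, hT.map_zero, one_apply_eq_self] at h1
  have h2 := (uniqueDiffOn_Ici (0 : ℝ) 0 self_mem_Ici).eq_deriv _ h1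
    (hasDerivWithinAt_const 0 (Ici 0) (‖orbitLaplace T w x‖ ^ 2))
  linarith

theorem eq_zero_of_orbitLaplace_eq_zero (hT : IsContractionSemigroup T) (hw : 0 < w.re) {x : H}
    (hx : orbitLaplace T w x = 0) : x = 0 := by
  have h1 := hT.hasDerivWithinAt_orbitLaplace hw x le_rfl
  simp only [hx, _root_.map_zero, smul_zero, Real.toNNReal_zero, hT.map_zero, one_apply_eq_self] at h1
  have h2 := (uniqueDiffOn_Ici (0 : ℝ) 0 self_mem_Ici).eq_deriv _ h1
    (hasDerivWithinAt_const (0 : ℝ) (Ici 0) (0 : H))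
  simpa using h2

/-- The adjoints of a strongly continuous semigroup of contractions form one as well. -/
theorem adjoint (hT : IsContractionSemigroup T) :
    IsContractionSemigroup fun t => adjoint (T t) := by
  have hadd : ∀ s t, ContinuousLinearMap.adjoint (T (s + t)) =
      ContinuousLinearMap.adjoint (T s) * ContinuousLinearMap.adjoint (T t) := by
    intro s t
    rw [add_comm, hT.map_add]
    exact adjoint_comp _ _
  have hnorm : ∀ t x, ‖ContinuousLinearMap.adjoint (T t) x‖ ≤ ‖x‖ := by
    intro t x
    refine (le_opNorm _ _).trans (mul_le_of_le_one_left (norm_nonneg x) ?_)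
    rw [LinearIsometryEquiv.norm_map]
    exact opNorm_le_bound _ zero_le_one fun y => by simpa using hT.norm_le t y
  refine ⟨?_, hadd, hnorm, fun x => ?_⟩
  · rw [hT.map_zero]
    exact star_one (H →L[ℂ] H)
  have hbound : ∀ s t : NNReal, s ≤ t → ‖ContinuousLinearMap.adjoint (T t) x
      - ContinuousLinearMap.adjoint (T s) x‖ ^ 2 ≤
        2 * ‖x‖ ^ 2 - 2 * (inner ℂ x (T (t - s) x)).re := by
    intro s t hst
    set y := ContinuousLinearMap.adjoint (T (t - s)) x with hy
    have h1 : ContinuousLinearMap.adjoint (T t) x - ContinuousLinearMap.adjoint (T s) x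
        = ContinuousLinearMap.adjoint (T s) (y - x) := by
      conv_lhs => rw [← add_tsub_cancel_of_le hst, hadd, mul_apply_eq_comp]
      rw [_root_.map_sub]
    have h2 : ‖y - x‖ ^ 2 = ‖y‖ ^ 2 - 2 * (inner ℂ x (T (t - s) x)).re + ‖x‖ ^ 2 := by
      rw [norm_sub_sq (𝕜 := ℂ), hy, adjoint_inner_left]
      rfl
    have h3 : ‖y‖ ^ 2 ≤ ‖x‖ ^ 2 := by gcongr; exact hnorm _ _
    rw [h1]
    calc _ ≤ ‖y - x‖ ^ 2 := by gcongr; exact hnorm _ _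
      _ ≤ _ := by linarith
  rw [continuous_iff_continuousAt]
  intro t
  rw [ContinuousAt, tendsto_iff_norm_sub_tendsto_zero]
  have hg : Continuous fun s : NNReal =>
      2 * ‖x‖ ^ 2 - 2 * (inner ℂ x (T ((s - t) + (t - s)) x)).re := by
    have : Continuous fun s : NNReal => T ((s - t) + (t - s)) x :=
      (hT.continuous x).comp (by fun_prop)
    exact continuous_const.sub (continuous_const.mul
      (Complex.continuous_re.comp (continuous_const.inner this)))
  have hg0 := hg.tendsto t
  simp only [tsub_self, add_zero, hT.map_zero, one_apply_eq_self, inner_self_eq_norm_sq_to_K]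
    at hg0
  have hsq : Tendsto (fun s : NNReal => ‖ContinuousLinearMap.adjoint (T s) x
      - ContinuousLinearMap.adjoint (T t) x‖ ^ 2) (𝓝 t) (𝓝 0) := by
    refine squeeze_zero (fun _ => sq_nonneg _) (fun s => ?_)
      (by simpa [← Complex.ofReal_pow] using hg0)
    · rcases le_total s t with h | h
      · rw [norm_sub_rev, tsub_eq_zero_of_le h, zero_add]
        exact hbound _ _ h
      · rw [tsub_eq_zero_of_le h, add_zero]
        exact hbound _ _ h
  simpa using hsq.sqrt

theorem adjoint_resolvent_apply (hT : IsContractionSemigroup T) (hw : 0 < w.re) (x : H) :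
    ContinuousLinearMap.adjoint (hT.resolvent hw) x =
      orbitLaplace (fun t => ContinuousLinearMap.adjoint (T t)) (conj w) x := by
  refine ext_inner_left ℂ fun y => ?_
  have hw' : 0 < (conj w).re := by simpa
  rw [adjoint_inner_right, resolvent_apply, ← inner_conj_symm, orbitLaplace,
    ← integral_inner (hT.integrableOn hw y), orbitLaplace,
    ← integral_inner (hT.adjoint.integrableOn hw' x), ← integral_conj]
  congr 1 with t
  rw [inner_smul_right, inner_smul_right, map_mul, inner_conj_symm, adjoint_inner_right,
    ← Complex.exp_conj]
  simp

/-- A strongly continuous semigroup of isometries whose adjoints tend strongly to zero has a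
common eigenvector of the adjoints for every exponential character of the half-line. -/
theorem exists_adjoint_eigenvector [Nontrivial H] (hT : IsContractionSemigroup T)
    (hiso : ∀ t x, ‖T t x‖ = ‖x‖)
    (hpure : ∀ x, Tendsto (fun t => ContinuousLinearMap.adjoint (T t) x) atTop (𝓝 0))
    (hw : 0 < w.re) :
    ∃ ξ : H, ξ ≠ 0 ∧ ∀ t : NNReal,
      ContinuousLinearMap.adjoint (T t) ξ = Complex.exp (-(w * (t : ℝ))) • ξ := by
  have hw' : 0 < (conj w).re := by simpa
  set R := hT.resolvent hw with hR
  set C : H →L[ℂ] H := ((2 * w.re : ℝ) : ℂ) • R - 1 with hC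
  have hnorm : ∀ (A : H →L[ℂ] H) (x : H), ‖(((2 * w.re : ℝ) : ℂ) • A - 1) x‖ ^ 2 =
      4 * w.re * (w.re * ‖A x‖ ^ 2 - (inner ℂ (A x) x).re) + ‖x‖ ^ 2 := by
    intro A x
    rw [sub_apply, smul_apply, one_apply_eq_self, norm_sub_sq (𝕜 := ℂ), inner_smul_left,
      norm_smul, Complex.conj_ofReal, Complex.norm_real, Real.norm_eq_abs, mul_pow, sq_abs]
    simp
    ring
  have hCC : ContinuousLinearMap.adjoint C * C = 1 := by
    refine (norm_map_iff_adjoint_comp_self C).1 fun x => ?_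
    rw [← sq_eq_sq₀ (norm_nonneg _) (norm_nonneg _), hC, hnorm, hR, resolvent_apply,
      hT.re_inner_orbitLaplace_self hw hiso]
    ring
  have hC' : ContinuousLinearMap.adjoint C =
      ((2 * w.re : ℝ) : ℂ) • ContinuousLinearMap.adjoint R - 1 := by
    rw [hC, map_sub, LinearIsometryEquiv.map_smulₛₗ, Complex.conj_ofReal]
    congr 1
    exact star_one (H →L[ℂ] H)
  have hker : ∃ ξ, ξ ≠ 0 ∧ ContinuousLinearMap.adjoint C ξ = 0 := by
    by_contra! hinj
    have hCC' : C * ContinuousLinearMap.adjoint C = 1 := by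
      ext x
      rw [← sub_eq_zero]
      by_contra hne
      refine hinj _ hne ?_
      rw [map_sub, mul_apply_eq_comp, ← mul_apply_eq_comp, hCC]
      simp
    have hiso' : ∀ x, ‖ContinuousLinearMap.adjoint C x‖ = ‖x‖ := by
      refine (norm_map_iff_adjoint_comp_self _).2 ?_
      rw [adjoint_adjoint]
      exact hCC'
    have hform : ∀ y, (inner ℂ (orbitLaplace (fun t => ContinuousLinearMap.adjoint (T t))
        (conj w) y) y).re = (conj w).re *
          ‖orbitLaplace (fun t => ContinuousLinearMap.adjoint (T t)) (conj w) y‖ ^ 2 := by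
      intro y
      have h1 := hnorm (ContinuousLinearMap.adjoint R) y
      rw [← hC', hiso', hR, adjoint_resolvent_apply] at h1
      have h2 : 4 * w.re ≠ 0 := by positivity
      have h3 := (mul_eq_zero.1 (left_eq_add.1 ((add_comm _ _).trans h1.symm).symm)).resolve_left h2
      rw [Complex.conj_re]
      linarith
    obtain ⟨x, hx⟩ := exists_ne (0 : H)
    refine hx (hT.adjoint.eq_zero_of_orbitLaplace_eq_zero hw' ?_)
    have h := (hpure (orbitLaplace (fun t => ContinuousLinearMap.adjoint (T t)) (conj w) x)).norm
    simp only [hT.adjoint.norm_apply_orbitLaplace hw' hform, norm_zero] at h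
    exact norm_eq_zero.1 (tendsto_nhds_unique tendsto_const_nhds h)
  obtain ⟨ξ, hξ, hξ0⟩ := hker
  refine ⟨ξ, hξ, fun t => ?_⟩
  rw [hC', sub_apply, smul_apply, one_apply_eq_self, sub_eq_zero, hR, adjoint_resolvent_apply]
    at hξ0
  have hd : ∀ r ∈ Ico (0 : ℝ) t, HasDerivWithinAt (fun s : ℝ => Complex.exp (w * s) •
      ContinuousLinearMap.adjoint (T s.toNNReal) ξ) 0 (Ici r) r := by
    intro r hr
    have hE : HasDerivAt (fun u : ℝ => Complex.exp (w * u)) (Complex.exp (w * r) * w) r := by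
      simpa using ((Complex.ofRealCLM.hasDerivAt (x := r)).const_mul w).cexp
    have h1 := (hT.adjoint.hasDerivWithinAt_orbitLaplace hw' ξ hr.1).const_smul
      ((2 * w.re : ℝ) : ℂ)
    simp only [smul_sub, smul_comm _ (conj w)] at h1
    have h2 : (fun s : ℝ => ((2 * w.re : ℝ) : ℂ) • ContinuousLinearMap.adjoint (T s.toNNReal)
        (orbitLaplace (fun t => ContinuousLinearMap.adjoint (T t)) (conj w) ξ)) =
        fun s : ℝ => ContinuousLinearMap.adjoint (T s.toNNReal) ξ := by
      ext s
      rw [← map_smul, hξ0]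
    rw [← map_smul, hξ0] at h1
    have h3 := hE.hasDerivWithinAt.smul (h1.congr_of_eventuallyEq
      (Eventually.of_forall fun s => (congrFun h2 s).symm) (congrFun h2 r).symm)
    refine h3.congr_deriv ?_
    have h4 : ((2 * w.re : ℝ) : ℂ) = w + conj w := by rw [Complex.add_conj]
    rw [h4]
    module
  have hc : Continuous fun s : ℝ => Complex.exp (w * s) •
      ContinuousLinearMap.adjoint (T s.toNNReal) ξ :=
    Continuous.smul (by fun_prop) ((hT.adjoint.continuous ξ).comp continuous_real_toNNReal)
  have h := constant_of_has_deriv_right_zero hc.continuousOn hd t ⟨t.2, le_rfl⟩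
  simp only [Real.toNNReal_coe, Real.toNNReal_zero, hT.adjoint.map_zero, one_apply_eq_self,
    Complex.ofReal_zero, mul_zero, Complex.exp_zero, one_smul] at h
  nth_rw 2 [← h]
  rw [smul_smul, ← Complex.exp_add]
  simp

end IsContractionSemigroup

/-- The joint eigenspace of the adjoints of the operators `T i t`, for `i ∈ S` and all `t`, with
eigenvalues `exp (-(z i * t))`. -/
noncomputable def jointEigenspace {ι H : Type*} [NormedAddCommGroup H] [InnerProductSpace ℂ H]
    [CompleteSpace H] (T : ι → NNReal → H →L[ℂ] H) (z : ι → ℂ) (S : Finset ι) : Submodule ℂ H :=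
  ⨅ i ∈ S, ⨅ t : NNReal,
    LinearMap.ker (adjoint (T i t) - Complex.exp (-(z i * (t : ℝ))) • (1 : H →L[ℂ] H)).toLinearMap

section JointEigenspace

variable {ι H : Type*} [NormedAddCommGroup H] [InnerProductSpace ℂ H] [CompleteSpace H]
  {T : ι → NNReal → H →L[ℂ] H} {z : ι → ℂ} {S : Finset ι}

theorem mem_jointEigenspace {x : H} : x ∈ jointEigenspace T z S ↔
    ∀ i ∈ S, ∀ t : NNReal, adjoint (T i t) x = Complex.exp (-(z i * (t : ℝ))) • x := by
  simp [jointEigenspace, Submodule.mem_iInf, sub_eq_zero]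

theorem isClosed_jointEigenspace : IsClosed (jointEigenspace T z S : Set H) := by
  simp only [jointEigenspace, Submodule.coe_iInf]
  exact isClosed_iInter fun i => isClosed_iInter fun _ => isClosed_iInter fun t =>
    ContinuousLinearMap.isClosed_ker _

theorem mapsTo_jointEigenspace {A : H →L[ℂ] H}
    (hA : ∀ i ∈ S, ∀ t, A * adjoint (T i t) = adjoint (T i t) * A) :
    ∀ x ∈ jointEigenspace T z S, A x ∈ jointEigenspace T z S := by
  intro x hx
  rw [mem_jointEigenspace] at hx ⊢
  intro i hi t
  rw [← mul_apply_eq_comp, ← hA i hi t, mul_apply_eq_comp, hx i hi t, map_smul]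

theorem jointEigenspace_ne_bot [Nontrivial H] (hT : ∀ i, IsContractionSemigroup (T i))
    (hiso : ∀ i t x, ‖T i t x‖ = ‖x‖)
    (hcomm : ∀ i j, i ≠ j → ∀ s t, T i s * T j t = T j t * T i s)
    (hdc : ∀ i j, i ≠ j → ∀ s t, T i s * adjoint (T j t) = adjoint (T j t) * T i s)
    (hpure : ∀ i x, Tendsto (fun t => adjoint (T i t) x) atTop (𝓝 0))
    (hz : ∀ i, 0 < (z i).re) (S : Finset ι) : jointEigenspace T z S ≠ ⊥ := by
  classical
  induction S using Finset.induction_on with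
  | empty => simp [jointEigenspace]
  | insert j S hj ih =>
    set M := jointEigenspace T z S with hM
    have hne : ∀ i ∈ S, j ≠ i := fun i hi h => hj (h ▸ hi)
    have hinv : ∀ t, ∀ x ∈ M, T j t x ∈ M := fun t =>
      mapsTo_jointEigenspace fun i hi s => hdc j i (hne i hi) t s
    have hinv' : ∀ t, ∀ x ∈ M, adjoint (T j t) x ∈ M := fun t =>
      mapsTo_jointEigenspace fun i hi s => by
        have h := congrArg adjoint (hcomm i j (hne i hi).symm s t)
        exact (adjoint_comp (T i s) (T j t)).symm.trans (h.trans (adjoint_comp (T j t) (T i s)))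
    have : CompleteSpace M := isClosed_jointEigenspace.completeSpace_coe
    have : Nontrivial M := Submodule.nontrivial_iff_ne_bot.2 ih
    let U : NNReal → M →L[ℂ] M := fun t => (T j t).restrict (hinv t)
    have hU : ∀ t (x : M), ((U t x : M) : H) = T j t x := fun _ _ => rfl
    have hU' : ∀ t (x : M), ((adjoint (U t) x : M) : H) = adjoint (T j t) x := by
      intro t x
      have h : (adjoint (T j t)).restrict (hinv' t) = adjoint (U t) := by
        rw [eq_adjoint_iff]
        intro a b
        exact adjoint_inner_left (T j t) (b : H) (a : H)
      rw [← h]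
      rfl
    have hUs : IsContractionSemigroup U :=
      { map_zero := by ext x; simp [hU, (hT j).map_zero]
        map_add := fun s t => by ext x; simp [hU, (hT j).map_add]
        norm_le := fun t x => (hT j).norm_le t x
        continuous := fun x => ((hT j).continuous x).subtype_mk _ }
    obtain ⟨ξ, hξ, hξe⟩ := hUs.exists_adjoint_eigenvector (fun t x => hiso j t x)
      (fun x => by
        rw [tendsto_subtype_rng]
        simpa only [hU', ZeroMemClass.coe_zero] using hpure j x) (hz j)
    rw [Submodule.ne_bot_iff]
    refine ⟨ξ, mem_jointEigenspace.2 fun i hi t => ?_, by simpa using hξ⟩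
    rcases Finset.mem_insert.1 hi with rfl | hi
    · rw [← hU', hξe]
      rfl
    · exact mem_jointEigenspace.1 ξ.2 i hi t

end JointEigenspace

/-- for a strongly continuous, doubly commuting, strongly pure isometric
representation of `ℝ₊^d` on a nonzero separable Hilbert space, `K_z ≠ 0` for every
`z ∈ ℍ₊^d`, where `K_z = {ξ : V_t* ξ = e^{-⟨z,t⟩} ξ for all t}`. -/
theorem stmt_4 (d : ℕ) (hd : 1 ≤ d)
    (H : Type*) [NormedAddCommGroup H] [InnerProductSpace ℂ H] [CompleteSpace H]
    [TopologicalSpace.SeparableSpace H] [Nontrivial H]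
    (V : (Fin d → NNReal) → H →L[ℂ] H)
    (hV0 : V 0 = 1)
    (hVadd : ∀ s t : Fin d → NNReal, V (s + t) = V s * V t)
    (hiso : ∀ (t : Fin d → NNReal) (x : H), ‖V t x‖ = ‖x‖)
    (hcont : ∀ ξ : H, Continuous fun t : Fin d → NNReal => V t ξ)
    (hdc : ∀ i j : Fin d, i ≠ j → ∀ s t : NNReal,
      V (Pi.single i s) * adjoint (V (Pi.single j t))
        = adjoint (V (Pi.single j t)) * V (Pi.single i s))
    (hpure : ∀ (i : Fin d) (ξ : H),
      Tendsto (fun t : NNReal => adjoint (V (Pi.single i t)) ξ) atTop (𝓝 0))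
    (z : Fin d → ℂ) (hz : ∀ i, 0 < (z i).re) :
    ∃ ξ : H, ξ ≠ 0 ∧ ∀ t : Fin d → NNReal,
      adjoint (V t) ξ = Complex.exp (-∑ i, z i * ((t i : ℝ) : ℂ)) • ξ := by
  let T : Fin d → NNReal → H →L[ℂ] H := fun i t => V (Pi.single i t)
  have hT : ∀ i, IsContractionSemigroup (T i) := fun i =>
    { map_zero := by simp [T, hV0]
      map_add := fun s t => by simp only [T, Pi.single_add, hVadd]
      norm_le := fun t x => (hiso _ x).le
      continuous := fun x => (hcont x).comp (_root_.continuous_single (A := fun _ => NNReal) i) }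
  have hcomm : ∀ i j, i ≠ j → ∀ s t, T i s * T j t = T j t * T i s := fun i j _ s t => by
    simp only [T, ← hVadd, add_comm]
  obtain ⟨ξ, hξ, hξ0⟩ := (Submodule.ne_bot_iff _).1
    (jointEigenspace_ne_bot hT (fun i t x => hiso _ x) hcomm hdc hpure hz Finset.univ)
  refine ⟨ξ, hξ0, fun t => ?_⟩
  have key : ∀ S : Finset (Fin d), adjoint (V (∑ i ∈ S, Pi.single i (t i))) ξ =
      Complex.exp (-∑ i ∈ S, z i * ((t i : ℝ) : ℂ)) • ξ := by
    intro S
    induction S using Finset.induction_on with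
    | empty =>
      rw [Finset.sum_empty, hV0, Finset.sum_empty, neg_zero, Complex.exp_zero, one_smul]
      exact congrArg (fun A : H →L[ℂ] H => A ξ) (star_one (H →L[ℂ] H))
    | insert j S hj ih =>
      have h : adjoint (V (Pi.single j (t j) + ∑ i ∈ S, Pi.single i (t i))) =
          adjoint (V (∑ i ∈ S, Pi.single i (t i))) * adjoint (V (Pi.single j (t j))) := by
        rw [hVadd]
        exact adjoint_comp _ _
      rw [Finset.sum_insert hj, h, mul_apply_eq_comp,
        mem_jointEigenspace.1 hξ j (Finset.mem_univ j) (t j), map_smul, ih, smul_smul,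
        ← Complex.exp_add, Finset.sum_insert hj, neg_add]
  simpa only [Finset.univ_sum_single] using key Finset.univ
end

section
/- Let V be a strongly continuous, doubly commuting, strongly pure isometric representation of ℝ₊^d on a separable complex Hilbert space H. Then L_{z₁} = L_{z₂} for all z₁, z₂ ∈ ℍ₊^d. -/
open ContinuousLinearMap Filter Topology

section OneParameter

open MeasureTheory Set
open scoped NNReal

variable {H : Type*} [NormedAddCommGroup H] [InnerProductSpace ℂ H]

/-- A strongly continuous one-parameter semigroup of isometries. -/
structure IsIsometricSemigroup (T : ℝ≥0 → H →L[ℂ] H) : Prop where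
  apply_zero : T 0 = 1
  apply_add : ∀ s t, T (s + t) = T s * T t
  norm_map : ∀ t x, ‖T t x‖ = ‖x‖
  continuous : ∀ x, Continuous fun t => T t x

/-- The function `t ↦ e^{-zt} T_t x`, extended to the real line by `e^{-zt} x` for `t < 0`. -/
noncomputable def dampedOrbit (T : ℝ≥0 → H →L[ℂ] H) (z : ℂ) (x : H) (t : ℝ) : H :=
  Complex.exp (-z * t) • T t.toNNReal x

/-- The resolvent `∫₀^∞ e^{-zt} T_t x dt`. -/
noncomputable def laplaceResolvent (T : ℝ≥0 → H →L[ℂ] H) (z : ℂ) (x : H) : H :=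
  ∫ t in Ioi (0 : ℝ), dampedOrbit T z x t

/-- The vector obtained from an eigenvector `x` of the adjoint semigroup with exponent `w`
by moving the exponent to `z`. -/
noncomputable def exponentShift (T : ℝ≥0 → H →L[ℂ] H) (w z : ℂ) (x : H) : H :=
  x + (w - z) • laplaceResolvent T z x

namespace IsIsometricSemigroup

variable {T : ℝ≥0 → H →L[ℂ] H} {z w : ℂ} {x : H}

theorem continuous_dampedOrbit (hT : IsIsometricSemigroup T)
    (z : ℂ) (x : H) : Continuous (dampedOrbit T z x) := by
  have h := (hT.continuous x).comp continuous_real_toNNReal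
  unfold dampedOrbit
  exact Continuous.smul (by fun_prop) h

theorem integrableOn_dampedOrbit (hT : IsIsometricSemigroup T)
    (hz : 0 < z.re) (x : H) (a : ℝ) :
    IntegrableOn (dampedOrbit T z x) (Ioi a) := by
  have h := (integrableOn_exp_mul_complex_Ioi (a := -z) (by simpa using hz) a).norm.mul_const ‖x‖
  refine h.mono' (hT.continuous_dampedOrbit z x).aestronglyMeasurable ?_
  refine Eventually.of_forall fun t => ?_
  simp [dampedOrbit, norm_smul, hT.norm_map]

theorem apply_dampedOrbit (hT : IsIsometricSemigroup T)
    (s : ℝ≥0) {t : ℝ} (ht : 0 ≤ t) :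
    T s (dampedOrbit T z x t) = Complex.exp (z * (s : ℝ)) • dampedOrbit T z x (t + s) := by
  have h1 : (t + s).toNNReal = s + t.toNNReal := by
    rw [Real.toNNReal_add ht s.coe_nonneg, Real.toNNReal_coe, add_comm]
  simp only [dampedOrbit, h1, hT.apply_add, map_smul, smul_smul, mul_apply_eq_comp, ← Complex.exp_add]
  congr 2
  push_cast
  ring

variable [CompleteSpace H]

theorem apply_laplaceResolvent (hT : IsIsometricSemigroup T)
    (hz : 0 < z.re) (x : H) (s : ℝ≥0) :
    T s (laplaceResolvent T z x) = Complex.exp (z * (s : ℝ)) •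
      (laplaceResolvent T z x - ∫ t in (0 : ℝ)..s, dampedOrbit T z x t) := by
  have h1 : laplaceResolvent T z x - ∫ t in (0 : ℝ)..s, dampedOrbit T z x t
      = ∫ t in Ioi (s : ℝ), dampedOrbit T z x t := by
    rw [laplaceResolvent, ← intervalIntegral.integral_interval_add_Ioi
      (hT.integrableOn_dampedOrbit hz x 0) (hT.integrableOn_dampedOrbit hz x s)]
    abel
  have h2 := (measurePreserving_add_right (volume : Measure ℝ) (s : ℝ)).setIntegral_preimage_emb
    (measurableEmbedding_addRight (s : ℝ)) (dampedOrbit T z x) (Ioi (s : ℝ))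
  rw [preimage_add_const_Ioi, sub_self] at h2
  rw [h1, ← h2, laplaceResolvent, ← (T s).integral_comp_comm (hT.integrableOn_dampedOrbit hz x 0),
    ← integral_smul]
  exact setIntegral_congr_fun measurableSet_Ioi fun t ht => hT.apply_dampedOrbit s (le_of_lt ht)

theorem adjoint_apply_self (hT : IsIsometricSemigroup T)
    (s : ℝ≥0) (x : H) : adjoint (T s) (T s x) = x := by
  have h := (norm_map_iff_adjoint_comp_self (T s)).1 (hT.norm_map s)
  exact DFunLike.congr_fun h x

theorem adjoint_apply_of_le (hT : IsIsometricSemigroup T)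
    {s t : ℝ≥0} (h : t ≤ s) (x : H) :
    adjoint (T s) (T t x) = adjoint (T (s - t)) x := by
  have h1 : T s = T t * T (s - t) := by rw [← hT.apply_add, add_tsub_cancel_of_le h]
  have h2 : adjoint (T s) = adjoint (T (s - t)) * adjoint (T t) := by
    rw [h1]; exact adjoint_comp _ _
  rw [h2, mul_apply_eq_comp, hT.adjoint_apply_self]

theorem smul_adjoint_integral_dampedOrbit (hT : IsIsometricSemigroup T)
    (s : ℝ≥0)
    (hx : ∀ s : ℝ≥0, adjoint (T s) x = Complex.exp (-(w * (s : ℝ))) • x) :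
    (w - z) • adjoint (T s) (∫ t in (0 : ℝ)..s, dampedOrbit T z x t)
      = (Complex.exp (-(z * (s : ℝ))) - Complex.exp (-(w * (s : ℝ)))) • x := by
  have h1 : adjoint (T s) (∫ t in (0 : ℝ)..s, dampedOrbit T z x t)
      = ∫ t in (0 : ℝ)..s, (Complex.exp (-(w * (s : ℝ))) * Complex.exp ((w - z) * t)) • x := by
    rw [← ContinuousLinearMap.intervalIntegral_comp_comm _
      ((hT.continuous_dampedOrbit z x).intervalIntegrable _ _)]
    refine intervalIntegral.integral_congr fun t ht => ?_
    rw [uIcc_of_le s.coe_nonneg] at ht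
    have hts : t.toNNReal ≤ s := Real.toNNReal_le_iff_le_coe.2 ht.2
    simp only [dampedOrbit, map_smul, hT.adjoint_apply_of_le hts, hx, smul_smul,
      ← Complex.exp_add, NNReal.coe_sub hts, Real.coe_toNNReal t ht.1]
    congr 2
    push_cast
    ring
  rw [h1, intervalIntegral.integral_smul_const, smul_smul,
    intervalIntegral.integral_const_mul]
  congr 1
  rcases eq_or_ne w z with rfl | hne
  · simp
  · rw [integral_exp_mul_complex (sub_ne_zero.2 hne)]
    have h2 : -(z * (s : ℝ)) = -(w * (s : ℝ)) + (w - z) * (s : ℝ) := by ring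
    rw [h2, Complex.exp_add]
    have := sub_ne_zero.2 hne
    field_simp
    simp

theorem adjoint_apply_exponentShift (hT : IsIsometricSemigroup T)
    (hz : 0 < z.re)
    (hx : ∀ s : ℝ≥0, adjoint (T s) x = Complex.exp (-(w * (s : ℝ))) • x) (s : ℝ≥0) :
    adjoint (T s) (exponentShift T w z x)
      = Complex.exp (-(z * (s : ℝ))) • exponentShift T w z x := by
  have h1 := congrArg (adjoint (T s)) (hT.apply_laplaceResolvent hz x s)
  rw [hT.adjoint_apply_self, map_smul, map_sub] at h1
  have h2 : Complex.exp (-(z * (s : ℝ))) • laplaceResolvent T z x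
      = adjoint (T s) (laplaceResolvent T z x)
        - adjoint (T s) (∫ t in (0 : ℝ)..s, dampedOrbit T z x t) := by
    conv_lhs => rw [h1]
    rw [smul_smul, ← Complex.exp_add, neg_add_cancel, Complex.exp_zero, one_smul]
  have h3 := hT.smul_adjoint_integral_dampedOrbit (z := z) s hx
  rw [exponentShift, map_add, map_smul, hx, smul_add, smul_comm, h2, smul_sub, h3]
  module

theorem apply_exponentShift_of_commute (hT : IsIsometricSemigroup T)
    (hz : 0 < z.re) (B : H →L[ℂ] H)
    (hB : ∀ t, T t * B = B * T t) {c : ℂ} (hx : B x = c • x) :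
    B (exponentShift T w z x) = c • exponentShift T w z x := by
  have h1 : B (laplaceResolvent T z x) = c • laplaceResolvent T z x := by
    rw [laplaceResolvent, ← B.integral_comp_comm (hT.integrableOn_dampedOrbit hz x 0),
      ← integral_smul]
    congr 1
    ext t
    have := DFunLike.congr_fun (hB t.toNNReal) x
    simp only [mul_apply_eq_comp, hx, map_smul] at this
    rw [dampedOrbit, map_smul, ← this, smul_comm]
  rw [exponentShift, map_add, map_smul, h1, hx, smul_add, smul_comm]

theorem mem_of_forall_apply_exponentShift_mem (hT : IsIsometricSemigroup T)
    (hw : 0 < w.re) (hz : 0 < z.re) (x : H)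
    (L : Submodule ℂ H) (hL : IsClosed (L : Set H))
    (h : ∀ t, T t (exponentShift T w z x) ∈ L) : x ∈ L := by
  have : CompleteSpace L := hL.completeSpace_coe
  suffices hG : laplaceResolvent T z x ∈ L by
    have h0 := h 0
    rw [hT.apply_zero, one_apply_eq_self, exponentShift] at h0
    exact (L.add_mem_iff_left (L.smul_mem _ hG)).1 h0
  rw [← L.orthogonal_orthogonal, Submodule.mem_orthogonal]
  intro y hy
  set G := laplaceResolvent T z x with hGdef
  let g : ℝ → H := fun t =>
    Complex.exp (-(w - z) * t) • (G - ∫ u in (0 : ℝ)..t, dampedOrbit T z x u)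
  have hgT : ∀ t : ℝ, 0 ≤ t → g t = Complex.exp (-w * t) • T t.toNNReal G := by
    intro t ht
    have h1 := hT.apply_laplaceResolvent hz x t.toNNReal
    rw [Real.coe_toNNReal t ht, ← hGdef] at h1
    rw [h1, smul_smul, ← Complex.exp_add]
    simp only [g]
    congr 2
    ring
  have hderiv : ∀ t : ℝ, 0 ≤ t → HasDerivAt g
      (-Complex.exp (-w * t) • T t.toNNReal (exponentShift T w z x)) t := by
    intro t ht
    have h1 := (hT.continuous_dampedOrbit z x).integral_hasStrictDerivAt 0 t
    have h2 : HasDerivAt (fun t : ℝ => Complex.exp (-(w - z) * t))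
        (Complex.exp (-(w - z) * t) * (-(w - z) * 1)) t :=
      (((hasDerivAt_id (t : ℂ)).const_mul (-(w - z))).cexp).comp_ofReal
    have h3 := h2.smul (h1.hasDerivAt.const_sub G)
    refine h3.congr_deriv ?_
    have h4 := hgT t ht
    simp only [g] at h4
    have h5 : Complex.exp (-(w - z) * t) • dampedOrbit T z x t
        = Complex.exp (-w * t) • T t.toNNReal x := by
      rw [dampedOrbit, smul_smul, ← Complex.exp_add]
      congr 2
      ring
    rw [smul_neg, h5, mul_comm (Complex.exp _), mul_smul, h4, exponentShift, map_add, map_smul, ← hGdef]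
    module
  have hconst : ∀ t : ℝ, 0 ≤ t → inner ℂ y (g t) = inner ℂ y (g 0) := by
    intro t ht
    have hd : ∀ u : ℝ, 0 ≤ u → HasDerivAt (fun u => inner ℂ y (g u)) 0 u := by
      intro u hu
      have h1 := (hasDerivAt_const u y).inner ℂ (hderiv u hu)
      refine h1.congr_deriv ?_
      rw [inner_zero_left, add_zero]
      exact (Submodule.mem_orthogonal' L y).1 hy _ (L.smul_mem _ (h _))
    exact constant_of_has_deriv_right_zero (a := 0) (b := t)
      (fun u hu => (hd u hu.1).continuousAt.continuousWithinAt)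
      (fun u hu => (hd u hu.1).hasDerivWithinAt) t ⟨ht, le_rfl⟩
  have hlim : Tendsto (fun t : ℝ => inner ℂ y (g t)) atTop (𝓝 0) := by
    have h1 : Tendsto (fun t : ℝ => ‖y‖ * (Real.exp (-w.re * t) * ‖G‖)) atTop (𝓝 0) := by
      have h2 : Tendsto (fun t : ℝ => Real.exp (-w.re * t)) atTop (𝓝 0) :=
        Real.tendsto_exp_atBot.comp (tendsto_id.const_mul_atTop_of_neg (by linarith))
      simpa using (h2.mul_const ‖G‖).const_mul ‖y‖
    refine squeeze_zero_norm' ?_ h1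
    filter_upwards [eventually_ge_atTop 0] with t ht
    refine (norm_inner_le_norm _ _).trans (le_of_eq ?_)
    rw [hgT t ht, norm_smul, hT.norm_map, Complex.norm_exp]
    simp
  have h0 : inner ℂ y (g 0) = 0 :=
    tendsto_nhds_unique (tendsto_const_nhds.congr'
      ((eventually_ge_atTop 0).mono fun t ht => (hconst t ht).symm)) hlim
  simpa [g] using h0

end IsIsometricSemigroup

theorem isIsometricSemigroup_single {ι : Type*} [DecidableEq ι]
    {V : (ι → ℝ≥0) → H →L[ℂ] H} (hV0 : V 0 = 1)
    (hVadd : ∀ s t, V (s + t) = V s * V t)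
    (hiso : ∀ t x, ‖V t x‖ = ‖x‖) (hcont : ∀ ξ, Continuous fun t => V t ξ) (i : ι) :
    IsIsometricSemigroup fun t : ℝ≥0 => V (Pi.single i t) where
  apply_zero := by rw [Pi.single_zero, hV0]
  apply_add s t := by rw [Pi.single_add, hVadd]
  norm_map t x := hiso _ x
  continuous x := (hcont x).comp (continuous_single (A := fun _ => ℝ≥0) i)

end OneParameter

section MultiParameter

open scoped NNReal

variable {ι H : Type*} [Fintype ι] [NormedAddCommGroup H] [InnerProductSpace ℂ H] [CompleteSpace H]

/-- `ξ` is a joint eigenvector of the adjoints `V_s*`, with eigenvalues `e^{-⟨z,s⟩}`. -/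
def IsAdjointEigenvector (V : (ι → ℝ≥0) → H →L[ℂ] H) (z : ι → ℂ) (ξ : H) : Prop :=
  ∀ s : ι → ℝ≥0, adjoint (V s) ξ = Complex.exp (-∑ i, z i * ((s i : ℝ) : ℂ)) • ξ

/-- The closed invariant subspace generated by the joint eigenvectors with exponent `z`. -/
noncomputable def eigenvectorHull (V : (ι → ℝ≥0) → H →L[ℂ] H) (z : ι → ℂ) : Submodule ℂ H :=
  (Submodule.span ℂ {x : H | ∃ (t : ι → ℝ≥0) (ξ : H),
    IsAdjointEigenvector V z ξ ∧ x = V t ξ}).topologicalClosure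

variable {V : (ι → ℝ≥0) → H →L[ℂ] H} {z w : ι → ℂ} {ξ : H}

theorem IsAdjointEigenvector.apply_mem (hξ : IsAdjointEigenvector V z ξ) (t : ι → ℝ≥0) :
    V t ξ ∈ eigenvectorHull V z :=
  Submodule.le_topologicalClosure _ (Submodule.subset_span ⟨t, ξ, hξ, rfl⟩)

variable [DecidableEq ι]

theorem IsAdjointEigenvector.adjoint_single (hξ : IsAdjointEigenvector V z ξ) (i : ι) (s : ℝ≥0) :
    adjoint (V (Pi.single i s)) ξ = Complex.exp (-(z i * (s : ℝ))) • ξ := by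
  rw [hξ, Finset.sum_eq_single i (fun j _ hj => by simp [Pi.single_eq_of_ne hj]) (by simp),
    Pi.single_eq_same]

theorem IsAdjointEigenvector.of_single (hV0 : V 0 = 1) (hVadd : ∀ s t, V (s + t) = V s * V t)
    (h : ∀ i (s : ℝ≥0), adjoint (V (Pi.single i s)) ξ = Complex.exp (-(z i * (s : ℝ))) • ξ) :
    IsAdjointEigenvector V z ξ := by
  intro s
  have key : ∀ S : Finset ι, adjoint (V (∑ i ∈ S, Pi.single i (s i))) ξ
      = Complex.exp (-∑ i ∈ S, z i * ((s i : ℝ) : ℂ)) • ξ := by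
    intro S
    induction S using Finset.induction_on with
    | empty =>
      have h1 : adjoint (1 : H →L[ℂ] H) = 1 := adjoint_id
      simp [hV0, h1]
    | insert a S ha ih =>
      have h1 : adjoint (V (Pi.single a (s a)) * V (∑ i ∈ S, Pi.single i (s i)))
          = adjoint (V (∑ i ∈ S, Pi.single i (s i))) * adjoint (V (Pi.single a (s a))) :=
        adjoint_comp _ _
      rw [Finset.sum_insert ha, Finset.sum_insert ha, hVadd, h1, mul_apply_eq_comp, h, map_smul, ih,
        smul_smul, ← Complex.exp_add, neg_add]
  simpa only [Finset.univ_sum_single] using key Finset.univ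

theorem eigenvectorHull_update_le (hV0 : V 0 = 1) (hVadd : ∀ s t, V (s + t) = V s * V t)
    (hiso : ∀ t x, ‖V t x‖ = ‖x‖) (hcont : ∀ ξ, Continuous fun t => V t ξ)
    (hdc : ∀ i j : ι, i ≠ j → ∀ s t : ℝ≥0,
      V (Pi.single i s) * adjoint (V (Pi.single j t))
        = adjoint (V (Pi.single j t)) * V (Pi.single i s))
    (i : ι) {c : ℂ} (hw : 0 < (w i).re) (hc : 0 < c.re) :
    eigenvectorHull V w ≤ eigenvectorHull V (Function.update w i c) := by
  have hT := isIsometricSemigroup_single hV0 hVadd hiso hcont i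
  refine Submodule.topologicalClosure_minimal _ (Submodule.span_le.2 ?_)
    (Submodule.isClosed_topologicalClosure _)
  rintro _ ⟨t, ξ, hξ, rfl⟩
  set η := exponentShift (fun t : ℝ≥0 => V (Pi.single i t)) (w i) c ξ
  have hηeig : IsAdjointEigenvector V (Function.update w i c) η := by
    refine .of_single hV0 hVadd fun j s => ?_
    rcases eq_or_ne j i with rfl | hj
    · rw [Function.update_self]
      exact hT.adjoint_apply_exponentShift hc (hξ.adjoint_single j) s
    · rw [Function.update_of_ne hj]
      exact hT.apply_exponentShift_of_commute hc _ (fun t => hdc i j hj.symm t s)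
        (hξ.adjoint_single j s)
  refine hT.mem_of_forall_apply_exponentShift_mem hw hc ξ
    ((eigenvectorHull V (Function.update w i c)).comap (V t).toLinearMap)
    ((Submodule.isClosed_topologicalClosure _).preimage (V t).continuous) fun s => ?_
  rw [Submodule.mem_comap, ContinuousLinearMap.coe_coe, ← mul_apply_eq_comp, ← hVadd]
  exact hηeig.apply_mem _

theorem eigenvectorHull_le (hV0 : V 0 = 1) (hVadd : ∀ s t, V (s + t) = V s * V t)
    (hiso : ∀ t x, ‖V t x‖ = ‖x‖) (hcont : ∀ ξ, Continuous fun t => V t ξ)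
    (hdc : ∀ i j : ι, i ≠ j → ∀ s t : ℝ≥0,
      V (Pi.single i s) * adjoint (V (Pi.single j t))
        = adjoint (V (Pi.single j t)) * V (Pi.single i s))
    (hw : ∀ i, 0 < (w i).re) (hz : ∀ i, 0 < (z i).re) :
    eigenvectorHull V w ≤ eigenvectorHull V z := by
  have key : ∀ S : Finset ι, eigenvectorHull V w ≤ eigenvectorHull V (S.piecewise z w) := by
    intro S
    induction S using Finset.induction_on with
    | empty => rw [Finset.piecewise_empty]
    | insert a S ha ih =>
      rw [Finset.piecewise_insert]
      refine ih.trans (eigenvectorHull_update_le hV0 hVadd hiso hcont hdc a ?_ (hz a))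
      rw [Finset.piecewise_eq_of_notMem _ _ _ ha]
      exact hw a
  simpa only [Finset.piecewise_univ] using key Finset.univ

end MultiParameter

/-- for a strongly continuous, doubly commuting, strongly pure isometric
representation of `ℝ₊^d` on a separable Hilbert space, `L_{z₁} = L_{z₂}` for all
`z₁, z₂ ∈ ℍ₊^d`, where `L_z` is the closed linear span of `{V_t ξ : t ∈ ℝ₊^d, ξ ∈ K_z}` and
`K_z = {ξ : V_t* ξ = e^{-⟨z,t⟩} ξ for all t}`. -/
theorem stmt_5 (d : ℕ) (hd : 1 ≤ d)
    (H : Type*) [NormedAddCommGroup H] [InnerProductSpace ℂ H] [CompleteSpace H]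
    [TopologicalSpace.SeparableSpace H]
    (V : (Fin d → NNReal) → H →L[ℂ] H)
    (hV0 : V 0 = 1)
    (hVadd : ∀ s t : Fin d → NNReal, V (s + t) = V s * V t)
    (hiso : ∀ (t : Fin d → NNReal) (x : H), ‖V t x‖ = ‖x‖)
    (hcont : ∀ ξ : H, Continuous fun t : Fin d → NNReal => V t ξ)
    (hdc : ∀ i j : Fin d, i ≠ j → ∀ s t : NNReal,
      V (Pi.single i s) * adjoint (V (Pi.single j t))
        = adjoint (V (Pi.single j t)) * V (Pi.single i s))
    (hpure : ∀ (i : Fin d) (ξ : H),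
      Tendsto (fun t : NNReal => adjoint (V (Pi.single i t)) ξ) atTop (𝓝 0))
    (z₁ z₂ : Fin d → ℂ) (hz₁ : ∀ i, 0 < (z₁ i).re) (hz₂ : ∀ i, 0 < (z₂ i).re) :
    closure (Submodule.span ℂ
        {x : H | ∃ (t : Fin d → NNReal) (ξ : H),
          (∀ s : Fin d → NNReal,
            adjoint (V s) ξ = Complex.exp (-∑ i, z₁ i * ((s i : ℝ) : ℂ)) • ξ)
          ∧ x = V t ξ} : Set H)
      = closure (Submodule.span ℂ
        {x : H | ∃ (t : Fin d → NNReal) (ξ : H),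
          (∀ s : Fin d → NNReal,
            adjoint (V s) ξ = Complex.exp (-∑ i, z₂ i * ((s i : ℝ) : ℂ)) • ξ)
          ∧ x = V t ξ} : Set H) := by
  exact congrArg (fun L : Submodule ℂ H => (L : Set H)) (le_antisymm
    (eigenvectorHull_le hV0 hVadd hiso hcont hdc hz₁ hz₂)
    (eigenvectorHull_le hV0 hVadd hiso hcont hdc hz₂ hz₁))
end

section
/- Let V be a strongly continuous, doubly commuting, strongly pure isometric representation of ℝ₊^d on a separable complex Hilbert space H. Then L_z = H for every z ∈ ℍ₊^d, i.e. the set {V_t ξ : t ∈ ℝ₊^d, ξ ∈ K_z} is total in H. -/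
open ContinuousLinearMap Filter Topology MeasureTheory Set
open scoped ComplexConjugate NNReal InnerProductSpace

/-- A strongly continuous one-parameter semigroup of contractions on a Hilbert space. -/
structure ContractionSemigroup (H : Type*) [NormedAddCommGroup H] [InnerProductSpace ℂ H] where
  /-- The operator at time `t`. -/
  op : ℝ≥0 → H →L[ℂ] H
  op_zero : op 0 = 1
  op_add : ∀ s t, op (s + t) = op s * op t
  norm_op_apply_le : ∀ t x, ‖op t x‖ ≤ ‖x‖
  continuous_op : ∀ x, Continuous fun t => op t x

theorem setIntegral_Ioi_comp_add_right {E : Type*} [NormedAddCommGroup E] [NormedSpace ℝ E]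
    (f : ℝ → E) (s : ℝ) : ∫ t in Ioi (0 : ℝ), f (t + s) = ∫ t in Ioi s, f t := by
  have h := (measurePreserving_add_right volume s).setIntegral_preimage_emb
    (measurableEmbedding_addRight s) f (Ioi s)
  simpa using h

theorem hasDerivAt_exp_mul_ofReal (z : ℂ) (s : ℝ) :
    HasDerivAt (fun s : ℝ => Complex.exp (z * s)) (z * Complex.exp (z * s)) s := by
  have h := ((hasDerivAt_id (s : ℂ)).const_mul z).cexp.comp_ofReal
  simpa [mul_comm] using h

theorem hasDerivAt_exp_smul_add_integral {E : Type*} [NormedAddCommGroup E] [NormedSpace ℂ E]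
    [CompleteSpace E] (z : ℂ) (c : E) {g : ℝ → E} (hg : Continuous g) (s : ℝ) :
    HasDerivAt (fun s : ℝ => Complex.exp (z * s) • (c + ∫ t in (0 : ℝ)..s, g t))
      (z • (Complex.exp (z * s) • (c + ∫ t in (0 : ℝ)..s, g t)) + Complex.exp (z * s) • g s) s := by
  have h := (hasDerivAt_exp_mul_ofReal z s).smul
    ((hg.integral_hasStrictDerivAt 0 s).hasDerivAt.const_add c)
  refine h.congr_deriv ?_
  rw [mul_smul, add_comm]

theorem inner_self_eq_ofReal_norm_sq {H : Type*} [NormedAddCommGroup H] [InnerProductSpace ℂ H]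
    (x : H) : ⟪x, x⟫_ℂ = ((‖x‖ ^ 2 : ℝ) : ℂ) := by
  rw [inner_self_eq_norm_sq_to_K]
  push_cast
  rfl

namespace ContractionSemigroup

variable {H : Type*} [NormedAddCommGroup H] [InnerProductSpace ℂ H]

/-- The orbit of `x` multiplied by `exp (-z t)`, extended to all real times. -/
noncomputable def dampedOrbit (S : ContractionSemigroup H) (z : ℂ) (x : H) (t : ℝ) : H :=
  Complex.exp (-z * t) • S.op t.toNNReal x

theorem continuous_orbit (S : ContractionSemigroup H) (x : H) :
    Continuous fun t : ℝ => S.op t.toNNReal x :=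
  (S.continuous_op x).comp continuous_real_toNNReal

theorem continuous_dampedOrbit (S : ContractionSemigroup H) (z : ℂ) (x : H) :
    Continuous (S.dampedOrbit z x) := by
  have h := S.continuous_orbit x
  unfold dampedOrbit
  fun_prop

theorem norm_dampedOrbit_le (S : ContractionSemigroup H) (z : ℂ) (x : H) (t : ℝ) :
    ‖S.dampedOrbit z x t‖ ≤ ‖Complex.exp (-z * t)‖ * ‖x‖ := by
  rw [dampedOrbit, norm_smul]
  gcongr
  exact S.norm_op_apply_le _ x

theorem integrableOn_dampedOrbit (S : ContractionSemigroup H) {z : ℂ} (hz : 0 < z.re) (x : H) :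
    IntegrableOn (S.dampedOrbit z x) (Ioi 0) := by
  have h := (integrableOn_exp_mul_complex_Ioi (a := -z) (by simpa) 0).norm.mul_const ‖x‖
  exact h.mono' (S.continuous_dampedOrbit z x).aestronglyMeasurable
    (Eventually.of_forall (S.norm_dampedOrbit_le z x))

theorem exp_smul_dampedOrbit (S : ContractionSemigroup H) (z : ℂ) (x : H) (t : ℝ) :
    Complex.exp (z * t) • S.dampedOrbit z x t = S.op t.toNNReal x := by
  rw [dampedOrbit, smul_smul, ← Complex.exp_add]
  simp

theorem op_toNNReal_add (S : ContractionSemigroup H) {s t : ℝ} (hs : 0 ≤ s) (ht : 0 ≤ t) (x : H) :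
    S.op (s + t).toNNReal x = S.op s.toNNReal (S.op t.toNNReal x) := by
  rw [Real.toNNReal_add hs ht, S.op_add]; rfl

theorem op_dampedOrbit (S : ContractionSemigroup H) (z : ℂ) (x : H) {s t : ℝ} (hs : 0 ≤ s)
    (ht : 0 ≤ t) :
    S.op s.toNNReal (S.dampedOrbit z x t) = Complex.exp (z * s) • S.dampedOrbit z x (t + s) := by
  rw [dampedOrbit, dampedOrbit, map_smul, smul_smul, ← Complex.exp_add, add_comm t s,
    S.op_toNNReal_add hs ht]
  congr 2
  push_cast
  ring

/-- The Laplace transform `x ↦ ∫₀^∞ exp (-z t) T_t x dt`. -/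
noncomputable def laplace (S : ContractionSemigroup H) (z : ℂ) (hz : 0 < z.re) : H →L[ℂ] H :=
  LinearMap.mkContinuous
    { toFun := fun x => ∫ t in Ioi (0 : ℝ), S.dampedOrbit z x t
      map_add' := fun x y => by
        rw [← integral_add (S.integrableOn_dampedOrbit hz x) (S.integrableOn_dampedOrbit hz y)]
        simp [dampedOrbit]
      map_smul' := fun c x => by
        rw [RingHom.id_apply, ← integral_smul]
        simp [dampedOrbit, smul_comm c] }
    (∫ t in Ioi (0 : ℝ), ‖Complex.exp (-z * t)‖) fun x => by
      have h := (integrableOn_exp_mul_complex_Ioi (a := -z) (by simpa) 0).norm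
      change ‖∫ t in Ioi (0 : ℝ), S.dampedOrbit z x t‖ ≤ _
      rw [← integral_mul_const]
      exact norm_integral_le_of_norm_le (h.mul_const ‖x‖)
        (Eventually.of_forall (S.norm_dampedOrbit_le z x))

theorem laplace_apply (S : ContractionSemigroup H) {z : ℂ} (hz : 0 < z.re) (x : H) :
    S.laplace z hz x = ∫ t in Ioi (0 : ℝ), S.dampedOrbit z x t := rfl

variable [CompleteSpace H]

theorem norm_adjoint_op_apply_le (S : ContractionSemigroup H) (t : ℝ≥0) (x : H) :
    ‖adjoint (S.op t) x‖ ≤ ‖x‖ := by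
  have h : ‖S.op t‖ ≤ 1 := (S.op t).opNorm_le_bound zero_le_one (by simpa using S.norm_op_apply_le t)
  refine (le_opNorm _ _).trans ?_
  rw [LinearIsometryEquiv.norm_map]
  exact mul_le_of_le_one_left (norm_nonneg x) h

theorem adjoint_op_add (S : ContractionSemigroup H) (s t : ℝ≥0) :
    adjoint (S.op (s + t)) = adjoint (S.op s) * adjoint (S.op t) := by
  rw [add_comm, S.op_add]
  exact adjoint_comp _ _

theorem norm_adjoint_op_sub_sq_le (S : ContractionSemigroup H) (x : H) (s t : ℝ≥0) :
    ‖adjoint (S.op s) x - adjoint (S.op t) x‖ ^ 2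
      ≤ 2 * (‖x‖ ^ 2 - RCLike.re ⟪S.op (nndist s t) x, x⟫_ℂ) := by
  wlog hst : s ≤ t generalizing s t
  · rw [norm_sub_rev, nndist_comm]
    exact this t s (le_of_not_ge hst)
  obtain ⟨h, rfl⟩ := exists_add_of_le hst
  have hd : nndist s (s + h) = h := by
    rw [NNReal.nndist_eq, add_tsub_cancel_left, tsub_eq_zero_of_le hst, max_eq_right zero_le]
  rw [hd, S.adjoint_op_add]
  change ‖adjoint (S.op s) x - adjoint (S.op s) (adjoint (S.op h) x)‖ ^ 2 ≤ _
  rw [← map_sub]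
  have h1 := S.norm_adjoint_op_apply_le s (x - adjoint (S.op h) x)
  have h2 := S.norm_adjoint_op_apply_le h x
  have h3 := norm_sub_sq (𝕜 := ℂ) x (adjoint (S.op h) x)
  rw [adjoint_inner_right] at h3
  nlinarith [norm_nonneg x, norm_nonneg (adjoint (S.op h) x),
    norm_nonneg (adjoint (S.op s) (x - adjoint (S.op h) x))]

theorem continuous_adjoint_op (S : ContractionSemigroup H) (x : H) :
    Continuous fun t => adjoint (S.op t) x := by
  rw [continuous_iff_continuousAt]
  intro t
  rw [ContinuousAt, tendsto_iff_norm_sub_tendsto_zero]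
  have hlim : Tendsto (fun s => 2 * (‖x‖ ^ 2 - RCLike.re ⟪S.op (nndist s t) x, x⟫_ℂ)) (𝓝 t) (𝓝 0) := by
    have hc : Continuous fun s => 2 * (‖x‖ ^ 2 - RCLike.re ⟪S.op (nndist s t) x, x⟫_ℂ) := by
      have := (S.continuous_op x).comp (continuous_id.nndist (continuous_const (y := t)))
      exact continuous_const.mul (continuous_const.sub
        (RCLike.continuous_re.comp (this.inner continuous_const)))
    have := hc.tendsto t
    simpa [S.op_zero, inner_self_eq_norm_sq_to_K, ← Complex.ofReal_pow] using this
  have hsq := squeeze_zero (fun s => sq_nonneg _)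
    (fun s => S.norm_adjoint_op_sub_sq_le x s t) hlim
  simpa using hsq.sqrt

/-- The adjoint semigroup. -/
noncomputable def adj (S : ContractionSemigroup H) : ContractionSemigroup H where
  op t := adjoint (S.op t)
  op_zero := by
    rw [S.op_zero]
    exact star_one (H →L[ℂ] H)
  op_add := S.adjoint_op_add
  norm_op_apply_le := S.norm_adjoint_op_apply_le
  continuous_op := S.continuous_adjoint_op

theorem adjoint_laplace (S : ContractionSemigroup H) {z : ℂ} (hz : 0 < z.re) :
    adjoint (S.laplace z hz) = S.adj.laplace (conj z) (by simpa) := by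
  symm
  rw [eq_adjoint_iff]
  intro x y
  have hz' : 0 < (conj z).re := by simpa
  rw [laplace_apply, laplace_apply, ← integral_inner (S.integrableOn_dampedOrbit hz y),
    ← inner_conj_symm, ← integral_inner (S.adj.integrableOn_dampedOrbit hz' x), ← integral_conj]
  congr 1 with t
  rw [inner_conj_symm, dampedOrbit, dampedOrbit, inner_smul_left, inner_smul_right]
  change _ * ⟪adjoint (S.op _) x, y⟫_ℂ = _
  rw [adjoint_inner_left, ← Complex.exp_conj]
  simp

theorem commute_laplace (S : ContractionSemigroup H) {z : ℂ} (hz : 0 < z.re) {A : H →L[ℂ] H}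
    (hA : ∀ t, Commute A (S.op t)) : Commute A (S.laplace z hz) := by
  ext x
  change A (S.laplace z hz x) = S.laplace z hz (A x)
  rw [laplace_apply, laplace_apply, ← A.integral_comp_comm (S.integrableOn_dampedOrbit hz x)]
  congr 1 with t
  rw [dampedOrbit, dampedOrbit, map_smul]
  congr 1
  exact DFunLike.congr_fun (hA _).eq x

theorem op_laplace_apply (S : ContractionSemigroup H) {z : ℂ} (hz : 0 < z.re) (x : H) {s : ℝ}
    (hs : 0 ≤ s) : S.op s.toNNReal (S.laplace z hz x) =
      Complex.exp (z * s) • (S.laplace z hz x + ∫ t in (0 : ℝ)..s, -S.dampedOrbit z x t) := by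
  have hint := S.integrableOn_dampedOrbit hz x
  rw [intervalIntegral.integral_neg, ← sub_eq_add_neg, laplace_apply,
    ← ContinuousLinearMap.integral_comp_comm _ hint,
    setIntegral_congr_fun measurableSet_Ioi
      (fun t ht => S.op_dampedOrbit z x hs (le_of_lt ht)), integral_smul,
    setIntegral_Ioi_comp_add_right (S.dampedOrbit z x),
    ← intervalIntegral.integral_interval_add_Ioi hint (hint.mono_set (Ioi_subset_Ioi hs)),
    add_sub_cancel_left]

theorem adjoint_op_op_apply (S : ContractionSemigroup H) (hiso : ∀ t x, ‖S.op t x‖ = ‖x‖)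
    (t : ℝ≥0) (x : H) : adjoint (S.op t) (S.op t x) = x :=
  DFunLike.congr_fun ((norm_map_iff_adjoint_comp_self (S.op t)).1 (hiso t)) x

theorem adjoint_op_laplace_apply (S : ContractionSemigroup H) (hiso : ∀ t x, ‖S.op t x‖ = ‖x‖)
    {z : ℂ} (hz : 0 < z.re) (x : H) {s : ℝ} (hs : 0 ≤ s) :
    S.adj.op s.toNNReal (S.laplace z hz x) =
      Complex.exp (-z * s) • (S.laplace z hz x + ∫ t in (0 : ℝ)..s, S.adj.dampedOrbit (-z) x t) := by
  have hint := S.integrableOn_dampedOrbit hz x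
  have hcont : Continuous fun t => S.adj.op s.toNNReal (S.dampedOrbit z x t) :=
    (S.adj.op _).continuous.comp (S.continuous_dampedOrbit z x)
  have hint' : IntegrableOn (fun t => S.adj.op s.toNNReal (S.dampedOrbit z x t)) (Ioi 0) :=
    (S.adj.op _).integrable_comp hint
  have h1 : ∫ t in (0 : ℝ)..s, S.adj.op s.toNNReal (S.dampedOrbit z x t) =
      Complex.exp (-z * s) • ∫ t in (0 : ℝ)..s, S.adj.dampedOrbit (-z) x t := by
    have hsub := intervalIntegral.integral_comp_sub_left
      (a := 0) (b := s) (S.adj.dampedOrbit (-z) x) s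
    rw [sub_self, sub_zero] at hsub
    rw [← hsub, ← intervalIntegral.integral_smul]
    refine intervalIntegral.integral_congr fun t ht => ?_
    rw [uIcc_of_le hs] at ht
    have hop := S.adj.op_toNNReal_add (sub_nonneg.2 ht.2) ht.1 (S.op t.toNNReal x)
    rw [sub_add_cancel] at hop
    simp only [dampedOrbit, map_smul, hop, smul_smul, ← Complex.exp_add]
    rw [show S.adj.op t.toNNReal (S.op t.toNNReal x) = x from S.adjoint_op_op_apply hiso _ x]
    congr 2
    push_cast
    ring
  have h2 : ∫ t in Ioi s, S.adj.op s.toNNReal (S.dampedOrbit z x t) =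
      Complex.exp (-z * s) • S.laplace z hz x := by
    rw [← setIntegral_Ioi_comp_add_right, laplace_apply, ← integral_smul]
    refine setIntegral_congr_fun measurableSet_Ioi fun t ht => ?_
    have hop := S.op_dampedOrbit z x hs (le_of_lt ht)
    have hshift : S.dampedOrbit z x (t + s) =
        Complex.exp (-z * s) • S.op s.toNNReal (S.dampedOrbit z x t) := by
      rw [hop, smul_smul, ← Complex.exp_add]
      simp
    simp only [hshift, map_smul]
    congr 1
    exact S.adjoint_op_op_apply hiso _ _
  rw [laplace_apply, ← ContinuousLinearMap.integral_comp_comm _ hint,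
    ← intervalIntegral.integral_interval_add_Ioi hint' (hint'.mono_set (Ioi_subset_Ioi hs)),
    h1, h2, ← laplace_apply S hz, ← smul_add, add_comm]

theorem hasDerivWithinAt_op_laplace (S : ContractionSemigroup H) {z : ℂ} (hz : 0 < z.re) (x : H)
    {s : ℝ} (hs : 0 ≤ s) :
    HasDerivWithinAt (fun t : ℝ => S.op t.toNNReal (S.laplace z hz x))
      (z • S.op s.toNNReal (S.laplace z hz x) - S.op s.toNNReal x) (Ici s) s := by
  have h := (hasDerivAt_exp_smul_add_integral z (S.laplace z hz x)
    (S.continuous_dampedOrbit z x).fun_neg s).hasDerivWithinAt (s := Ici s)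
  refine (h.congr (fun t ht => S.op_laplace_apply hz x (hs.trans ht))
    (S.op_laplace_apply hz x hs)).congr_deriv ?_
  rw [← S.op_laplace_apply hz x hs, smul_neg, S.exp_smul_dampedOrbit, sub_eq_add_neg]

theorem hasDerivWithinAt_adjoint_op_laplace (S : ContractionSemigroup H)
    (hiso : ∀ t x, ‖S.op t x‖ = ‖x‖) {z : ℂ} (hz : 0 < z.re) (x : H) {s : ℝ} (hs : 0 ≤ s) :
    HasDerivWithinAt (fun t : ℝ => S.adj.op t.toNNReal (S.laplace z hz x))
      (-z • S.adj.op s.toNNReal (S.laplace z hz x) + S.adj.op s.toNNReal x) (Ici s) s := by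
  have h := (hasDerivAt_exp_smul_add_integral (-z) (S.laplace z hz x)
    (S.adj.continuous_dampedOrbit (-z) x) s).hasDerivWithinAt (s := Ici s)
  refine (h.congr (fun t ht => S.adjoint_op_laplace_apply hiso hz x (hs.trans ht))
    (S.adjoint_op_laplace_apply hiso hz x hs)).congr_deriv ?_
  rw [← S.adjoint_op_laplace_apply hiso hz x hs, S.adj.exp_smul_dampedOrbit]

/-- A positive multiple of the orthogonal projection onto the joint eigenspace
`{x | ∀ t, T_t* x = exp (-z t) x}` of an isometric semigroup. -/
noncomputable def eigenProj (S : ContractionSemigroup H) (z : ℂ) (hz : 0 < z.re) : H →L[ℂ] H :=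
  S.laplace z hz + S.adj.laplace (conj z) (by simpa) -
    (z + conj z) • (S.laplace z hz * S.adj.laplace (conj z) (by simpa))

theorem eigenProj_apply (S : ContractionSemigroup H) {z : ℂ} (hz : 0 < z.re)
    (hz' : 0 < (conj z).re) (x : H) :
    S.eigenProj z hz x = S.laplace z hz x + S.adj.laplace (conj z) hz' x -
      (z + conj z) • S.laplace z hz (S.adj.laplace (conj z) hz' x) := rfl

theorem isSelfAdjoint_eigenProj (S : ContractionSemigroup H) {z : ℂ} (hz : 0 < z.re) :
    IsSelfAdjoint (S.eigenProj z hz) := by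
  have h : S.adj.laplace (conj z) (by simpa) = star (S.laplace z hz) := (S.adjoint_laplace hz).symm
  rw [eigenProj, h]
  simp [IsSelfAdjoint, add_comm]

theorem commute_eigenProj (S : ContractionSemigroup H) {z : ℂ} (hz : 0 < z.re) {A : H →L[ℂ] H}
    (hA : ∀ t, Commute A (S.op t)) (hA' : ∀ t, Commute A (S.adj.op t)) :
    Commute A (S.eigenProj z hz) := by
  have h := S.commute_laplace hz hA
  have h' := S.adj.commute_laplace (z := conj z) (by simpa) hA'
  exact (h.add_right h').sub_right ((h.mul_right h').smul_right _)

theorem adj_op_eigenProj (S : ContractionSemigroup H) (hiso : ∀ t x, ‖S.op t x‖ = ‖x‖)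
    {z : ℂ} (hz : 0 < z.re) (x : H) (t : ℝ≥0) :
    S.adj.op t (S.eigenProj z hz x) = Complex.exp (-(z * ((t : ℝ) : ℂ))) • S.eigenProj z hz x := by
  have hz' : 0 < (conj z).re := by simpa
  set y := x - (z + conj z) • S.adj.laplace (conj z) hz' x with hy
  have hP : S.eigenProj z hz x = S.laplace z hz y + S.adj.laplace (conj z) hz' x := by
    rw [S.eigenProj_apply hz hz', hy, map_sub, map_smul]
    abel
  have hder : ∀ s ∈ Ico (0 : ℝ) t,
      HasDerivWithinAt (fun s : ℝ => Complex.exp (z * s) • S.adj.op s.toNNReal (S.eigenProj z hz x))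
        0 (Ici s) s := by
    intro s hs
    have h1 := (S.hasDerivWithinAt_adjoint_op_laplace hiso hz y hs.1).add
      (S.adj.hasDerivWithinAt_op_laplace hz' x hs.1)
    have h2 := (hasDerivAt_exp_mul_ofReal z s).hasDerivWithinAt (s := Ici s) |>.smul h1
    simp only [hP, map_add]
    refine h2.congr_deriv ?_
    simp only [hy, map_sub, map_smul, Pi.add_apply]
    module
  have hc : ContinuousOn
      (fun s : ℝ => Complex.exp (z * s) • S.adj.op s.toNNReal (S.eigenProj z hz x))
      (Icc (0 : ℝ) t) := by
    have h := S.adj.continuous_orbit (S.eigenProj z hz x)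
    exact Continuous.continuousOn (by fun_prop)
  have h := constant_of_has_deriv_right_zero hc hder t ⟨t.2, le_rfl⟩
  simp only [Real.toNNReal_coe, Complex.ofReal_zero, mul_zero, Complex.exp_zero,
    Real.toNNReal_zero, S.adj.op_zero, one_smul, one_apply_eq_self] at h
  rw [Complex.exp_neg, eq_inv_smul_iff₀ (Complex.exp_ne_zero _), h]

theorem eq_zero_of_laplace_eq_zero (S : ContractionSemigroup H) {z : ℂ} (hz : 0 < z.re) {x : H}
    (hx : S.laplace z hz x = 0) : x = 0 := by
  have h := S.hasDerivWithinAt_op_laplace hz x le_rfl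
  simp only [hx, map_zero, smul_zero, Real.toNNReal_zero, S.op_zero, zero_sub,
    one_apply_eq_self] at h
  have := (uniqueDiffWithinAt_Ici (0 : ℝ)).eq_deriv _ h (hasDerivWithinAt_const 0 _ (0 : H))
  simpa using this

theorem two_mul_re_inner_of_eigenProj_eq_zero (S : ContractionSemigroup H) {z : ℂ} (hz : 0 < z.re)
    (hz' : 0 < (conj z).re) {x : H} (hx : S.eigenProj z hz x = 0) :
    RCLike.re ⟪S.adj.laplace (conj z) hz' x, x⟫_ℂ =
      z.re * ‖S.adj.laplace (conj z) hz' x‖ ^ 2 := by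
  have hR : ∀ u v, ⟪S.laplace z hz u, v⟫_ℂ = ⟪u, S.adj.laplace (conj z) hz' v⟫_ℂ := by
    intro u v
    rw [← S.adjoint_laplace hz, adjoint_inner_right]
  have h := congrArg (fun y => RCLike.re ⟪y, x⟫_ℂ) hx
  simp only [S.eigenProj_apply hz hz', inner_sub_left, inner_add_left, inner_smul_left, hR,
    inner_self_eq_ofReal_norm_sq, inner_zero_left, map_add, map_sub, Complex.conj_conj] at h
  rw [inner_re_symm x] at h
  rw [add_comm (conj z), Complex.add_conj] at h
  simp only [RCLike.re_to_complex, Complex.re_ofReal_mul, Complex.ofReal_re, Complex.zero_re] at h ⊢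
  linarith

/-- If the semigroup is isometric and pure, vectors whose backward orbit is annihilated by
`eigenProj` vanish: the derivative of `‖T_t* R* x‖²` is then zero. -/
theorem eq_zero_of_eigenProj_eq_zero (S : ContractionSemigroup H) {x : H}
    (hpure : ∀ y, Tendsto (fun t => S.adj.op t y) atTop (𝓝 0)) {z : ℂ} (hz : 0 < z.re)
    (hx : ∀ t, S.eigenProj z hz (S.adj.op t x) = 0) : x = 0 := by
  have hz' : 0 < (conj z).re := by simpa
  have hcomm : ∀ t, S.adj.laplace (conj z) hz' (S.adj.op t x) =
      S.adj.op t (S.adj.laplace (conj z) hz' x) := fun t =>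
    (DFunLike.congr_fun (S.adj.commute_laplace hz' (A := S.adj.op t) fun s => by
      rw [Commute, SemiconjBy, ← S.adj.op_add, ← S.adj.op_add, add_comm]).eq x).symm
  set y := S.adj.laplace (conj z) hz' x with hy
  have hconst : ∀ t : ℝ≥0, ‖S.adj.op t y‖ ^ 2 = ‖y‖ ^ 2 := by
    intro t
    have hc : ContinuousOn (fun s : ℝ => ‖S.adj.op s.toNNReal y‖ ^ 2) (Icc (0 : ℝ) t) :=
      ((S.adj.continuous_orbit y).norm.pow 2).continuousOn
    have hder : ∀ s ∈ Ico (0 : ℝ) t,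
        HasDerivWithinAt (fun s : ℝ => ‖S.adj.op s.toNNReal y‖ ^ 2) 0 (Ici s) s := by
      intro s hs
      let : InnerProductSpace ℝ H := InnerProductSpace.rclikeToReal ℂ H
      refine (S.adj.hasDerivWithinAt_op_laplace hz' x hs.1).norm_sq.congr_deriv ?_
      have h := S.two_mul_re_inner_of_eigenProj_eq_zero hz hz' (hx s.toNNReal)
      rw [hcomm] at h
      rw [real_inner_eq_re_inner ℂ, inner_sub_right, inner_smul_right,
        inner_self_eq_ofReal_norm_sq, map_sub, ← hy, h,
        RCLike.re_to_complex, Complex.re_mul_ofReal, Complex.conj_re, sub_self, mul_zero]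
    simpa [S.adj.op_zero] using constant_of_has_deriv_right_zero hc hder t ⟨t.2, le_rfl⟩
  have h0 : ‖y‖ ^ 2 = 0 := by
    have h := (hpure y).norm.pow 2
    simp only [hconst] at h
    simpa using tendsto_nhds_unique tendsto_const_nhds h
  exact S.adj.eq_zero_of_laplace_eq_zero hz' (by simpa using h0)

section Joint

variable {ι : Type*} (S : ι → ContractionSemigroup H) {z : ι → ℂ} (hz : ∀ i, 0 < (z i).re)

/-- The product of the operators `eigenProj` along a list of semigroups. -/
noncomputable def jointEigenProj (l : List ι) : H →L[ℂ] H :=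
  (l.map fun i => (S i).eigenProj (z i) (hz i)).prod

theorem jointEigenProj_cons_apply (i : ι) (l : List ι) (x : H) :
    jointEigenProj S hz (i :: l) x =
      (S i).eigenProj (z i) (hz i) (jointEigenProj S hz l x) := by
  simp [jointEigenProj]

variable {S}

theorem commute_jointEigenProj {A : H →L[ℂ] H} {l : List ι}
    (hA : ∀ i ∈ l, ∀ t, Commute A ((S i).op t)) (hA' : ∀ i ∈ l, ∀ t, Commute A ((S i).adj.op t)) :
    Commute A (jointEigenProj S hz l) := by
  refine Commute.list_prod_right _ _ fun B hB => ?_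
  obtain ⟨i, hi, rfl⟩ := List.mem_map.1 hB
  exact (S i).commute_eigenProj (hz i) (hA i hi) (hA' i hi)

theorem commute_adj_op_op
    (hcomm' : ∀ i j, i ≠ j → ∀ s t, Commute ((S i).op s) ((S j).adj.op t))
    {i j : ι} (hij : i ≠ j) (s t : ℝ≥0) : Commute ((S i).adj.op s) ((S j).op t) :=
  (hcomm' j i hij.symm t s).symm

theorem commute_adj_op_adj_op
    (hcomm : ∀ i j, i ≠ j → ∀ s t, Commute ((S i).op s) ((S j).op t))
    {i j : ι} (hij : i ≠ j) (s t : ℝ≥0) : Commute ((S i).adj.op s) ((S j).adj.op t) :=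
  (hcomm i j hij s t).star_star

theorem commute_op_jointEigenProj
    (hcomm : ∀ i j, i ≠ j → ∀ s t, Commute ((S i).op s) ((S j).op t))
    (hcomm' : ∀ i j, i ≠ j → ∀ s t, Commute ((S i).op s) ((S j).adj.op t))
    {i : ι} {l : List ι} (hi : i ∉ l) (t : ℝ≥0) :
    Commute ((S i).op t) (jointEigenProj S hz l) :=
  commute_jointEigenProj hz (fun j hj => hcomm i j (ne_of_mem_of_not_mem hj hi).symm t)
    (fun j hj => hcomm' i j (ne_of_mem_of_not_mem hj hi).symm t)

theorem commute_adj_op_jointEigenProj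
    (hcomm : ∀ i j, i ≠ j → ∀ s t, Commute ((S i).op s) ((S j).op t))
    (hcomm' : ∀ i j, i ≠ j → ∀ s t, Commute ((S i).op s) ((S j).adj.op t))
    {i : ι} {l : List ι} (hi : i ∉ l) (t : ℝ≥0) :
    Commute ((S i).adj.op t) (jointEigenProj S hz l) :=
  commute_jointEigenProj hz
    (fun _ hj => commute_adj_op_op hcomm' (ne_of_mem_of_not_mem hj hi).symm t)
    (fun _ hj => commute_adj_op_adj_op hcomm (ne_of_mem_of_not_mem hj hi).symm t)

theorem commute_eigenProj_jointEigenProj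
    (hcomm : ∀ i j, i ≠ j → ∀ s t, Commute ((S i).op s) ((S j).op t))
    (hcomm' : ∀ i j, i ≠ j → ∀ s t, Commute ((S i).op s) ((S j).adj.op t))
    {i : ι} {l : List ι} (hi : i ∉ l) :
    Commute ((S i).eigenProj (z i) (hz i)) (jointEigenProj S hz l) :=
  ((S i).commute_eigenProj (hz i)
    (fun t => (commute_op_jointEigenProj hz hcomm hcomm' hi t).symm)
    (fun t => (commute_adj_op_jointEigenProj hz hcomm hcomm' hi t).symm)).symm

theorem isSelfAdjoint_jointEigenProj
    (hcomm : ∀ i j, i ≠ j → ∀ s t, Commute ((S i).op s) ((S j).op t))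
    (hcomm' : ∀ i j, i ≠ j → ∀ s t, Commute ((S i).op s) ((S j).adj.op t))
    {l : List ι} (hl : l.Nodup) :
    IsSelfAdjoint (jointEigenProj S hz l) := by
  induction l with
  | nil => exact IsSelfAdjoint.one _
  | cons i l ih =>
    rw [List.nodup_cons] at hl
    have h := (((S i).isSelfAdjoint_eigenProj (hz i)).commute_iff (ih hl.2)).1
      (commute_eigenProj_jointEigenProj hz hcomm hcomm' hl.1)
    simpa [jointEigenProj] using h

theorem adj_op_jointEigenProj
    (hcomm : ∀ i j, i ≠ j → ∀ s t, Commute ((S i).op s) ((S j).op t))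
    (hcomm' : ∀ i j, i ≠ j → ∀ s t, Commute ((S i).op s) ((S j).adj.op t))
    (hiso : ∀ i t x, ‖(S i).op t x‖ = ‖x‖) {l : List ι} {j : ι}
    (hj : j ∈ l) (t : ℝ≥0) (x : H) :
    (S j).adj.op t (jointEigenProj S hz l x) =
      Complex.exp (-(z j * ((t : ℝ) : ℂ))) • jointEigenProj S hz l x := by
  induction l with
  | nil => simp at hj
  | cons i l ih =>
    rw [jointEigenProj_cons_apply]
    by_cases hij : j = i
    · subst hij
      exact (S j).adj_op_eigenProj (hiso j) (hz j) _ t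
    · have h := (S i).commute_eigenProj (hz i) (A := (S j).adj.op t)
        (fun s => commute_adj_op_op hcomm' hij t s)
        (fun s => commute_adj_op_adj_op hcomm hij t s)
      have h' := DFunLike.congr_fun h.eq (jointEigenProj S hz l x)
      rw [mul_apply_eq_comp, mul_apply_eq_comp] at h'
      rw [h', ih (List.mem_of_ne_of_mem hij hj), map_smul]

theorem eq_zero_of_jointEigenProj_eq_zero
    (hcomm : ∀ i j, i ≠ j → ∀ s t, Commute ((S i).op s) ((S j).op t))
    (hcomm' : ∀ i j, i ≠ j → ∀ s t, Commute ((S i).op s) ((S j).adj.op t))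
    [DecidableEq ι]
    (hpure : ∀ i y, Tendsto (fun t => (S i).adj.op t y) atTop (𝓝 0))
    (W : (ι → ℝ≥0) → H →L[ℂ] H) (hW0 : W 0 = 1)
    (hW : ∀ t i u, W (t + Pi.single i u) = (S i).adj.op u * W t)
    {l : List ι} (hl : l.Nodup) {x : H} (hx : ∀ t, jointEigenProj S hz l (W t x) = 0) : x = 0 := by
  induction l with
  | nil => simpa [jointEigenProj, hW0] using hx 0
  | cons i l ih =>
    rw [List.nodup_cons] at hl
    refine ih hl.2 fun t => (S i).eq_zero_of_eigenProj_eq_zero (hpure i) (hz i) fun u => ?_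
    have h := hx (t + Pi.single i u)
    have hc := DFunLike.congr_fun
      (commute_adj_op_jointEigenProj hz hcomm hcomm' hl.1 u).eq (W t x)
    rw [mul_apply_eq_comp, mul_apply_eq_comp] at hc
    rwa [jointEigenProj_cons_apply, hW, mul_apply_eq_comp, ← hc] at h

end Joint

end ContractionSemigroup

/-- for a strongly continuous, doubly commuting, strongly pure isometric
representation of `ℝ₊^d` on a separable Hilbert space, `L_z = H` for every `z ∈ ℍ₊^d`,
i.e. `{V_t ξ : t ∈ ℝ₊^d, ξ ∈ K_z}` is total in `H`. -/
theorem stmt_6 (d : ℕ) (hd : 1 ≤ d)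
    (H : Type*) [NormedAddCommGroup H] [InnerProductSpace ℂ H] [CompleteSpace H]
    [TopologicalSpace.SeparableSpace H]
    (V : (Fin d → NNReal) → H →L[ℂ] H)
    (hV0 : V 0 = 1)
    (hVadd : ∀ s t : Fin d → NNReal, V (s + t) = V s * V t)
    (hiso : ∀ (t : Fin d → NNReal) (x : H), ‖V t x‖ = ‖x‖)
    (hcont : ∀ ξ : H, Continuous fun t : Fin d → NNReal => V t ξ)
    (hdc : ∀ i j : Fin d, i ≠ j → ∀ s t : NNReal,
      V (Pi.single i s) * adjoint (V (Pi.single j t))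
        = adjoint (V (Pi.single j t)) * V (Pi.single i s))
    (hpure : ∀ (i : Fin d) (ξ : H),
      Tendsto (fun t : NNReal => adjoint (V (Pi.single i t)) ξ) atTop (𝓝 0))
    (z : Fin d → ℂ) (hz : ∀ i, 0 < (z i).re) :
    closure (Submodule.span ℂ
        {x : H | ∃ (t : Fin d → NNReal) (ξ : H),
          (∀ s : Fin d → NNReal,
            adjoint (V s) ξ = Complex.exp (-∑ i, z i * ((s i : ℝ) : ℂ)) • ξ)
          ∧ x = V t ξ} : Set H) = Set.univ := by
  let S : Fin d → ContractionSemigroup H := fun i =>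
    { op := fun t => V (Pi.single i t)
      op_zero := by rw [Pi.single_zero, hV0]
      op_add := fun s t => by rw [Pi.single_add, hVadd]
      norm_op_apply_le := fun t x => (hiso _ x).le
      continuous_op := fun x => (hcont x).comp (continuous_single (A := fun _ => NNReal) i) }
  have hcomm : ∀ i j, i ≠ j → ∀ s t, Commute ((S i).op s) ((S j).op t) := fun i j _ s t => by
    change V (Pi.single i s) * V (Pi.single j t) = V (Pi.single j t) * V (Pi.single i s)
    rw [← hVadd, ← hVadd, add_comm]
  have hcomm' : ∀ i j, i ≠ j → ∀ s t, Commute ((S i).op s) ((S j).adj.op t) := hdc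
  have hadd : ∀ s t, adjoint (V (s + t)) = adjoint (V t) * adjoint (V s) := fun s t => by
    rw [hVadd]
    exact adjoint_comp _ _
  have hzero : adjoint (V 0) = 1 := by
    rw [hV0]
    exact star_one (H →L[ℂ] H)
  set l := List.finRange d
  have hl : l.Nodup := List.nodup_finRange d
  set Q := ContractionSemigroup.jointEigenProj S hz l
  have heigen : ∀ (x : H) (s : Fin d → NNReal),
      adjoint (V s) (Q x) = Complex.exp (-∑ i, z i * ((s i : ℝ) : ℂ)) • Q x := by
    intro x s
    suffices h : ∀ F : Finset (Fin d), adjoint (V (∑ i ∈ F, Pi.single i (s i))) (Q x) =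
        Complex.exp (-∑ i ∈ F, z i * ((s i : ℝ) : ℂ)) • Q x by
      simpa [Finset.univ_sum_single] using h Finset.univ
    intro F
    induction F using Finset.induction_on with
    | empty => simp [hzero]
    | insert i F hi ih =>
      have hQ := ContractionSemigroup.adj_op_jointEigenProj hz hcomm hcomm'
        (fun i t x => hiso (Pi.single i t) x) (List.mem_finRange i) (s i) x
      change adjoint (V (Pi.single i (s i))) (Q x) = _ • Q x at hQ
      rw [Finset.sum_insert hi, Finset.sum_insert hi, hadd, mul_apply_eq_comp, hQ,
        map_smul, ih, smul_smul, ← Complex.exp_add, neg_add]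
  rw [← Submodule.topologicalClosure_coe, ← Submodule.top_coe (R := ℂ), SetLike.coe_set_eq,
    Submodule.topologicalClosure_eq_top_iff, Submodule.eq_bot_iff]
  intro y hy
  refine ContractionSemigroup.eq_zero_of_jointEigenProj_eq_zero hz hcomm hcomm' hpure
    (fun t => adjoint (V t)) hzero (fun t i u => hadd t _) hl fun t => ?_
  refine ext_inner_left ℂ fun x => ?_
  have hsa : adjoint Q = Q := ContractionSemigroup.isSelfAdjoint_jointEigenProj hz hcomm hcomm' hl
  change ⟪x, Q (adjoint (V t) y)⟫_ℂ = _
  rw [← hsa, adjoint_inner_right, adjoint_inner_right, inner_zero_right]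
  exact hy _ (Submodule.subset_span ⟨t, Q x, heigen x, rfl⟩)
end

section
/- (Cooper's theorem, doubly commuting multiparameter version.) Let V be a strongly continuous, doubly commuting, strongly pure isometric representation of ℝ₊^d on a separable complex Hilbert space H. Then there exist a separable complex Hilbert space K and a unitary operator U : L²(ℝ₊^d; K) → H such that U S_t^K U* = V_t for every t ∈ ℝ₊^d, where S^K = (S_t^K)_{t∈ℝ₊^d} is the K-valued shift semigroup on L²(ℝ₊^d; K): for f ∈ L²(ℝ₊^d; K), (S_t^K f)(x) = f(x−t) if x−t ∈ ℝ₊^d and (S_t^K f)(x) = 0 otherwise (Lebesgue-a.e. x). -/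
open ContinuousLinearMap Filter Topology MeasureTheory

namespace Cooper

open Set
open scoped NNReal InnerProductSpace

section Semigroup

attribute [local instance] InnerProductSpace.complexToReal

variable {H : Type*} [NormedAddCommGroup H] [InnerProductSpace ℂ H]

/-- A strongly continuous one-parameter semigroup of contractions. -/
structure IsContractionSemigroup (T : ℝ≥0 → H →L[ℂ] H) : Prop where
  zero : T 0 = 1
  add : ∀ s t, T (s + t) = T s * T t
  norm_le : ∀ t x, ‖T t x‖ ≤ ‖x‖
  cont : ∀ x, Continuous fun t => T t x

namespace IsContractionSemigroup

variable {T : ℝ≥0 → H →L[ℂ] H}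

theorem commute (hT : IsContractionSemigroup T) (s t : ℝ≥0) : Commute (T s) (T t) := by
  rw [Commute, SemiconjBy, ← hT.add, ← hT.add, add_comm]

theorem continuous_apply_toNNReal (hT : IsContractionSemigroup T) (x : H) :
    Continuous fun h : ℝ => T h.toNNReal x := (hT.cont x).comp continuous_real_toNNReal

theorem continuous_exp_smul (hT : IsContractionSemigroup T) (x : H) :
    Continuous fun t : ℝ => Real.exp (-t) • T t.toNNReal x :=
  (Real.continuous_exp.comp continuous_neg).smul ((hT.cont x).comp continuous_real_toNNReal)

theorem integrableOn_exp_smul (hT : IsContractionSemigroup T) (x : H) (a : ℝ) :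
    IntegrableOn (fun t : ℝ => Real.exp (-t) • T t.toNNReal x) (Ioi a) := by
  refine ((integrableOn_exp_neg_Ioi a).mul_const ‖x‖).mono'
    (hT.continuous_exp_smul x).aestronglyMeasurable (ae_of_all _ fun t => ?_)
  rw [norm_smul, Real.norm_of_nonneg (Real.exp_pos _).le]
  exact mul_le_mul_of_nonneg_left (hT.norm_le _ _) (Real.exp_pos _).le

end IsContractionSemigroup

variable {T : ℝ≥0 → H →L[ℂ] H}

/-- The resolvent at `1` of the generator of a strongly continuous contraction semigroup,
given by the Laplace transform. -/
noncomputable def resolvent (hT : IsContractionSemigroup T) : H →L[ℂ] H :=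
  LinearMap.mkContinuous
    { toFun := fun x => ∫ t in Ioi (0 : ℝ), Real.exp (-t) • T t.toNNReal x
      map_add' := fun x y => by
        rw [← integral_add (hT.integrableOn_exp_smul x 0) (hT.integrableOn_exp_smul y 0)]
        simp
      map_smul' := fun c x => by
        rw [RingHom.id_apply, ← integral_smul]
        congr 1 with t
        rw [map_smul, smul_comm] }
    1 fun x => by
      refine (norm_integral_le_integral_norm _).trans ?_
      rw [← integral_exp_neg_Ioi_zero, ← integral_mul_const]
      refine setIntegral_mono_on (hT.integrableOn_exp_smul x 0).norm
        ((integrableOn_exp_neg_Ioi 0).mul_const ‖x‖) measurableSet_Ioi fun t _ => ?_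
      rw [norm_smul, Real.norm_of_nonneg (Real.exp_pos _).le]
      exact mul_le_mul_of_nonneg_left (hT.norm_le _ _) (Real.exp_pos _).le

theorem resolvent_apply (hT : IsContractionSemigroup T) (x : H) :
    resolvent hT x = ∫ t in Ioi (0 : ℝ), Real.exp (-t) • T t.toNNReal x := rfl

theorem norm_sub_two_smul_sq (x y : H) :
    ‖x - (2 : ℂ) • y‖ ^ 2 = ‖x‖ ^ 2 + 4 * ⟪y, y - x⟫_ℝ := by
  have h : (2 : ℂ) • y = (2 : ℝ) • y := by rw [← Complex.coe_smul]; norm_num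
  rw [h, norm_sub_sq_real, norm_smul, inner_smul_right, inner_sub_right,
    real_inner_self_eq_norm_sq, real_inner_comm]
  norm_num
  ring

variable [CompleteSpace H]

theorem commute_resolvent (hT : IsContractionSemigroup T) {A : H →L[ℂ] H}
    (hA : ∀ t, Commute A (T t)) : Commute A (resolvent hT) := by
  ext x
  change A (resolvent hT x) = resolvent hT (A x)
  rw [resolvent_apply, resolvent_apply, ← ContinuousLinearMap.integral_comp_comm _
    (hT.integrableOn_exp_smul x 0)]
  congr 1 with t
  have := congrArg (fun B : H →L[ℂ] H => B x) (hA t.toNNReal).eq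
  simp only [mul_apply_eq_comp] at this
  rw [← this, ← Complex.coe_smul, ← Complex.coe_smul, map_smul]

theorem adjoint_resolvent {T' : ℝ≥0 → H →L[ℂ] H} (hT : IsContractionSemigroup T)
    (hT' : IsContractionSemigroup T') (h : ∀ t, T' t = adjoint (T t)) :
    adjoint (resolvent hT) = resolvent hT' := by
  symm
  rw [eq_adjoint_iff]
  intro x y
  rw [resolvent_apply, resolvent_apply, ← integral_inner (hT.integrableOn_exp_smul y 0),
    ← inner_conj_symm, ← integral_inner (hT'.integrableOn_exp_smul x 0), ← integral_conj]
  congr 1 with t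
  rw [inner_conj_symm, h, ← Complex.coe_smul, ← Complex.coe_smul, inner_smul_left,
    inner_smul_right, adjoint_inner_left, Complex.conj_ofReal]

theorem apply_resolvent (hT : IsContractionSemigroup T) (x : H) {h : ℝ} (hh : 0 ≤ h) :
    T h.toNNReal (resolvent hT x) =
      Real.exp h • (resolvent hT x - ∫ t in (0 : ℝ)..h, Real.exp (-t) • T t.toNNReal x) := by
  have h1 := intervalIntegral.integral_interval_add_Ioi (hT.integrableOn_exp_smul x 0)
    (hT.integrableOn_exp_smul x h)
  rw [← resolvent_apply hT x] at h1
  rw [sub_eq_of_eq_add' h1.symm]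
  have h2 := (measurePreserving_add_left (volume : Measure ℝ) h).setIntegral_preimage_emb
    (measurableEmbedding_addLeft h) (fun t => Real.exp (-t) • T t.toNNReal x) (Ioi h)
  have h3 : (fun x => h + x) ⁻¹' Ioi h = Ioi (0 : ℝ) := by ext; simp
  rw [← h2, h3, ← integral_smul, resolvent_apply, ← ContinuousLinearMap.integral_comp_comm _
    (hT.integrableOn_exp_smul x 0)]
  refine setIntegral_congr_fun measurableSet_Ioi fun t ht => ?_
  have ht' : (0 : ℝ) ≤ t := le_of_lt ht
  rw [← Complex.coe_smul, map_smul, Complex.coe_smul, smul_smul, ← Real.exp_add,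
    Real.toNNReal_add hh ht', hT.add, mul_apply_eq_comp]
  congr 2
  ring

theorem hasDerivWithinAt_apply_resolvent (hT : IsContractionSemigroup T) (x : H) {h : ℝ}
    (hh : 0 ≤ h) :
    HasDerivWithinAt (fun h : ℝ => T h.toNNReal (resolvent hT x))
      (T h.toNNReal (resolvent hT x - x)) (Ici h) h := by
  have h1 : HasDerivAt (fun u : ℝ => ∫ t in (0 : ℝ)..u, Real.exp (-t) • T t.toNNReal x)
      (Real.exp (-h) • T h.toNNReal x) h :=
    intervalIntegral.integral_hasDerivAt_right
      ((hT.continuous_exp_smul x).intervalIntegrable _ _)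
      (hT.continuous_exp_smul x).stronglyMeasurable.stronglyMeasurableAtFilter
      (hT.continuous_exp_smul x).continuousAt
  have h2 := ((Real.hasDerivAt_exp h).smul (h1.const_sub (resolvent hT x))).hasDerivWithinAt
    (s := Ici h)
  refine (h2.congr_deriv ?_).congr_of_mem
    (fun u hu => apply_resolvent hT x (hh.trans hu)) self_mem_Ici
  rw [map_sub, apply_resolvent hT x hh, smul_neg, smul_smul, ← Real.exp_add]
  simp
  abel

theorem norm_sub_resolvent_of_isometry (hT : IsContractionSemigroup T)
    (hiso : ∀ t x, ‖T t x‖ = ‖x‖) (x : H) : ‖x - (2 : ℂ) • resolvent hT x‖ = ‖x‖ := by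
  have h1 := (hasDerivWithinAt_apply_resolvent hT x le_rfl).norm_sq
  have h2 : HasDerivWithinAt (fun h : ℝ => ‖T h.toNNReal (resolvent hT x)‖ ^ 2) 0 (Ici 0) 0 := by
    simp only [hiso]
    exact hasDerivWithinAt_const _ _ _
  have h3 := (uniqueDiffWithinAt_Ici (0 : ℝ)).eq_deriv _ h1 h2
  simp only [Real.toNNReal_zero, hT.zero, one_apply_eq_self] at h3
  have h4 := norm_sub_two_smul_sq x (resolvent hT x)
  refine (sq_eq_sq₀ (norm_nonneg _) (norm_nonneg _)).1 ?_
  linarith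

theorem resolvent_injective (hT : IsContractionSemigroup T) {x : H} (hx : resolvent hT x = 0) :
    x = 0 := by
  have h1 := hasDerivWithinAt_apply_resolvent hT x le_rfl
  simp only [hx, map_zero, zero_sub, Real.toNNReal_zero, hT.zero, one_apply_eq_self] at h1
  exact neg_eq_zero.1 ((uniqueDiffWithinAt_Ici (0 : ℝ)).eq_deriv _ h1
    (hasDerivWithinAt_const _ _ _))

theorem eq_zero_of_norm_sub_resolvent (hT : IsContractionSemigroup T)
    (hpure : ∀ x, Tendsto (fun t => T t x) atTop (𝓝 0)) {x : H}
    (hx : ∀ t, ‖T t x - (2 : ℂ) • resolvent hT (T t x)‖ = ‖T t x‖) : x = 0 := by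
  refine resolvent_injective hT (norm_eq_zero.1 (pow_eq_zero_iff two_ne_zero |>.1 ?_))
  have hcomm : ∀ t, T t (resolvent hT x) = resolvent hT (T t x) := fun t =>
    congrArg (fun B : H →L[ℂ] H => B x) (commute_resolvent hT (hT.commute t)).eq
  have key : ∀ b : ℝ, 0 ≤ b → ‖T b.toNNReal (resolvent hT x)‖ ^ 2 = ‖resolvent hT x‖ ^ 2 := by
    intro b hb
    have := constant_of_has_deriv_right_zero (a := 0) (b := b)
      (f := fun h : ℝ => ‖T h.toNNReal (resolvent hT x)‖ ^ 2)
      ((hT.continuous_apply_toNNReal _).norm.pow 2).continuousOn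
      (fun h hh => by
        refine (hasDerivWithinAt_apply_resolvent hT x hh.1).norm_sq.congr_deriv ?_
        have h4 := norm_sub_two_smul_sq (T h.toNNReal x) (resolvent hT (T h.toNNReal x))
        rw [hx] at h4
        rw [map_sub, hcomm]
        linarith) b ⟨hb, le_rfl⟩
    simpa [hT.zero] using this
  have h1 : Tendsto (fun t => ‖T t (resolvent hT x)‖ ^ 2) atTop (𝓝 0) := by
    simpa using ((hpure (resolvent hT x)).norm).pow 2
  refine tendsto_nhds_unique (tendsto_const_nhds.congr fun t => ?_) h1
  simpa using (key t t.2).symm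

theorem apply_eq_exp_smul (hT : IsContractionSemigroup T) {x : H}
    (hx : (2 : ℂ) • resolvent hT x = x) (t : ℝ≥0) : T t x = Real.exp (-t) • x := by
  have hx' : (2 : ℝ) • resolvent hT x = x := by
    rw [← Complex.coe_smul]; simpa using hx
  have := constant_of_has_deriv_right_zero (a := 0) (b := t)
      (f := fun h : ℝ => Real.exp h • T h.toNNReal (resolvent hT x))
      (Real.continuous_exp.smul (hT.continuous_apply_toNNReal _)).continuousOn
      (fun h hh => by
        refine ((Real.hasDerivAt_exp h).hasDerivWithinAt.smul
          (hasDerivWithinAt_apply_resolvent hT x hh.1)).congr_deriv ?_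
        have : resolvent hT x - x = - resolvent hT x := by
          nth_rewrite 2 [← hx']
          rw [two_smul]; abel
        rw [this, map_neg, smul_neg, neg_add_cancel]) t ⟨t.2, le_rfl⟩
  simp only [Real.toNNReal_coe, Real.exp_zero, Real.toNNReal_zero, hT.zero, one_apply_eq_self,
    one_smul] at this
  have h2 : T t x = (2 : ℝ) • T t (resolvent hT x) := by
    rw [← Complex.coe_smul, ← map_smul, Complex.coe_smul, hx']
  have h3 : T t (resolvent hT x) = Real.exp (-t) • resolvent hT x := by
    rw [← this, smul_smul, ← Real.exp_add]
    simp [this]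
  rw [h2, h3, smul_comm, hx']

theorem adjoint_norm_le {A : H →L[ℂ] H} (hA : ∀ x, ‖A x‖ ≤ ‖x‖) (x : H) :
    ‖adjoint A x‖ ≤ ‖x‖ := by
  refine (le_opNorm _ _).trans ?_
  rw [LinearIsometryEquiv.norm_map]
  exact mul_le_of_le_one_left (norm_nonneg _)
    (opNorm_le_bound _ zero_le_one fun y => by simpa using hA y)

theorem IsContractionSemigroup.adjoint (hT : IsContractionSemigroup T) :
    IsContractionSemigroup fun t => adjoint (T t) where
  zero := by rw [hT.zero]; exact star_one _
  add s t := by rw [add_comm, hT.add]; exact star_mul _ _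
  norm_le t x := adjoint_norm_le (hT.norm_le t) x
  cont x := by
    have hlim : Tendsto (fun h => ‖ContinuousLinearMap.adjoint (T h) x - x‖) (𝓝 0) (𝓝 0) := by
      have h1 : ∀ h, ‖ContinuousLinearMap.adjoint (T h) x - x‖ ≤
          √(2 * ‖x‖ ^ 2 - 2 * ⟪x, T h x⟫_ℝ) := fun h => by
        refine Real.le_sqrt_of_sq_le ?_
        rw [norm_sub_sq_real]
        have h2 : ⟪ContinuousLinearMap.adjoint (T h) x, x⟫_ℝ = ⟪x, T h x⟫_ℝ :=
          congrArg Complex.re (adjoint_inner_left (T h) x x)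
        have h3 := pow_le_pow_left₀ (norm_nonneg _) (adjoint_norm_le (hT.norm_le h) x) 2
        rw [h2]
        linarith
      refine squeeze_zero (fun _ => norm_nonneg _) h1 ?_
      have h4 : Continuous fun h => √(2 * ‖x‖ ^ 2 - 2 * ⟪x, T h x⟫_ℝ) := by
        have := hT.cont x
        fun_prop
      simpa [hT.zero, real_inner_self_eq_norm_sq] using h4.tendsto 0
    have key : ∀ s t, dist (ContinuousLinearMap.adjoint (T s) x)
        (ContinuousLinearMap.adjoint (T t) x) ≤
        ‖ContinuousLinearMap.adjoint (T ((s - t) + (t - s))) x - x‖ := by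
      have aux : ∀ s h, ‖ContinuousLinearMap.adjoint (T (s + h)) x -
          ContinuousLinearMap.adjoint (T s) x‖ ≤ ‖ContinuousLinearMap.adjoint (T h) x - x‖ := by
        intro s h
        have h5 : ContinuousLinearMap.adjoint (T (s + h)) =
            ContinuousLinearMap.adjoint (T s) * ContinuousLinearMap.adjoint (T h) := by
          rw [add_comm, hT.add]; exact star_mul _ _
        rw [h5, mul_apply_eq_comp, ← map_sub]
        exact adjoint_norm_le (hT.norm_le s) _
      intro s t
      rcases le_total s t with h | h
      · have := aux s (t - s)
        rw [add_tsub_cancel_of_le h] at this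
        rwa [tsub_eq_zero_of_le h, zero_add, dist_comm, dist_eq_norm]
      · have := aux t (s - t)
        rw [add_tsub_cancel_of_le h] at this
        rwa [tsub_eq_zero_of_le h, add_zero, dist_eq_norm]
    refine continuous_iff_continuousAt.2 fun t => tendsto_iff_dist_tendsto_zero.2 ?_
    refine squeeze_zero (fun _ => dist_nonneg) (fun s => key s t) (hlim.comp ?_)
    have h6 : Continuous fun s : ℝ≥0 => (s - t) + (t - s) := by fun_prop
    simpa using h6.tendsto t

/-- The cogenerator (Cayley transform of the generator) of a contraction semigroup. -/
noncomputable def cogenerator (hT : IsContractionSemigroup T) : H →L[ℂ] H :=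
  1 - (2 : ℂ) • resolvent hT

/-- The defect operator of the adjoint of the cogenerator. For an isometric semigroup it is the
projection onto the vectors `x` with `(T t)* x = exp (-t) x` for all `t`. -/
noncomputable def defect (hT : IsContractionSemigroup T) : H →L[ℂ] H :=
  1 - cogenerator hT * adjoint (cogenerator hT)

theorem adjoint_defect (hT : IsContractionSemigroup T) : adjoint (defect hT) = defect hT := by
  simp [defect, ← star_eq_adjoint]

theorem adjoint_cogenerator (hT : IsContractionSemigroup T) :
    adjoint (cogenerator hT) = 1 - (2 : ℂ) • resolvent hT.adjoint := by
  rw [← adjoint_resolvent hT hT.adjoint fun _ => rfl, cogenerator, ← star_eq_adjoint,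
    ← star_eq_adjoint, star_sub, star_smul, star_one]
  simp

theorem commute_defect (hT : IsContractionSemigroup T) {A : H →L[ℂ] H}
    (hA : ∀ t, Commute A (T t)) (hA' : ∀ t, Commute A (adjoint (T t))) :
    Commute A (defect hT) := by
  refine (Commute.one_right A).sub_right (Commute.mul_right ?_ ?_)
  · exact (Commute.one_right A).sub_right ((commute_resolvent hT hA).smul_right _)
  · rw [adjoint_cogenerator]
    exact (Commute.one_right A).sub_right ((commute_resolvent hT.adjoint hA').smul_right _)

theorem adjoint_cogenerator_mul_cogenerator (hT : IsContractionSemigroup T)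
    (hiso : ∀ t x, ‖T t x‖ = ‖x‖) : adjoint (cogenerator hT) * cogenerator hT = 1 :=
  (norm_map_iff_adjoint_comp_self _).1 fun x => norm_sub_resolvent_of_isometry hT hiso x

theorem adjoint_apply_defect (hT : IsContractionSemigroup T) (hiso : ∀ t x, ‖T t x‖ = ‖x‖)
    (t : ℝ≥0) (x : H) : adjoint (T t) (defect hT x) = (Real.exp (-t) : ℂ) • defect hT x := by
  rw [Complex.coe_smul]
  refine apply_eq_exp_smul hT.adjoint ?_ t
  have h : adjoint (cogenerator hT) * defect hT = 0 := by
    rw [defect, mul_sub, ← mul_assoc, adjoint_cogenerator_mul_cogenerator hT hiso]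
    simp
  have h' := congrArg (fun B : H →L[ℂ] H => B x) h
  rw [adjoint_cogenerator] at h'
  exact (sub_eq_zero.1 h').symm

theorem defect_mul (hT : IsContractionSemigroup T) (hiso : ∀ t x, ‖T t x‖ = ‖x‖)
    (t : ℝ≥0) : defect hT * T t = (Real.exp (-t) : ℂ) • defect hT := by
  have h : adjoint (T t) * defect hT = (Real.exp (-t) : ℂ) • defect hT := by
    ext x
    exact adjoint_apply_defect hT hiso t x
  have h' := congrArg star h
  rw [star_mul, star_smul, ← star_eq_adjoint, star_star, star_eq_adjoint, adjoint_defect] at h'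
  rw [h']
  simp [← Complex.exp_conj]

theorem eq_zero_of_defect_adjoint (hT : IsContractionSemigroup T)
    (hpure : ∀ x, Tendsto (fun t => adjoint (T t) x) atTop (𝓝 0)) {x : H}
    (hx : ∀ t, defect hT (adjoint (T t) x) = 0) : x = 0 := by
  refine eq_zero_of_norm_sub_resolvent hT.adjoint hpure fun t => ?_
  have h : adjoint (cogenerator hT) (adjoint (T t) x) =
      adjoint (T t) x - (2 : ℂ) • resolvent hT.adjoint (adjoint (T t) x) := by
    rw [adjoint_cogenerator]; rfl
  rw [← h]
  have hy := hx t
  generalize adjoint (T t) x = y at hy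
  have hy' : cogenerator hT (adjoint (cogenerator hT) y) = y := (sub_eq_zero.1 hy).symm
  refine (sq_eq_sq₀ (norm_nonneg _) (norm_nonneg _)).1 ?_
  rw [← inner_self_eq_norm_sq (𝕜 := ℂ), adjoint_inner_left, hy', inner_self_eq_norm_sq]

end Semigroup
section DoublyCommuting

variable {ι : Type*} [DecidableEq ι]
  {H : Type*} [NormedAddCommGroup H] [InnerProductSpace ℂ H] [CompleteSpace H]

/-- A strongly continuous, doubly commuting isometric representation of `ℝ₊^ι`. -/
structure IsDoublyCommuting (V : (ι → ℝ≥0) → H →L[ℂ] H) : Prop where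
  zero : V 0 = 1
  add : ∀ s t, V (s + t) = V s * V t
  norm_eq : ∀ t x, ‖V t x‖ = ‖x‖
  cont : ∀ x, Continuous fun t => V t x
  commute_adjoint : ∀ i j, i ≠ j → ∀ s t : ℝ≥0,
    Commute (V (Pi.single i s)) (adjoint (V (Pi.single j t)))

/-- The joint eigenspace `{x | (V t)* x = exp (-∑ i, t i) x for all t}`. -/
def vacuum [Fintype ι] (V : (ι → ℝ≥0) → H →L[ℂ] H) : Submodule ℂ H where
  carrier := {x | ∀ t : ι → ℝ≥0, adjoint (V t) x = (Real.exp (-∑ i, (t i : ℝ)) : ℂ) • x}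
  add_mem' hx hy t := by rw [map_add, hx t, hy t, smul_add]
  zero_mem' t := by simp
  smul_mem' c x hx t := by rw [map_smul, hx t, smul_comm]

namespace IsDoublyCommuting

variable {V : (ι → ℝ≥0) → H →L[ℂ] H}

theorem coord (hV : IsDoublyCommuting V) (i : ι) :
    IsContractionSemigroup fun t : ℝ≥0 => V (Pi.single i t) where
  zero := by rw [Pi.single_zero, hV.zero]
  add s t := by rw [Pi.single_add, hV.add]
  norm_le t x := (hV.norm_eq _ x).le
  cont x := (hV.cont x).comp (continuous_single (A := fun _ : ι => ℝ≥0) i)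

theorem adjoint_add (hV : IsDoublyCommuting V) (s t : ι → ℝ≥0) :
    adjoint (V (s + t)) = adjoint (V s) * adjoint (V t) := by
  rw [add_comm, hV.add]; exact star_mul _ _

theorem commute (hV : IsDoublyCommuting V) (s t : ι → ℝ≥0) : Commute (V s) (V t) := by
  rw [Commute, SemiconjBy, ← hV.add, ← hV.add, add_comm]

theorem commute_adjoint_defect (hV : IsDoublyCommuting V) {i j : ι} (hij : i ≠ j) (t : ℝ≥0) :
    Commute (adjoint (V (Pi.single i t))) (defect (hV.coord j)) :=
  commute_defect _ (fun s => (hV.commute_adjoint j i hij.symm s t).symm)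
    fun s => (hV.commute (Pi.single i t) (Pi.single j s)).star_star

theorem commute_self_defect (hV : IsDoublyCommuting V) {i j : ι} (hij : i ≠ j) (t : ℝ≥0) :
    Commute (V (Pi.single i t)) (defect (hV.coord j)) :=
  commute_defect _ (fun _ => hV.commute _ _) fun s => hV.commute_adjoint i j hij t s

/-- The product of the coordinate defect operators along a list of coordinates. -/
noncomputable def jointDefect (hV : IsDoublyCommuting V) (l : List ι) : H →L[ℂ] H :=
  (l.map fun i => defect (hV.coord i)).prod

theorem jointDefect_cons (hV : IsDoublyCommuting V) (i : ι) (l : List ι) :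
    hV.jointDefect (i :: l) = defect (hV.coord i) * hV.jointDefect l := by
  simp [jointDefect]

theorem eq_zero_of_jointDefect (hV : IsDoublyCommuting V)
    (hpure : ∀ i x, Tendsto (fun t => adjoint (V (Pi.single i t)) x) atTop (𝓝 0))
    {l : List ι} (hl : l.Nodup) {x : H} (hx : ∀ s, hV.jointDefect l (adjoint (V s) x) = 0) :
    x = 0 := by
  induction l with
  | nil =>
    have := hx 0
    rw [hV.zero] at this
    simpa [jointDefect, ← star_eq_adjoint] using this
  | cons i l ih =>
    obtain ⟨hi, hl⟩ := List.nodup_cons.1 hl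
    refine ih hl fun s => eq_zero_of_defect_adjoint (hV.coord i) (hpure i) fun t => ?_
    have hcomm : Commute (adjoint (V (Pi.single i t))) (hV.jointDefect l) := by
      refine Commute.list_prod_right _ _ fun A hA => ?_
      obtain ⟨j, hj, rfl⟩ := List.mem_map.1 hA
      exact hV.commute_adjoint_defect (by rintro rfl; exact hi hj) t
    have h := hx (Pi.single i t + s)
    rw [jointDefect_cons, hV.adjoint_add, mul_apply_eq_comp, mul_apply_eq_comp] at h
    rw [← h]
    congr 1
    exact congrArg (fun B : H →L[ℂ] H => B (adjoint (V s) x)) hcomm.eq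

theorem jointDefect_mul (hV : IsDoublyCommuting V) {l : List ι} {i : ι} (hi : i ∈ l) (t : ℝ≥0) :
    hV.jointDefect l * V (Pi.single i t) = (Real.exp (-t) : ℂ) • hV.jointDefect l := by
  induction l with
  | nil => simp at hi
  | cons j l ih =>
    rw [jointDefect_cons, mul_assoc]
    by_cases h : i ∈ l
    · rw [ih h, mul_smul_comm]
    · obtain rfl : i = j := by simpa [h] using hi
      have hcomm : Commute (V (Pi.single i t)) (hV.jointDefect l) := by
        refine Commute.list_prod_right _ _ fun A hA => ?_
        obtain ⟨j, hj, rfl⟩ := List.mem_map.1 hA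
        exact hV.commute_self_defect (by rintro rfl; exact h hj) t
      rw [← hcomm.eq, ← mul_assoc, defect_mul (hV.coord i) (fun _ => hV.norm_eq _),
        smul_mul_assoc]

theorem inner_map_map (hV : IsDoublyCommuting V) (t : ι → ℝ≥0) (x y : H) :
    ⟪V t x, V t y⟫_ℂ = ⟪x, y⟫_ℂ := by
  rw [inner_map_map_iff_adjoint_comp_self _ |>.2]
  exact (norm_map_iff_adjoint_comp_self _).1 (hV.norm_eq t)

variable [Fintype ι]

theorem adjoint_jointDefect_mem (hV : IsDoublyCommuting V) (x : H) :
    adjoint (hV.jointDefect Finset.univ.toList) x ∈ vacuum V := by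
  intro t
  refine Pi.single_induction (fun t : ι → ℝ≥0 => adjoint (V t) _ =
    (Real.exp (-∑ i, (t i : ℝ)) : ℂ) • _) t ?_ ?_ ?_
  · rw [hV.zero]
    simp [← star_eq_adjoint]
  · intro s t hs ht
    rw [hV.adjoint_add, mul_apply_eq_comp, ht, map_smul, hs, smul_smul, ← Complex.ofReal_mul,
      ← Real.exp_add]
    simp only [Pi.add_apply, NNReal.coe_add, Finset.sum_add_distrib]
    congr 3
    ring
  · intro i t
    have h := congrArg star (hV.jointDefect_mul (l := Finset.univ.toList) (i := i) (by simp) t)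
    rw [star_mul, star_smul] at h
    have h' := congrArg (fun B : H →L[ℂ] H => B x) h
    have h2 : ∑ j, ((Pi.single i t : ι → ℝ≥0) j : ℝ) = t := by
      rw [Finset.sum_eq_single i] <;> simp +contextual
    rw [h2]
    simpa [← Complex.exp_conj, star_eq_adjoint] using h'

theorem eq_zero_of_inner_vacuum (hV : IsDoublyCommuting V)
    (hpure : ∀ i x, Tendsto (fun t => adjoint (V (Pi.single i t)) x) atTop (𝓝 0))
    {x : H} (hx : ∀ s, ∀ k ∈ vacuum V, ⟪V s k, x⟫_ℂ = 0) : x = 0 := by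
  refine hV.eq_zero_of_jointDefect hpure (Finset.nodup_toList Finset.univ) fun s => ?_
  refine ext_inner_left ℂ fun y => ?_
  rw [← adjoint_inner_left, adjoint_inner_right, inner_zero_right]
  exact hx s _ (hV.adjoint_jointDefect_mem y)

theorem commute_adjoint_of_disjoint (hV : IsDoublyCommuting V) {a b : ι → ℝ≥0}
    (hab : ∀ i, a i = 0 ∨ b i = 0) : Commute (V a) (adjoint (V b)) := by
  have key : ∀ (A : H →L[ℂ] H) (c : ι → ℝ≥0), (∀ i, Commute (V (Pi.single i (c i))) A) →
      Commute (V c) A := by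
    intro A c h
    rw [← Finset.univ_sum_single c]
    refine Finset.sum_induction (fun i => Pi.single i (c i)) (fun c => Commute (V c) A)
      (fun s t hs ht => ?_) ?_ fun i _ => h i
    · rw [hV.add]; exact hs.mul_left ht
    · rw [hV.zero]; exact Commute.one_left A
  refine key _ _ fun i => ?_
  refine commute_star_star.1 ?_
  rw [star_eq_adjoint (adjoint (V b)), adjoint_adjoint]
  refine Commute.symm (key _ _ fun j => ?_)
  by_cases hij : i = j
  · subst hij
    rcases hab i with h | h
    · rw [h, Pi.single_zero, hV.zero, star_one]; exact Commute.one_right _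
    · rw [h, Pi.single_zero, hV.zero]; exact Commute.one_left _
  · exact hV.commute_adjoint j i (Ne.symm hij) _ _

theorem inner_vacuum (hV : IsDoublyCommuting V) (s t : ι → ℝ≥0) {x y : H}
    (hx : x ∈ vacuum V) (hy : y ∈ vacuum V) :
    ⟪V s x, V t y⟫_ℂ = (Real.exp (-∑ i, |(s i : ℝ) - t i|) : ℂ) * ⟪x, y⟫_ℂ := by
  have hs : V s = V (s ⊓ t) * V (s - t) := by
    rw [← hV.add]; congr 1; funext i
    rcases le_total (s i) (t i) with h | h <;> simp [h, tsub_eq_zero_of_le]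
  have ht : V t = V (s ⊓ t) * V (t - s) := by
    rw [← hV.add]; congr 1; funext i
    rcases le_total (s i) (t i) with h | h <;> simp [h, tsub_eq_zero_of_le]
  have hcomm := hV.commute_adjoint_of_disjoint (a := t - s) (b := s - t) fun i => by
    rcases le_total (s i) (t i) with h | h
    · right; exact tsub_eq_zero_of_le h
    · left; exact tsub_eq_zero_of_le h
  have h1 : adjoint (V (s - t)) (V (t - s) y) = V (t - s) (adjoint (V (s - t)) y) :=
    congrArg (fun B : H →L[ℂ] H => B y) hcomm.eq.symm
  rw [hs, ht, mul_apply_eq_comp, mul_apply_eq_comp, hV.inner_map_map, ← adjoint_inner_right, h1,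
    ← adjoint_inner_left, hx, hy, inner_smul_left, inner_smul_right, Complex.conj_ofReal,
    ← mul_assoc, ← Complex.ofReal_mul, ← Real.exp_add, ← neg_add, ← Finset.sum_add_distrib]
  congr 4
  refine Finset.sum_congr rfl fun i _ => ?_
  simp only [Pi.sub_apply]
  rcases le_total (s i) (t i) with h | h
  · rw [tsub_eq_zero_of_le h, NNReal.coe_sub h, abs_of_nonpos (sub_nonpos.2 (by exact_mod_cast h))]
    simp
  · rw [tsub_eq_zero_of_le h, NNReal.coe_sub h, abs_of_nonneg (sub_nonneg.2 (by exact_mod_cast h))]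
    simp

end IsDoublyCommuting

end DoublyCommuting
section Extension

theorem denseRange_linearCombination {κ G : Type*} [NormedAddCommGroup G]
    [InnerProductSpace ℂ G] [CompleteSpace G] {u : κ → G}
    (hu : ∀ x, (∀ i, ⟪u i, x⟫_ℂ = 0) → x = 0) :
    DenseRange (Finsupp.linearCombination ℂ u) := by
  have h : (LinearMap.range (Finsupp.linearCombination ℂ u)).topologicalClosure = ⊤ := by
    rw [Submodule.topologicalClosure_eq_top_iff, Submodule.eq_bot_iff]
    exact fun x hx => hu x fun i =>
      (Submodule.mem_orthogonal _ _).1 hx _ ⟨Finsupp.single i 1, by simp⟩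
  exact Submodule.dense_iff_topologicalClosure_eq_top.2 h

theorem exists_linearIsometryEquiv_of_inner_eq {κ E F : Type*}
    [NormedAddCommGroup E] [InnerProductSpace ℂ E] [CompleteSpace E]
    [NormedAddCommGroup F] [InnerProductSpace ℂ F] [CompleteSpace F]
    (v : κ → E) (w : κ → F) (h : ∀ i j, ⟪v i, v j⟫_ℂ = ⟪w i, w j⟫_ℂ)
    (hv : ∀ x, (∀ i, ⟪v i, x⟫_ℂ = 0) → x = 0) (hw : ∀ x, (∀ i, ⟪w i, x⟫_ℂ = 0) → x = 0) :
    ∃ U : E ≃ₗᵢ[ℂ] F, ∀ i, U (v i) = w i := by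
  have hnorm : ∀ x, ‖Finsupp.linearCombination ℂ w x‖ = ‖Finsupp.linearCombination ℂ v x‖ := by
    intro x
    refine (sq_eq_sq₀ (norm_nonneg _) (norm_nonneg _)).1 ?_
    rw [← inner_self_eq_norm_sq (𝕜 := ℂ), ← inner_self_eq_norm_sq (𝕜 := ℂ)]
    simp only [Finsupp.linearCombination_apply, Finsupp.sum, sum_inner, inner_sum,
      inner_smul_left, inner_smul_right, h]
  refine ⟨(LinearEquiv.refl ℂ (κ →₀ ℂ)).extendOfIsometry (Finsupp.linearCombination ℂ v)
    (Finsupp.linearCombination ℂ w) (denseRange_linearCombination hv) (denseRange_linearCombination hw) hnorm, fun i => ?_⟩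
  have := (LinearEquiv.refl ℂ (κ →₀ ℂ)).extendOfIsometry_eq
    (Finsupp.linearCombination ℂ v) (Finsupp.linearCombination ℂ w) (denseRange_linearCombination hv) (denseRange_linearCombination hw) hnorm
    (Finsupp.single i 1)
  simpa using this

/-- A separable Hilbert space has an isometric copy in the lowest universe. -/
theorem exists_linearIsometryEquiv_type {K : Type*} [NormedAddCommGroup K]
    [InnerProductSpace ℂ K] [CompleteSpace K] [TopologicalSpace.SeparableSpace K] :
    ∃ (K' : Type) (_ : NormedAddCommGroup K') (_ : InnerProductSpace ℂ K')
      (_ : CompleteSpace K') (_ : TopologicalSpace.SeparableSpace K'),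
      Nonempty (K' ≃ₗᵢ[ℂ] K) := by
  obtain ⟨w, b, hb⟩ := exists_hilbertBasis ℂ K
  have hw : w.Countable := by
    refine Set.PairwiseDisjoint.countable_of_isOpen (s := fun x => Metric.ball x (1 / 2))
      (fun x hx y hy hxy => ?_) (fun _ _ => Metric.isOpen_ball)
      fun x _ => ⟨x, Metric.mem_ball_self (by norm_num)⟩
    refine Metric.ball_disjoint_ball ?_
    have ho := b.orthonormal
    have hne : (⟨x, hx⟩ : w) ≠ ⟨y, hy⟩ := fun h => hxy (congrArg Subtype.val h)
    have h1 := ho.2 hne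
    have h2 := ho.1 ⟨x, hx⟩
    have h3 := ho.1 ⟨y, hy⟩
    rw [hb] at h1 h2 h3
    have h4 := norm_sub_sq (𝕜 := ℂ) x y
    simp only at h1 h2 h3
    rw [h1, h2, h3] at h4
    rw [dist_eq_norm]
    norm_num at h4 ⊢
    nlinarith [norm_nonneg (x - y)]
  obtain ⟨f, hf⟩ := hw.to_subtype.exists_injective_nat
  let e : Set.range f ≃ w := (Equiv.ofInjective f hf).symm
  have ho : Orthonormal ℂ (b ∘ e) := b.orthonormal.comp _ e.injective
  let b' : HilbertBasis (Set.range f) ℂ K := HilbertBasis.mk ho (by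
    rw [e.surjective.range_comp]; exact b.dense_span.ge)
  exact ⟨_, inferInstance, inferInstance, inferInstance,
    b'.repr.toHomeomorph.symm.symm.surjective.denseRange.separableSpace b'.repr.continuous,
    ⟨b'.repr.symm⟩⟩

end Extension
section Model

variable {ι : Type*} [Fintype ι]

/-- Lebesgue measure on the nonnegative cone. -/
noncomputable abbrev coneMeasure (ι : Type*) [Fintype ι] : Measure (ι → ℝ) :=
  (volume : Measure (ι → ℝ)).restrict {x | ∀ i, 0 ≤ x i}

theorem measurableSet_forall_le (a : ι → ℝ) : MeasurableSet {x : ι → ℝ | ∀ i, a i ≤ x i} :=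
  measurableSet_Ici (a := a)

theorem measurableSet_cone : MeasurableSet {x : ι → ℝ | ∀ i, 0 ≤ x i} :=
  measurableSet_forall_le (0 : ι → ℝ)

/-- The decaying exponential `u ↦ exp (-(u - a))` on `[a, ∞)`, extended by zero. -/
noncomputable def expTail (a u : ℝ) : ℝ := (Ici a).indicator (fun u => Real.exp (-(u - a))) u

theorem expTail_add (a b u : ℝ) : expTail (a + b) u = expTail a (u - b) := by
  have h : a ≤ u - b ↔ a + b ≤ u := le_sub_iff_add_le
  by_cases hu : a + b ≤ u
  · rw [expTail, expTail, indicator_of_mem (mem_Ici.2 hu), indicator_of_mem (mem_Ici.2 (h.2 hu))]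
    congr 1
    ring
  · rw [expTail, expTail, indicator_of_notMem (by simpa using hu)]
    exact (indicator_of_notMem (fun h' => hu (h.1 (mem_Ici.1 h'))) _).symm

theorem expTail_of_le {a u : ℝ} (h : a ≤ u) : expTail a u = Real.exp (-(u - a)) :=
  indicator_of_mem (mem_Ici.2 h) _

theorem expTail_of_lt {a u : ℝ} (h : u < a) : expTail a u = 0 :=
  indicator_of_notMem (by simpa using h) _

theorem measurable_expTail (a : ℝ) : Measurable (expTail a) := by
  unfold expTail
  exact Measurable.indicator (by fun_prop) measurableSet_Ici

theorem expTail_mul (a b : ℝ) : (fun u => expTail a u * expTail b u) =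
    (Ici (max a b)).indicator fun u => Real.exp (a + b) * Real.exp (-2 * u) := by
  ext u
  by_cases h : max a b ≤ u
  · rw [indicator_of_mem (mem_Ici.2 h), expTail_of_le (le_of_max_le_left h),
      expTail_of_le (le_of_max_le_right h), ← Real.exp_add, ← Real.exp_add]
    congr 1
    ring
  · rw [indicator_of_notMem (by simpa using h)]
    rcases lt_max_iff.1 (not_le.1 h) with h | h
    · rw [expTail_of_lt h, zero_mul]
    · rw [expTail_of_lt h, mul_zero]

theorem integrable_expTail_mul (a b : ℝ) :
    Integrable fun u => expTail a u * expTail b u := by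
  rw [expTail_mul, integrable_indicator_iff measurableSet_Ici, integrableOn_Ici_iff_integrableOn_Ioi]
  exact (integrableOn_exp_mul_Ioi (by norm_num) _).const_mul _

theorem integral_expTail_mul (a b : ℝ) :
    ∫ u, expTail a u * expTail b u = 2⁻¹ * Real.exp (-|a - b|) := by
  rw [expTail_mul, integral_indicator measurableSet_Ici, integral_Ici_eq_integral_Ioi,
    integral_const_mul, integral_exp_mul_Ioi (by norm_num)]
  have h : Real.exp (-|a - b|) = Real.exp (a + b) * Real.exp (-2 * max a b) := by
    rw [← Real.exp_add]
    congr 1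
    rcases le_total a b with h | h
    · rw [max_eq_right h, abs_of_nonpos (sub_nonpos.2 h)]; ring
    · rw [max_eq_left h, abs_of_nonneg (sub_nonneg.2 h)]; ring
  rw [h]
  ring

/-- The normalized exponential on the translated cone `s + ℝ₊^ι`, extended by zero. -/
noncomputable def coneExp (s x : ι → ℝ) : ℝ :=
  √(2 ^ Fintype.card ι) * ∏ i, expTail (s i) (x i)

theorem measurable_coneExp (s : ι → ℝ) : Measurable (coneExp s) :=
  (Finset.measurable_prod _ fun i _ =>
    (measurable_expTail (s i)).comp (measurable_pi_apply i)).const_mul _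

theorem coneExp_mul (s t x : ι → ℝ) : coneExp s x * coneExp t x =
    2 ^ Fintype.card ι * ∏ i, expTail (s i) (x i) * expTail (t i) (x i) := by
  rw [coneExp, coneExp, mul_mul_mul_comm, Real.mul_self_sqrt (by positivity),
    Finset.prod_mul_distrib]

theorem integrable_coneExp_mul (s t : ι → ℝ) : Integrable fun x => coneExp s x * coneExp t x := by
  simp only [coneExp_mul]
  exact (Integrable.fintype_prod (f := fun i u => expTail (s i) u * expTail (t i) u)
    fun i => integrable_expTail_mul (s i) (t i)).const_mul _

theorem integral_coneExp_mul (s t : ι → ℝ) :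
    ∫ x, coneExp s x * coneExp t x = Real.exp (-∑ i, |s i - t i|) := by
  simp only [coneExp_mul]
  rw [integral_const_mul,
    integral_fintype_prod_volume_eq_prod fun i u => expTail (s i) u * expTail (t i) u]
  simp only [integral_expTail_mul]
  rw [Finset.prod_mul_distrib, ← Real.exp_sum, Finset.sum_neg_distrib]
  simp

theorem coneExp_of_lt {s x : ι → ℝ} {i : ι} (h : x i < s i) : coneExp s x = 0 := by
  rw [coneExp, Finset.prod_eq_zero (Finset.mem_univ i) (expTail_of_lt h), mul_zero]

theorem coneExp_of_le {s x : ι → ℝ} (h : ∀ i, s i ≤ x i) :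
    coneExp s x = √(2 ^ Fintype.card ι) * Real.exp (-∑ i, (x i - s i)) := by
  rw [coneExp, Finset.prod_congr rfl fun i _ => expTail_of_le (h i), ← Real.exp_sum,
    Finset.sum_neg_distrib]

theorem indicator_coneExp_sub (s t x : ι → ℝ) (hs : ∀ i, 0 ≤ s i) :
    {x : ι → ℝ | ∀ i, t i ≤ x i}.indicator (fun x => coneExp s (x - t)) x = coneExp (s + t) x := by
  by_cases h : ∀ i, t i ≤ x i
  · rw [indicator_of_mem (show x ∈ {x : ι → ℝ | ∀ i, t i ≤ x i} from h)]
    simp [coneExp, expTail_add]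
  · rw [indicator_of_notMem (show x ∉ {x : ι → ℝ | ∀ i, t i ≤ x i} from h)]
    obtain ⟨i, hi⟩ := not_forall.1 h
    exact (coneExp_of_lt (i := i) (by simpa using (not_le.1 hi).trans_le (by simp [hs i]))).symm

variable {K : Type*} [NormedAddCommGroup K] [InnerProductSpace ℂ K]

theorem memLp_coneExp_smul (s : ι → ℝ) (k : K) :
    MemLp (fun x => (coneExp s x : ℂ) • k) 2 (coneMeasure ι) := by
  have hm : AEStronglyMeasurable (fun x => (coneExp s x : ℂ)) (coneMeasure ι) :=
    (Complex.measurable_ofReal.comp (measurable_coneExp s)).aestronglyMeasurable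
  rw [memLp_two_iff_integrable_sq_norm (hm.smul_const k)]
  refine ((integrable_coneExp_mul s s).mul_const (‖k‖ ^ 2)).restrict.congr
    (ae_of_all _ fun x => ?_)
  simp only [norm_smul, Complex.norm_real, mul_pow, Real.norm_eq_abs, sq_abs]
  ring

/-- The class in `L²` of `x ↦ coneExp s x • k`. -/
noncomputable def coneExpLp (s : ι → ℝ) (k : K) : Lp K 2 (coneMeasure ι) :=
  (memLp_coneExp_smul s k).toLp _

theorem coeFn_coneExpLp (s : ι → ℝ) (k : K) :
    coneExpLp s k =ᵐ[coneMeasure ι] fun x => (coneExp s x : ℂ) • k :=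
  MemLp.coeFn_toLp _

theorem inner_coneExpLp {s t : ι → ℝ} (hs : ∀ i, 0 ≤ s i) (k l : K) :
    ⟪coneExpLp s k, coneExpLp t l⟫_ℂ = (Real.exp (-∑ i, |s i - t i|) : ℂ) * ⟪k, l⟫_ℂ := by
  rw [L2.inner_def, ← integral_coneExp_mul, ← integral_complex_ofReal, ← integral_mul_const]
  have h : ∀ᵐ x ∂coneMeasure ι, ⟪coneExpLp s k x, coneExpLp t l x⟫_ℂ =
      ((coneExp s x * coneExp t x : ℝ) : ℂ) * ⟪k, l⟫_ℂ := by
    filter_upwards [coeFn_coneExpLp s k, coeFn_coneExpLp t l] with x h1 h2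
    rw [h1, h2, inner_smul_left, inner_smul_right, Complex.conj_ofReal, Complex.ofReal_mul,
      mul_assoc]
  rw [integral_congr_ae h]
  refine setIntegral_eq_integral_of_forall_compl_eq_zero fun x hx => ?_
  obtain ⟨i, hi⟩ := not_forall.1 hx
  rw [coneExp_of_lt (i := i) ((not_le.1 hi).trans_le (hs i))]
  simp

theorem ae_eq_zero_of_forall_setIntegral_Ici {ν : Measure (ι → ℝ)} {g : (ι → ℝ) → ℂ}
    (hg : Integrable g ν) (h0 : ∫ x, g x ∂ν = 0) (h : ∀ a, ∫ x in Ici a, g x ∂ν = 0) :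
    g =ᵐ[ν] 0 := by
  have hgen : (MeasurableSpace.pi : MeasurableSpace (ι → ℝ)) =
      MeasurableSpace.generateFrom (pi univ '' pi univ fun _ : ι => range Ici) := by
    refine (generateFrom_eq_pi (fun _ => ?_) fun _ => ?_).symm
    · rw [← borel_eq_generateFrom_Ici]; exact (BorelSpace.measurable_eq (α := ℝ)).symm
    · refine ⟨fun n : ℕ => Ici (-(n : ℝ)), fun n => ⟨_, rfl⟩, eq_univ_of_forall fun x => ?_⟩
      obtain ⟨n, hn⟩ := exists_nat_ge (-x)
      exact mem_iUnion.2 ⟨n, mem_Ici.2 (by linarith)⟩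
  have hpi : IsPiSystem (pi univ '' pi univ fun _ : ι => range (Ici : ℝ → Set ℝ)) := by
    refine IsPiSystem.pi fun _ => ?_
    rintro _ ⟨a, rfl⟩ _ ⟨b, rfl⟩ _
    exact ⟨_, Ici_inter_Ici.symm⟩
  refine hg.ae_eq_zero_of_forall_setIntegral_eq_zero fun A hA hfin => ?_
  clear hfin
  induction A, hA using MeasurableSpace.induction_on_inter hgen hpi with
  | empty => simp
  | basic A hA =>
    obtain ⟨c, hc, rfl⟩ := hA
    choose a ha using fun i => hc i (mem_univ i)
    have : pi univ c = Ici a := by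
      rw [← funext ha]; exact pi_univ_Ici a
    rw [this]; exact h a
  | compl A hA ih =>
    have := integral_add_compl hA hg
    rwa [ih, zero_add, h0] at this
  | iUnion f hd hf ih =>
    rw [integral_iUnion hf hd hg.integrableOn]
    simp [ih]

theorem eq_zero_of_inner_coneExpLp [TopologicalSpace.SeparableSpace K]
    {f : Lp K 2 (coneMeasure ι)}
    (hf : ∀ (s : ι → ℝ≥0) (k : K), ⟪coneExpLp (fun i => (s i : ℝ)) k, f⟫_ℂ = 0) : f = 0 := by
  rw [Lp.eq_zero_iff_ae_eq_zero]
  refine ae_eq_zero_of_forall_inner (𝕜 := ℂ) fun k => ?_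
  set g : (ι → ℝ) → ℂ := fun x => ⟪coneExpLp (0 : ι → ℝ) k x, f x⟫_ℂ with hg
  have hgint : Integrable g (coneMeasure ι) := L2.integrable_inner _ _
  have hg' : ∀ᵐ x ∂coneMeasure ι, g x = (coneExp 0 x : ℂ) * ⟪k, f x⟫_ℂ := by
    filter_upwards [coeFn_coneExpLp 0 k] with x h1
    rw [hg]
    simp only [h1]
    rw [inner_smul_left, Complex.conj_ofReal]
  have hcone : ∀ᵐ x ∂coneMeasure ι, ∀ i, 0 ≤ x i := ae_restrict_mem measurableSet_cone
  have hset : ∀ s : ι → ℝ≥0, ∫ x in Ici (fun i => (s i : ℝ)), g x ∂coneMeasure ι = 0 := by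
    intro s
    have h1 := hf s k
    rw [L2.inner_def] at h1
    have h2 : ∀ᵐ x ∂coneMeasure ι, (Ici fun i => (s i : ℝ)).indicator g x =
        (Real.exp (-∑ i, (s i : ℝ)) : ℂ) * ⟪coneExpLp (fun i => (s i : ℝ)) k x, f x⟫_ℂ := by
      filter_upwards [coeFn_coneExpLp (fun i => (s i : ℝ)) k, hg', hcone] with x h3 h4 h5
      rw [h3, inner_smul_left, Complex.conj_ofReal, ← mul_assoc, ← Complex.ofReal_mul]
      by_cases hx : ∀ i, (s i : ℝ) ≤ x i
      · rw [indicator_of_mem (mem_Ici.2 hx), h4, coneExp_of_le hx, coneExp_of_le (s := 0) h5,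
          mul_left_comm (Real.exp _), ← Real.exp_add]
        congr 4
        simp only [Finset.sum_sub_distrib, Pi.zero_apply, sub_zero]
        ring
      · rw [indicator_of_notMem fun h' => hx (mem_Ici.1 h')]
        obtain ⟨i, hi⟩ := not_forall.1 hx
        rw [coneExp_of_lt (i := i) (not_le.1 hi)]
        simp
    rw [← integral_indicator measurableSet_Ici, integral_congr_ae h2, integral_const_mul, h1,
      mul_zero]
  have hzero : g =ᵐ[coneMeasure ι] 0 := by
    refine ae_eq_zero_of_forall_setIntegral_Ici hgint (hf 0 k) fun a => ?_
    rw [← hset fun i => (a i).toNNReal]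
    refine setIntegral_congr_set ?_
    filter_upwards [hcone] with x hx
    refine propext (forall_congr' fun i => ?_)
    simp [hx i]
  filter_upwards [hzero, hg', hcone] with x h1 h2 h3
  rw [h2, coneExp_of_le (s := 0) h3] at h1
  refine (mul_eq_zero.1 h1).resolve_left (Complex.ofReal_ne_zero.2 ?_)
  positivity

end Model
section Shift

variable {ι : Type*} [Fintype ι] {K : Type*} [NormedAddCommGroup K]

theorem coneMeasure_restrict_forall_le (t : ι → ℝ≥0) :
    (coneMeasure ι).restrict {x | ∀ i, (t i : ℝ) ≤ x i} =
      (volume : Measure (ι → ℝ)).restrict {x | ∀ i, (t i : ℝ) ≤ x i} :=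
  Measure.restrict_restrict_of_subset fun _ hx i => (t i).coe_nonneg.trans (hx i)

theorem measurePreserving_sub_coneMeasure (t : ι → ℝ≥0) :
    MeasurePreserving (fun x : ι → ℝ => x - fun i => (t i : ℝ))
      ((coneMeasure ι).restrict {x | ∀ i, (t i : ℝ) ≤ x i}) (coneMeasure ι) := by
  have h := (measurePreserving_sub_right (volume : Measure (ι → ℝ))
    fun i => (t i : ℝ)).restrict_preimage (measurableSet_cone (ι := ι))
  rw [coneMeasure_restrict_forall_le]
  have hs : (fun x : ι → ℝ => x - fun i => (t i : ℝ)) ⁻¹' {x | ∀ i, 0 ≤ x i} =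
      {x | ∀ i, (t i : ℝ) ≤ x i} := by
    ext x
    simp
  rwa [hs] at h

theorem ae_imp_sub {p : (ι → ℝ) → Prop} (h : ∀ᵐ x ∂coneMeasure ι, p x) (t : ι → ℝ≥0) :
    ∀ᵐ x ∂coneMeasure ι, (∀ i, (t i : ℝ) ≤ x i) → p (x - fun i => (t i : ℝ)) :=
  (ae_restrict_iff' (measurableSet_forall_le _)).1
    ((measurePreserving_sub_coneMeasure t).quasiMeasurePreserving.ae h)

/-- Translation by `t` on the cone, extended by zero. -/
noncomputable def shiftFun (t : ι → ℝ≥0) (f : (ι → ℝ) → K) : (ι → ℝ) → K :=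
  {x : ι → ℝ | ∀ i, (t i : ℝ) ≤ x i}.indicator fun x => f (x - fun i => (t i : ℝ))

theorem shiftFun_congr_ae (t : ι → ℝ≥0) {f g : (ι → ℝ) → K} (h : f =ᵐ[coneMeasure ι] g) :
    shiftFun t f =ᵐ[coneMeasure ι] shiftFun t g := by
  filter_upwards [ae_imp_sub h t] with x hx
  by_cases hx' : x ∈ {x : ι → ℝ | ∀ i, (t i : ℝ) ≤ x i}
  · rw [shiftFun, shiftFun, indicator_of_mem hx', indicator_of_mem hx', hx hx']
  · rw [shiftFun, shiftFun, indicator_of_notMem hx', indicator_of_notMem hx']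

theorem eLpNorm_shiftFun (t : ι → ℝ≥0) {f : (ι → ℝ) → K}
    (hf : AEStronglyMeasurable f (coneMeasure ι)) :
    eLpNorm (shiftFun t f) 2 (coneMeasure ι) = eLpNorm f 2 (coneMeasure ι) := by
  rw [shiftFun, eLpNorm_indicator_eq_eLpNorm_restrict (measurableSet_forall_le _)]
  exact eLpNorm_comp_measurePreserving hf (measurePreserving_sub_coneMeasure t)

theorem memLp_shiftFun (t : ι → ℝ≥0) {f : (ι → ℝ) → K} (hf : MemLp f 2 (coneMeasure ι)) :
    MemLp (shiftFun t f) 2 (coneMeasure ι) :=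
  (memLp_indicator_iff_restrict (measurableSet_forall_le _)).2
    (hf.comp_measurePreserving (measurePreserving_sub_coneMeasure t))

variable [InnerProductSpace ℂ K]

/-- The shift by `t` on `L²` of the cone. -/
noncomputable def shift (t : ι → ℝ≥0) :
    Lp K 2 (coneMeasure ι) →ₗᵢ[ℂ] Lp K 2 (coneMeasure ι) where
  toFun f := (memLp_shiftFun t (Lp.memLp f)).toLp _
  map_add' f g := by
    rw [← MemLp.toLp_add, MemLp.toLp_eq_toLp_iff]
    refine (shiftFun_congr_ae t (Lp.coeFn_add f g)).trans (ae_of_all _ fun x => ?_)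
    exact congrFun (indicator_add _ _ _) x
  map_smul' c f := by
    rw [RingHom.id_apply, ← MemLp.toLp_const_smul, MemLp.toLp_eq_toLp_iff]
    refine (shiftFun_congr_ae t (Lp.coeFn_smul c f)).trans (ae_of_all _ fun x => ?_)
    exact congrFun (indicator_const_smul _ c _) x
  norm_map' f := by
    change ‖(memLp_shiftFun t (Lp.memLp f)).toLp _‖ = ‖f‖
    rw [Lp.norm_toLp, Lp.norm_def, eLpNorm_shiftFun t (Lp.aestronglyMeasurable f)]

theorem coeFn_shift (t : ι → ℝ≥0) (f : Lp K 2 (coneMeasure ι)) :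
    shift t f =ᵐ[coneMeasure ι] shiftFun t f :=
  MemLp.coeFn_toLp (memLp_shiftFun t (Lp.memLp f))

theorem shift_coneExpLp (t s : ι → ℝ≥0) (k : K) :
    shift t (coneExpLp (fun i => (s i : ℝ)) k) = coneExpLp (fun i => ((t + s) i : ℝ)) k := by
  refine Lp.ext ((coeFn_shift t _).trans ((shiftFun_congr_ae t (coeFn_coneExpLp _ k)).trans
    (EventuallyEq.trans (ae_of_all _ fun x => ?_) (coeFn_coneExpLp _ k).symm)))
  have h := indicator_coneExp_sub (fun i => (s i : ℝ)) (fun i => (t i : ℝ)) x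
    fun i => (s i).coe_nonneg
  have hst : (fun i => ((t + s) i : ℝ)) = (fun i => (s i : ℝ)) + fun i => (t i : ℝ) := by
    ext i
    simp [add_comm]
  simp only [shiftFun]
  rw [hst, ← h]
  by_cases hx : x ∈ {x : ι → ℝ | ∀ i, (t i : ℝ) ≤ x i}
  · rw [indicator_of_mem hx, indicator_of_mem hx]
  · rw [indicator_of_notMem hx, indicator_of_notMem hx, Complex.ofReal_zero, zero_smul]

end Shift

theorem isClosed_vacuum {ι H : Type*} [Fintype ι] [NormedAddCommGroup H] [InnerProductSpace ℂ H]
    [CompleteSpace H] (V : (ι → ℝ≥0) → H →L[ℂ] H) : IsClosed (vacuum V : Set H) := by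
  have h : (vacuum V : Set H) =
      ⋂ t, {x | adjoint (V t) x = (Real.exp (-∑ i, (t i : ℝ)) : ℂ) • x} := by
    ext x
    rw [mem_iInter]
    rfl
  rw [h]
  exact isClosed_iInter fun t =>
    isClosed_eq (adjoint (V t)).continuous (continuous_id.const_smul _)

end Cooper

/-- Cooper's theorem, doubly commuting multiparameter version: a strongly
continuous, doubly commuting, strongly pure isometric representation of `ℝ₊^d` on a separable
Hilbert space is unitarily equivalent to the `K`-valued shift semigroup on `L²(ℝ₊^d; K)` for
some separable Hilbert space `K`. Here `L²(ℝ₊^d; K)` is realized as `Lp K 2 μ` where `μ` is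
Lebesgue measure on `ℝ^d` restricted to the nonnegative cone. -/
theorem stmt_7 (d : ℕ) (hd : 1 ≤ d)
    (H : Type*) [NormedAddCommGroup H] [InnerProductSpace ℂ H] [CompleteSpace H]
    [TopologicalSpace.SeparableSpace H]
    (V : (Fin d → NNReal) → H →L[ℂ] H)
    (hV0 : V 0 = 1)
    (hVadd : ∀ s t : Fin d → NNReal, V (s + t) = V s * V t)
    (hiso : ∀ (t : Fin d → NNReal) (x : H), ‖V t x‖ = ‖x‖)
    (hcont : ∀ ξ : H, Continuous fun t : Fin d → NNReal => V t ξ)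
    (hdc : ∀ i j : Fin d, i ≠ j → ∀ s t : NNReal,
      V (Pi.single i s) * adjoint (V (Pi.single j t))
        = adjoint (V (Pi.single j t)) * V (Pi.single i s))
    (hpure : ∀ (i : Fin d) (ξ : H),
      Tendsto (fun t : NNReal => adjoint (V (Pi.single i t)) ξ) atTop (𝓝 0)) :
    ∃ (K : Type) (_ : NormedAddCommGroup K) (_ : InnerProductSpace ℂ K)
      (_ : CompleteSpace K) (_ : TopologicalSpace.SeparableSpace K)
      (S : (Fin d → NNReal) →
        (Lp K 2 ((volume : Measure (Fin d → ℝ)).restrict {x | ∀ i, 0 ≤ x i}) →L[ℂ]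
          Lp K 2 ((volume : Measure (Fin d → ℝ)).restrict {x | ∀ i, 0 ≤ x i})))
      (U : Lp K 2 ((volume : Measure (Fin d → ℝ)).restrict {x | ∀ i, 0 ≤ x i}) ≃ₗᵢ[ℂ] H),
      (∀ (t : Fin d → NNReal)
          (f : Lp K 2 ((volume : Measure (Fin d → ℝ)).restrict {x | ∀ i, 0 ≤ x i})),
        (S t f : (Fin d → ℝ) → K)
          =ᵐ[(volume : Measure (Fin d → ℝ)).restrict {x | ∀ i, 0 ≤ x i}]
        Set.indicator {x : Fin d → ℝ | ∀ i, (t i : ℝ) ≤ x i}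
          (fun x => f (x - fun i => (t i : ℝ)))) ∧
      ∀ (t : Fin d → NNReal) (ξ : H), U (S t (U.symm ξ)) = V t ξ := by
  open Cooper in
  have hV : IsDoublyCommuting V := ⟨hV0, hVadd, hiso, hcont, hdc⟩
  have : CompleteSpace (vacuum V) := (isClosed_vacuum V).completeSpace_coe
  have : SecondCountableTopology H := UniformSpace.secondCountable_of_separable H
  obtain ⟨K, _, _, _, _, ⟨J⟩⟩ := exists_linearIsometryEquiv_type (K := vacuum V)
  let v : (Fin d → NNReal) × K → Lp K 2 (coneMeasure (Fin d)) := fun p =>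
    coneExpLp (fun i => (p.1 i : ℝ)) p.2
  have hv : ∀ x, (∀ p, inner ℂ (v p) x = 0) → x = 0 := fun x hx =>
    eq_zero_of_inner_coneExpLp fun s k => hx (s, k)
  obtain ⟨U, hU⟩ := exists_linearIsometryEquiv_of_inner_eq v
    (fun p : (Fin d → NNReal) × K => V p.1 (J p.2 : H))
    (fun p q => by
      rw [inner_coneExpLp fun i => (p.1 i).coe_nonneg,
        hV.inner_vacuum p.1 q.1 (J p.2).2 (J q.2).2, ← Submodule.coe_inner,
        J.inner_map_map]) hv
    (fun x hx => hV.eq_zero_of_inner_vacuum hpure fun s k hk => by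
      simpa using hx (s, J.symm ⟨k, hk⟩))
  refine ⟨K, inferInstance, inferInstance, inferInstance, inferInstance,
    fun t => (shift t).toContinuousLinearMap, U, fun t f => coeFn_shift t f, fun t ξ => ?_⟩
  have h : ∀ f, U (shift t f) = V t (U f) := by
    refine congrFun ((denseRange_linearCombination hv).equalizer
      (U.continuous.comp (shift t).continuous) ((V t).continuous.comp U.continuous) ?_)
    funext c
    induction c using Finsupp.induction_linear with
    | zero => simp
    | add c c' hc hc' => simp_all
    | single p a =>
      have := hU (t + p.1, p.2)
      simp_all [v, shift_coneExpLp]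
  exact (h _).trans (by rw [U.apply_symm_apply])
end

section
/- Let d ≥ 1 and let S = (S_t)_{t∈ℝ₊^d} be the shift semigroup on L²(ℝ₊^d). If T is a bounded linear operator on L²(ℝ₊^d) such that T S_t = S_t T and T S_t* = S_t* T for every t ∈ ℝ₊^d, then T = c·1 for some scalar c ∈ ℂ. In other words, the shift semigroup is irreducible. -/
open ContinuousLinearMap Filter Topology MeasureTheory

theorem setOf_forall_nonneg_eq_Ici (d : ℕ) : {x : Fin d → ℝ | ∀ i, 0 ≤ x i} = Set.Ici 0 := rfl

theorem measurableSet_setOf_forall_nonneg (d : ℕ) :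
    MeasurableSet {x : Fin d → ℝ | ∀ i, 0 ≤ x i} :=
  setOf_forall_nonneg_eq_Ici d ▸ measurableSet_Ici

/-- Lebesgue measure restricted to the nonnegative cone of `ℝ^d`. -/
noncomputable abbrev coneVolume (d : ℕ) : Measure (Fin d → ℝ) :=
  volume.restrict {x | ∀ i, 0 ≤ x i}

/-- The decaying exponential `x ↦ exp (-∑ i, x i)`. -/
noncomputable def expNegSum (d : ℕ) (x : Fin d → ℝ) : ℂ := ∏ i, (Real.exp (-x i) : ℂ)

theorem expNegSum_ne_zero {d : ℕ} (x : Fin d → ℝ) : expNegSum d x ≠ 0 :=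
  Finset.prod_ne_zero_iff.2 fun i _ => by exact_mod_cast (Real.exp_pos _).ne'

theorem expNegSum_add {d : ℕ} (x y : Fin d → ℝ) :
    expNegSum d (x + y) = expNegSum d x * expNegSum d y := by
  simp only [expNegSum, ← Finset.prod_mul_distrib, Pi.add_apply, neg_add, Real.exp_add,
    Complex.ofReal_mul]

theorem continuous_expNegSum (d : ℕ) : Continuous (expNegSum d) := by
  unfold expNegSum; fun_prop

theorem star_expNegSum {d : ℕ} (x : Fin d → ℝ) : star (expNegSum d x) = expNegSum d x := by
  simp [expNegSum, ← Complex.ofReal_prod, -Complex.ofReal_exp]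

theorem memLp_expNegSum (d : ℕ) :
    MemLp (expNegSum d) 2 (coneVolume d) := by
  refine (memLp_two_iff_integrable_sq_norm
    (continuous_expNegSum d).aestronglyMeasurable).2 ?_
  have hcone : {x : Fin d → ℝ | ∀ i, 0 ≤ x i} = Set.univ.pi fun _ => Set.Ici 0 := by
    ext x; simp only [Set.mem_ofPred_eq, Set.mem_univ_pi, Set.mem_Ici]
  rw [coneVolume, hcone, volume_pi, Measure.restrict_pi_pi]
  have h : Integrable (fun x : ℝ => Real.exp (-2 * x)) (volume.restrict (Set.Ici 0)) :=
    (integrableOn_Ici_iff_integrableOn_Ioi (by simp)).2 (integrableOn_exp_mul_Ioi (by norm_num) 0)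
  convert Integrable.fintype_prod (fun _ : Fin d => h) using 2 with x
  simp only [expNegSum, norm_prod, ← Finset.prod_pow, Complex.norm_real, Real.norm_eq_abs,
    Real.abs_exp, ← Real.exp_nat_mul]
  refine Finset.prod_congr rfl fun i _ => ?_
  congr 1; push_cast; ring

/-- An integrable function on `ℝ^d` whose integrals over all upper orthants vanish is zero. -/
theorem ae_eq_zero_of_forall_setIntegral_Ici_eq_zero {d : ℕ} {μ : Measure (Fin d → ℝ)}
    {k : (Fin d → ℝ) → ℂ} (hk : Integrable k μ) (huniv : ∫ x, k x ∂μ = 0)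
    (h : ∀ t, ∫ x in Set.Ici t, k x ∂μ = 0) : k =ᵐ[μ] 0 := by
  suffices H : ∀ s, MeasurableSet s → ∫ x in s, k x ∂μ = 0 from
    hk.ae_eq_zero_of_forall_setIntegral_eq_zero fun s hs _ => H s hs
  intro s hs
  have hgen : (MeasurableSpace.pi : MeasurableSpace (Fin d → ℝ)) =
      MeasurableSpace.generateFrom
        (Set.pi Set.univ '' Set.pi Set.univ fun _ => Set.range (Set.Ici : ℝ → Set ℝ)) := by
    refine (generateFrom_eq_pi (fun _ => ?_) fun _ => ?_).symm
    · rw [← borel_eq_generateFrom_Ici ℝ]; exact (BorelSpace.measurable_eq).symm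
    · refine ⟨fun n : ℕ => Set.Ici (-(n : ℝ)), fun n => ⟨_, rfl⟩, ?_⟩
      refine Set.iUnion_eq_univ_iff.2 fun x => ?_
      obtain ⟨n, hn⟩ := exists_nat_ge (-x)
      exact ⟨n, by simp; linarith⟩
  have hpi : IsPiSystem
      (Set.pi Set.univ '' Set.pi Set.univ fun _ : Fin d => Set.range (Set.Ici : ℝ → Set ℝ)) := by
    refine IsPiSystem.pi fun _ => ?_
    rintro _ ⟨a, rfl⟩ _ ⟨b, rfl⟩ _
    exact ⟨a ⊔ b, Set.Ici_inter_Ici.symm⟩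
  induction s, hs using MeasurableSpace.induction_on_inter hgen hpi with
  | empty => simp
  | basic s hs =>
    obtain ⟨f, hf, rfl⟩ := hs
    choose t ht using fun i => hf i (Set.mem_univ i)
    obtain rfl : (fun i => Set.Ici (t i)) = f := funext ht
    rw [Set.pi_univ_Ici]
    exact h t
  | compl s hs ih =>
    have := integral_add_compl hs hk
    rwa [ih, huniv, zero_add] at this
  | iUnion f hd hm ih =>
    rw [integral_iUnion hm hd hk.integrableOn]
    simp [ih]

theorem setIntegral_Ici_coneVolume {d : ℕ} (k : (Fin d → ℝ) → ℂ) (t : Fin d → ℝ) :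
    ∫ x in Set.Ici t, k x ∂coneVolume d = ∫ x in Set.Ici (t ⊔ 0), k x := by
  rw [coneVolume, setOf_forall_nonneg_eq_Ici, Measure.restrict_restrict measurableSet_Ici,
    Set.Ici_inter_Ici]

/-- The exponential truncated to the orthants `Ici t` is total in `L²` of the cone. -/
theorem Lp.eq_zero_of_forall_setIntegral_Ici_expNegSum_mul {d : ℕ} {g : Lp ℂ 2 (coneVolume d)}
    (h : ∀ t : Fin d → NNReal,
      ∫ x in Set.Ici (fun i => (t i : ℝ)), expNegSum d x * g x ∂coneVolume d = 0) : g = 0 := by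
  have hk : Integrable (fun x => expNegSum d x * g x) (coneVolume d) :=
    (memLp_expNegSum d).integrable_mul (Lp.memLp g)
  have h0 : ∫ x, expNegSum d x * g x ∂coneVolume d = 0 := by
    have := h 0
    rw [setIntegral_Ici_coneVolume] at this
    simpa [coneVolume, setOf_forall_nonneg_eq_Ici, ← Pi.zero_def] using! this
  have hz := ae_eq_zero_of_forall_setIntegral_Ici_eq_zero hk h0 fun t => by
    have := h fun i => (t i).toNNReal
    rw [setIntegral_Ici_coneVolume] at this ⊢
    convert! this using 4
    ext i; simp
  refine (Lp.eq_zero_iff_ae_eq_zero).2 ?_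
  filter_upwards [hz] with x hx
  exact (mul_eq_zero.1 hx).resolve_left (expNegSum_ne_zero x)

/-- The function `expNegSum` as a vector of `L²` of the cone. -/
noncomputable def expVec (d : ℕ) : Lp ℂ 2 (coneVolume d) := (memLp_expNegSum d).toLp

theorem coeFn_expVec (d : ℕ) : expVec d =ᵐ[coneVolume d] expNegSum d := MemLp.coeFn_toLp _

section Shift

variable {d : ℕ} {t : Fin d → NNReal} {g h : Lp ℂ 2 (coneVolume d)}

/-- The exponential is an eigenvector of the adjoint shift, in weak form. -/
theorem inner_expVec_of_ae_eq_shift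
    (hg : h =ᵐ[coneVolume d] Set.indicator {x : Fin d → ℝ | ∀ i, (t i : ℝ) ≤ x i}
      (fun x => g (x - fun i => (t i : ℝ)))) :
    inner ℂ (expVec d) h = expNegSum d (fun i => t i) * inner ℂ (expVec d) g := by
  set s : Fin d → ℝ := fun i => (t i : ℝ)
  have hm := measurableSet_setOf_forall_nonneg d
  let F : (Fin d → ℝ) → ℂ := Set.indicator {x | ∀ i, 0 ≤ x i}
    fun y => g y * expNegSum d y
  have hL : ∀ f : Lp ℂ 2 (coneVolume d),
      inner ℂ (expVec d) f = ∫ x, f x * expNegSum d x ∂coneVolume d := fun f => by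
    rw [L2.inner_def]
    refine integral_congr_ae ?_
    filter_upwards [coeFn_expVec d] with x hx
    rw [hx, RCLike.inner_apply, starRingEnd_apply, star_expNegSum]
  have hF : ∫ x, h x * expNegSum d x ∂coneVolume d = ∫ x, expNegSum d s * F (x - s) := by
    rw [← integral_indicator hm]
    refine integral_congr_ae ?_
    filter_upwards [(ae_restrict_iff' hm).1 hg] with x hx
    by_cases hxs : x ∈ {x : Fin d → ℝ | ∀ i, s i ≤ x i}
    · have hx0 : x ∈ {x : Fin d → ℝ | ∀ i, 0 ≤ x i} := fun i => (t i).2.trans (hxs i)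
      have hxs0 : x - s ∈ {x : Fin d → ℝ | ∀ i, 0 ≤ x i} := fun i => sub_nonneg.2 (hxs i)
      have he : expNegSum d x = expNegSum d s * expNegSum d (x - s) := by
        rw [← expNegSum_add, add_sub_cancel]
      simp only [F, Set.indicator_of_mem hx0, Set.indicator_of_mem hxs0]
      rw [hx hx0, Set.indicator_of_mem hxs, he]
      ring
    · have hxs0 : x - s ∉ {x : Fin d → ℝ | ∀ i, 0 ≤ x i} := fun H =>
        hxs fun i => sub_nonneg.1 (H i)
      simp only [F, Set.indicator_of_notMem hxs0, mul_zero]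
      refine Set.indicator_apply_eq_zero.2 fun hx0 => ?_
      rw [hx hx0, Set.indicator_of_notMem hxs, zero_mul]
  rw [hL, hL, hF, integral_const_mul, integral_sub_right_eq_self F, integral_indicator hm]

/-- The shifted exponential is a multiple of the exponential truncated to an orthant. -/
theorem coeFn_shift_expVec
    (hg : h =ᵐ[coneVolume d] Set.indicator {x : Fin d → ℝ | ∀ i, (t i : ℝ) ≤ x i}
      (fun x => expVec d (x - fun i => (t i : ℝ)))) :
    ∀ᵐ x ∂coneVolume d, expNegSum d (fun i => t i) * h x =
      Set.indicator (Set.Ici fun i => (t i : ℝ)) (expNegSum d) x := by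
  set s : Fin d → ℝ := fun i => (t i : ℝ)
  have hm := measurableSet_setOf_forall_nonneg d
  have hshift := (measurePreserving_sub_right (volume : Measure (Fin d → ℝ))
    s).quasiMeasurePreserving.ae ((ae_restrict_iff' hm).1 (coeFn_expVec d))
  filter_upwards [hg, ae_restrict_of_ae hshift] with x hx hxe
  rw [hx]
  by_cases hxs : x ∈ Set.Ici s
  · rw [Set.indicator_of_mem hxs, Set.indicator_of_mem (show x ∈ {x | ∀ i, s i ≤ x i} from hxs),
      hxe fun i => sub_nonneg.2 (hxs i), ← expNegSum_add, add_sub_cancel]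
  · rw [Set.indicator_of_notMem hxs,
      Set.indicator_of_notMem (show x ∉ {x | ∀ i, s i ≤ x i} from hxs), mul_zero]

theorem inner_shift_expVec
    (hg : h =ᵐ[coneVolume d] Set.indicator {x : Fin d → ℝ | ∀ i, (t i : ℝ) ≤ x i}
      (fun x => expVec d (x - fun i => (t i : ℝ)))) :
    expNegSum d (fun i => t i) * inner ℂ h g =
      ∫ x in Set.Ici (fun i => (t i : ℝ)), expNegSum d x * g x ∂coneVolume d := by
  rw [L2.inner_def, ← integral_const_mul, ← integral_indicator measurableSet_Ici]
  refine integral_congr_ae ?_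
  filter_upwards [coeFn_shift_expVec hg] with x hx
  rw [RCLike.inner_apply, ← star_expNegSum, mul_left_comm]
  have : star (expNegSum d fun i => t i) * (starRingEnd ℂ) (h x) =
      Set.indicator (Set.Ici fun i => (t i : ℝ)) (expNegSum d) x := by
    rw [starRingEnd_apply, ← star_mul', hx]
    by_cases hx : x ∈ Set.Ici (fun i => (t i : ℝ)) <;>
      simp only [hx, Set.indicator_of_mem, Set.indicator_of_notMem, not_false_eq_true, star_zero,
        star_expNegSum]
  rw [this]
  by_cases hx : x ∈ Set.Ici (fun i => (t i : ℝ)) <;> simp [hx, mul_comm]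

end Shift

/-- irreducibility of the shift semigroup on `L²(ℝ₊^d)`: any bounded operator
commuting with all `S_t` and all `S_t*` is a scalar multiple of the identity. `L²(ℝ₊^d)` is
realized as `Lp ℂ 2 μ` with `μ` Lebesgue measure restricted to the nonnegative cone, and `S`
is any family of bounded operators given a.e. by the shift formula. -/
theorem stmt_10 (d : ℕ) (hd : 1 ≤ d)
    (S : (Fin d → NNReal) →
      (Lp ℂ 2 ((volume : Measure (Fin d → ℝ)).restrict {x | ∀ i, 0 ≤ x i}) →L[ℂ]
        Lp ℂ 2 ((volume : Measure (Fin d → ℝ)).restrict {x | ∀ i, 0 ≤ x i})))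
    (hS : ∀ (t : Fin d → NNReal)
        (g : Lp ℂ 2 ((volume : Measure (Fin d → ℝ)).restrict {x | ∀ i, 0 ≤ x i})),
      (S t g : (Fin d → ℝ) → ℂ)
          =ᵐ[(volume : Measure (Fin d → ℝ)).restrict {x | ∀ i, 0 ≤ x i}]
        Set.indicator {x : Fin d → ℝ | ∀ i, (t i : ℝ) ≤ x i}
          (fun x => g (x - fun i => (t i : ℝ))))
    (T : Lp ℂ 2 ((volume : Measure (Fin d → ℝ)).restrict {x | ∀ i, 0 ≤ x i}) →L[ℂ]
      Lp ℂ 2 ((volume : Measure (Fin d → ℝ)).restrict {x | ∀ i, 0 ≤ x i}))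
    (hTS : ∀ t : Fin d → NNReal, T * S t = S t * T)
    (hTS' : ∀ t : Fin d → NNReal, T * adjoint (S t) = adjoint (S t) * T) :
    ∃ c : ℂ, T = c • 1 := by
  let e := expVec d
  have total : ∀ g, (∀ t, inner ℂ (S t e) g = 0) → g = 0 := fun g hg =>
    Lp.eq_zero_of_forall_setIntegral_Ici_expNegSum_mul fun t => by
      rw [← inner_shift_expVec (hS t e), hg, mul_zero]
  have adj : ∀ t, adjoint (S t) e = expNegSum d (fun i => t i) • e := fun t =>
    ext_inner_right ℂ fun g => by
      rw [adjoint_inner_left, inner_expVec_of_ae_eq_shift (hS t g), inner_smul_left,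
        starRingEnd_apply, star_expNegSum]
  obtain ⟨c, hc⟩ : ∃ c : ℂ, inner ℂ e (T e) = c * inner ℂ e e := by
    by_cases he : e = 0
    · exact ⟨0, by simp [he]⟩
    · exact ⟨_, (div_mul_cancel₀ _ (inner_self_ne_zero.2 he)).symm⟩
  have hTe : T e = c • e := by
    rw [← sub_eq_zero]
    refine total _ fun t => ?_
    have h1 : adjoint (S t) (T e) = expNegSum d (fun i => t i) • T e := by
      have := DFunLike.congr_fun (hTS' t) e
      simpa [adj] using! this.symm
    rw [← adjoint_inner_right, map_sub, map_smul, h1, adj, inner_sub_right, inner_smul_right,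
      inner_smul_right, inner_smul_right, hc]
    ring
  refine ⟨c, ?_⟩
  have hadj : adjoint (T - c • 1) = 0 := by
    ext1 g
    refine total _ fun t => ?_
    have h1 : T (S t e) = S t (T e) := DFunLike.congr_fun (hTS t) e
    rw [adjoint_inner_right]
    simp [h1, hTe]
  rw [← sub_eq_zero]
  exact adjoint.map_eq_zero_iff.1 hadj
end

section
/- (Wold decomposition.) Let V be a strongly continuous, doubly commuting isometric representation of ℝ₊^d on a complex Hilbert space H. Then there exists a unique family (H_α)_{α ⊆ {1,…,d}} of pairwise orthogonal closed subspaces of H such that: (i) the closed linear span of ⋃_α H_α is H; (ii) each H_α is reducing for V, i.e. V_t H_α ⊆ H_α and V_t* H_α ⊆ H_α for all t ∈ ℝ₊^d; (iii) for every i ∈ α, the restricted semigroup (V_t^{(i)}|_{H_α})_{t≥0} is strongly pure on H_α, i.e. (V_t^{(i)})*ξ → 0 as t → ∞ for every ξ ∈ H_α; and (iv) for every i ∉ α and every t ≥ 0, V_t^{(i)} H_α = H_α (the restriction of V^{(i)} to H_α is a unitary semigroup). -/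
open ContinuousLinearMap Filter Topology
open scoped InnerProductSpace

section WoldDecomposition

variable {H : Type*} [NormedAddCommGroup H] [InnerProductSpace ℂ H]

/-- The intersection of the ranges of a family of operators; for a semigroup of isometries this is
the subspace on which the semigroup is unitary. -/
def unitaryPart {ι : Type*} (T : ι → H →L[ℂ] H) : Submodule ℂ H :=
  ⨅ s, LinearMap.range (T s).toLinearMap

theorem mem_unitaryPart {ι : Type*} {T : ι → H →L[ℂ] H} {x : H} :
    x ∈ unitaryPart T ↔ ∀ s, ∃ y, T s y = x := by
  simp [unitaryPart, Submodule.mem_iInf]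

theorem map_mem_unitaryPart {ι : Type*} {T : ι → H →L[ℂ] H} {A : H →L[ℂ] H}
    (hA : ∀ s y, A (T s y) = T s (A y)) {x : H} (hx : x ∈ unitaryPart T) :
    A x ∈ unitaryPart T := by
  rw [mem_unitaryPart] at hx ⊢
  intro s
  obtain ⟨y, rfl⟩ := hx s
  exact ⟨A y, (hA s y).symm⟩

variable [CompleteSpace H]

theorem isClosed_range_of_norm_map {A : H →L[ℂ] H} (hA : ∀ x, ‖A x‖ = ‖x‖) :
    IsClosed (LinearMap.range A.toLinearMap : Set H) :=
  (AddMonoidHomClass.isometry_of_norm A hA).isClosedEmbedding.isClosed_range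

theorem adjoint_apply_map_of_norm_map {A : H →L[ℂ] H} (hA : ∀ x, ‖A x‖ = ‖x‖) (x : H) :
    adjoint A (A x) = x := by
  have h := (ContinuousLinearMap.norm_map_iff_adjoint_comp_self A).1 hA
  exact congrArg (fun B : H →L[ℂ] H => B x) h

theorem norm_adjoint_apply_le_of_norm_map {A : H →L[ℂ] H} (hA : ∀ x, ‖A x‖ = ‖x‖) (x : H) :
    ‖adjoint A x‖ ≤ ‖x‖ := by
  have h : ‖adjoint A‖ ≤ 1 := by
    rw [LinearIsometryEquiv.norm_map]
    exact A.opNorm_le_bound zero_le_one fun y => by simp [hA]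
  simpa using (adjoint A).le_of_opNorm_le h x

theorem isClosed_unitaryPart {ι : Type*} {T : ι → H →L[ℂ] H} (hT : ∀ s x, ‖T s x‖ = ‖x‖) :
    IsClosed (unitaryPart T : Set H) := by
  rw [unitaryPart, Submodule.coe_iInf]
  exact isClosed_iInter fun s => isClosed_range_of_norm_map (hT s)

/-- The vectors on which the adjoints of a family of isometries tend strongly to zero. -/
def purePart (T : NNReal → H →L[ℂ] H) : Submodule ℂ H where
  carrier := {x | Tendsto (fun s => adjoint (T s) x) atTop (𝓝 0)}
  zero_mem' := by simp
  add_mem' {x y} hx hy := by simpa using Tendsto.add hx hy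
  smul_mem' c x hx := by simpa using Tendsto.const_smul hx c

theorem isClosed_purePart {T : NNReal → H →L[ℂ] H} (hT : ∀ s x, ‖T s x‖ = ‖x‖) :
    IsClosed (purePart T : Set H) := by
  refine isClosed_of_closure_subset fun x hx => ?_
  refine Metric.tendsto_atTop.2 fun ε hε => ?_
  obtain ⟨y, hy, hxy⟩ := Metric.mem_closure_iff.1 hx (ε / 2) (half_pos hε)
  obtain ⟨N, hN⟩ := Metric.tendsto_atTop.1 (show Tendsto _ _ _ from hy) (ε / 2) (half_pos hε)
  refine ⟨N, fun s hs => ?_⟩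
  have h1 := hN s hs
  have h2 := norm_adjoint_apply_le_of_norm_map (hT s) (x - y)
  rw [dist_zero_right] at h1 ⊢
  rw [dist_eq_norm] at hxy
  calc ‖adjoint (T s) x‖ = ‖adjoint (T s) (x - y) + adjoint (T s) y‖ := by
        rw [← map_add, sub_add_cancel]
    _ ≤ ‖adjoint (T s) (x - y)‖ + ‖adjoint (T s) y‖ := norm_add_le _ _
    _ < ε := by linarith

theorem purePart_eq_orthogonal_unitaryPart {T : NNReal → H →L[ℂ] H}
    (hadd : ∀ s t, T (s + t) = T s * T t) (hT : ∀ s x, ‖T s x‖ = ‖x‖) :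
    purePart T = (unitaryPart T)ᗮ := by
  apply le_antisymm
  · intro x hx
    rw [Submodule.mem_orthogonal]
    intro u hu
    have hlim : Tendsto (fun s => ‖u‖ * ‖adjoint (T s) x‖) atTop (𝓝 0) := by
      simpa using (Tendsto.norm (show Tendsto _ _ _ from hx)).const_mul ‖u‖
    refine norm_le_zero_iff.1 (ge_of_tendsto' hlim fun s => ?_)
    obtain ⟨y, rfl⟩ := mem_unitaryPart.1 hu s
    rw [← adjoint_inner_right, hT]
    exact norm_inner_le_norm _ _
  · have hker : ∀ s, (LinearMap.range (T s).toLinearMap)ᗮ ≤ purePart T := by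
      intro s x hx
      have hsx : adjoint (T s) x = 0 := by
        refine ext_inner_left ℂ fun y => ?_
        rw [adjoint_inner_right, inner_zero_right]
        exact (Submodule.mem_orthogonal _ _).1 hx _ ⟨y, rfl⟩
      refine tendsto_const_nhds.congr' ?_
      filter_upwards [eventually_ge_atTop s] with r hr
      obtain ⟨q, rfl⟩ := exists_add_of_le hr
      rw [hadd, ← star_eq_adjoint, star_mul, mul_apply_eq_comp, star_eq_adjoint (T s), hsx, map_zero]
    have : CompleteSpace (purePart T) := (isClosed_purePart hT).completeSpace_coe
    rw [← Submodule.orthogonal_orthogonal (purePart T)]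
    refine Submodule.orthogonal_le (le_iInf fun s => ?_)
    have hs : (LinearMap.range (T s).toLinearMap)ᗮᗮ = LinearMap.range (T s).toLinearMap := by
      have : CompleteSpace (LinearMap.range (T s).toLinearMap) :=
        (isClosed_range_of_norm_map (hT s)).completeSpace_coe
      exact Submodule.orthogonal_orthogonal _
    exact (Submodule.orthogonal_le (hker s)).trans hs.le

theorem map_mem_orthogonal {A : H →L[ℂ] H} {U : Submodule ℂ H}
    (hA : ∀ u ∈ U, adjoint A u ∈ U) {x : H} (hx : x ∈ Uᗮ) : A x ∈ Uᗮ := by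
  rw [Submodule.mem_orthogonal] at hx ⊢
  intro u hu
  rw [← adjoint_inner_left]
  exact hx _ (hA u hu)

theorem starProjection_map_of_reducing {A : H →L[ℂ] H} {U : Submodule ℂ H}
    [U.HasOrthogonalProjection] (hA : ∀ u ∈ U, A u ∈ U) (hA' : ∀ u ∈ U, adjoint A u ∈ U) (x : H) :
    U.starProjection (A x) = A (U.starProjection x) := by
  refine Submodule.eq_starProjection_of_mem_orthogonal (hA _ (U.starProjection_apply_mem x)) ?_
  rw [← map_sub]
  exact map_mem_orthogonal hA' (U.sub_starProjection_mem_orthogonal x)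

end WoldDecomposition

/-- Commuting splittings `x = Q i x + (x - Q i x)` along `U i` and `P i` jointly decompose the
whole module. -/
theorem iSup_iInf_ite_eq_top {R M ι : Type*} [Ring R] [AddCommGroup M] [Module R M] [Fintype ι]
    [DecidableEq ι] (U P : ι → Submodule R M) (Q : ι → M → M)
    (hQU : ∀ i x, Q i x ∈ U i) (hQP : ∀ i x, x - Q i x ∈ P i)
    (hU : ∀ i j x, x ∈ U j → Q i x ∈ U j) (hP : ∀ i j, i ≠ j → ∀ x ∈ P j, Q i x ∈ P j) :
    ⨆ α : Finset ι, ⨅ i, (if i ∈ α then P i else U i) = ⊤ := by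
  have key : ∀ S : Finset ι,
      (⨆ α : Finset ι, ⨅ i ∈ S, (if i ∈ α then P i else U i)) = ⊤ := by
    intro S
    induction S using Finset.induction_on with
    | empty => simp
    | insert a S ha ih =>
      rw [eq_top_iff, ← ih]
      refine iSup_le fun α x hx => ?_
      simp only [Submodule.mem_iInf] at hx
      have hQ : ∀ i ∈ S, Q a x ∈ (if i ∈ α then P i else U i) := by
        intro i hi
        have hai : a ≠ i := fun h => ha (h ▸ hi)
        have := hx i hi
        split_ifs at this ⊢
        exacts [hP a i hai x this, hU a i x this]
      rw [← add_sub_cancel (Q a x) x]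
      refine add_mem (Submodule.mem_iSup_of_mem (α.erase a) ?_)
        (Submodule.mem_iSup_of_mem (insert a α) ?_)
      · simp only [Submodule.mem_iInf]
        intro i hi
        obtain rfl | hi := Finset.mem_insert.1 hi
        · simpa using hQU i x
        · have hai : i ≠ a := fun h => ha (h ▸ hi)
          simpa [hai] using hQ i hi
      · simp only [Submodule.mem_iInf]
        intro i hi
        obtain rfl | hi := Finset.mem_insert.1 hi
        · simpa using hQP i x
        · have hai : i ≠ a := fun h => ha (h ▸ hi)
          simpa [hai] using sub_mem (hx i hi) (hQ i hi)
  simpa using key Finset.univ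

/-- A family of closed subspaces with dense span that lies inside a pairwise orthogonal family
coincides with it. -/
theorem eq_of_le_of_pairwise_orthogonal {H ι : Type*} [NormedAddCommGroup H]
    [InnerProductSpace ℂ H] [CompleteSpace H] {K L : ι → Submodule ℂ H}
    (hK : ∀ α, IsClosed (K α : Set H)) (hspan : (⨆ α, K α).topologicalClosure = ⊤)
    (hL : ∀ α β, α ≠ β → ∀ x ∈ L α, ∀ y ∈ L β, ⟪x, y⟫_ℂ = 0) (hle : ∀ α, K α ≤ L α) :
    K = L := by
  funext α
  refine le_antisymm (hle α) fun x hx => ?_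
  have : CompleteSpace (K α) := (hK α).completeSpace_coe
  set z := x - (K α).starProjection x with hz
  have hzL : z ∈ L α := sub_mem hx (hle α ((K α).starProjection_apply_mem x))
  have hz0 : z ∈ (⨆ α, K α)ᗮ := by
    rw [← Submodule.iInf_orthogonal, Submodule.mem_iInf]
    intro β
    by_cases hβ : β = α
    · subst hβ
      exact (K β).sub_starProjection_mem_orthogonal x
    · rw [Submodule.mem_orthogonal]
      exact fun y hy => hL β α hβ y (hle β hy) z hzL
  rw [(Submodule.topologicalClosure_eq_top_iff).1 hspan, Submodule.mem_bot, hz, sub_eq_zero] at hz0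
  rw [hz0]
  exact (K α).starProjection_apply_mem x

/-- Wold decomposition: a strongly continuous doubly commuting isometric
representation of `ℝ₊^d` on a Hilbert space `H` admits a unique family `(H_α)_{α ⊆ {1,…,d}}`
of pairwise orthogonal closed reducing subspaces whose closed linear span is `H`, with
`V^{(i)}` strongly pure on `H_α` for `i ∈ α` and unitary on `H_α` for `i ∉ α`. -/
theorem stmt_11 (d : ℕ) (hd : 1 ≤ d)
    (H : Type*) [NormedAddCommGroup H] [InnerProductSpace ℂ H] [CompleteSpace H]
    (V : (Fin d → NNReal) → H →L[ℂ] H)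
    (hV0 : V 0 = 1)
    (hVadd : ∀ s t : Fin d → NNReal, V (s + t) = V s * V t)
    (hiso : ∀ (t : Fin d → NNReal) (x : H), ‖V t x‖ = ‖x‖)
    (hcont : ∀ ξ : H, Continuous fun t : Fin d → NNReal => V t ξ)
    (hdc : ∀ i j : Fin d, i ≠ j → ∀ s t : NNReal,
      V (Pi.single i s) * adjoint (V (Pi.single j t))
        = adjoint (V (Pi.single j t)) * V (Pi.single i s)) :
    ∃! Hs : Finset (Fin d) → Submodule ℂ H,
      (∀ α, IsClosed (Hs α : Set H)) ∧
      (∀ α β, α ≠ β → ∀ x ∈ Hs α, ∀ y ∈ Hs β, ⟪x, y⟫_ℂ = 0) ∧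
      (⨆ α, Hs α).topologicalClosure = ⊤ ∧
      (∀ α (t : Fin d → NNReal), ∀ x ∈ Hs α, V t x ∈ Hs α ∧ adjoint (V t) x ∈ Hs α) ∧
      (∀ α, ∀ i ∈ α, ∀ ξ ∈ Hs α,
        Tendsto (fun s : NNReal => adjoint (V (Pi.single i s)) ξ) atTop (𝓝 0)) ∧
      (∀ α, ∀ i ∉ α, ∀ s : NNReal,
        Submodule.map (V (Pi.single i s)).toLinearMap (Hs α) = Hs α) := by
  have hcomm : ∀ s t x, V s (V t x) = V t (V s x) := fun s t x => by
    rw [← mul_apply_eq_comp, ← hVadd, add_comm, hVadd, mul_apply_eq_comp]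
  set T : Fin d → NNReal → H →L[ℂ] H := fun i s => V (Pi.single i s) with hTdef
  have hT : ∀ i s x, ‖T i s x‖ = ‖x‖ := fun i s x => hiso _ x
  have hTadd : ∀ i s t, T i (s + t) = T i s * T i t := fun i s t => by
    simp only [hTdef, Pi.single_add, hVadd]
  set U : Fin d → Submodule ℂ H := fun i => unitaryPart (T i) with hUdef
  have hUclosed : ∀ i, IsClosed (U i : Set H) := fun i => isClosed_unitaryPart (hT i)
  have : ∀ i, CompleteSpace (U i) := fun i => (hUclosed i).completeSpace_coe
  have hpure : ∀ i x, x ∈ (U i)ᗮ ↔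
      Tendsto (fun s : NNReal => adjoint (V (Pi.single i s)) x) atTop (𝓝 0) := fun i x => by
    rw [hUdef, ← purePart_eq_orthogonal_unitaryPart (hTadd i) (hT i)]
    rfl
  have hUV : ∀ i t, ∀ x ∈ U i, V t x ∈ U i := fun i t x hx =>
    map_mem_unitaryPart (fun s y => hcomm _ _ _) hx
  have hUV' : ∀ i t, ∀ x ∈ U i, adjoint (V t) x ∈ U i := by
    intro i t
    rw [← Finset.univ_sum_single t]
    refine Finset.sum_induction (fun j => Pi.single j (t j))
      (fun t => ∀ x ∈ U i, adjoint (V t) x ∈ U i) ?_ ?_ ?_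
    · intro s t hs ht x hx
      rw [hVadd, ← star_eq_adjoint, star_mul]
      exact ht _ (hs _ hx)
    · intro x hx
      rw [hV0, ← star_eq_adjoint, star_one]
      exact hx
    · intro j _ x hx
      by_cases hij : i = j
      · subst hij
        refine mem_unitaryPart.2 fun s => ?_
        obtain ⟨y, rfl⟩ := mem_unitaryPart.1 hx (t i + s)
        refine ⟨y, ?_⟩
        rw [hTadd, mul_apply_eq_comp]
        exact (adjoint_apply_map_of_norm_map (hT i (t i)) _).symm
      · exact map_mem_unitaryPart
          (fun s y => congrArg (fun B : H →L[ℂ] H => B y) (hdc i j hij s (t j)).symm) hx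
  have hPV : ∀ i t, ∀ x ∈ (U i)ᗮ, V t x ∈ (U i)ᗮ := fun i t x hx =>
    map_mem_orthogonal (hUV' i t) hx
  have hPV' : ∀ i t, ∀ x ∈ (U i)ᗮ, adjoint (V t) x ∈ (U i)ᗮ := fun i t x hx =>
    map_mem_orthogonal (fun u hu => by simpa using hUV i t u hu) hx
  have hQU : ∀ i j x, x ∈ U j → (U i).starProjection x ∈ U j := fun i j x hx =>
    map_mem_unitaryPart (fun s y => starProjection_map_of_reducing (hUV i _) (hUV' i _) y) hx
  set L : Finset (Fin d) → Submodule ℂ H :=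
    fun α => ⨅ i, (if i ∈ α then (U i)ᗮ else U i) with hLdef
  have hLmem : ∀ α x, x ∈ L α ↔ (∀ i ∈ α, x ∈ (U i)ᗮ) ∧ ∀ i ∉ α, x ∈ U i := by
    intro α x
    simp only [hLdef, Submodule.mem_iInf]
    refine ⟨fun h => ⟨fun i hi => by simpa [hi] using h i, fun i hi => by simpa [hi] using h i⟩,
      fun h i => ?_⟩
    split_ifs with hi
    exacts [h.1 i hi, h.2 i hi]
  have hLred : ∀ α (t : Fin d → NNReal), ∀ x ∈ L α, V t x ∈ L α ∧ adjoint (V t) x ∈ L α := by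
    intro α t x hx
    rw [hLmem] at hx
    rw [hLmem, hLmem]
    exact ⟨⟨fun i hi => hPV i t x (hx.1 i hi), fun i hi => hUV i t x (hx.2 i hi)⟩,
      ⟨fun i hi => hPV' i t x (hx.1 i hi), fun i hi => hUV' i t x (hx.2 i hi)⟩⟩
  have hLorth : ∀ α β, α ≠ β → ∀ x ∈ L α, ∀ y ∈ L β, ⟪x, y⟫_ℂ = 0 := by
    intro α β hαβ x hx y hy
    rw [hLmem] at hx hy
    obtain ⟨i, hi⟩ : ∃ i, ¬(i ∈ α ↔ i ∈ β) := by
      by_contra! h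
      exact hαβ (Finset.ext h)
    by_cases hiα : i ∈ α
    · have hiβ : i ∉ β := fun h => hi (iff_of_true hiα h)
      exact Submodule.inner_left_of_mem_orthogonal (hy.2 i hiβ) (hx.1 i hiα)
    · have hiβ : i ∈ β := by_contra fun h => hi (iff_of_false hiα h)
      exact Submodule.inner_right_of_mem_orthogonal (hx.2 i hiα) (hy.1 i hiβ)
  refine ⟨L, ⟨?_, hLorth, ?_, hLred, ?_, ?_⟩, ?_⟩
  · intro α
    simp only [hLdef, Submodule.coe_iInf]
    refine isClosed_iInter fun i => ?_
    split_ifs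
    exacts [(U i).isClosed_orthogonal, hUclosed i]
  · have htop : ⨆ α, L α = ⊤ :=
      iSup_iInf_ite_eq_top U (fun i => (U i)ᗮ) (fun i => (U i).starProjection)
        (fun i x => (U i).starProjection_apply_mem x)
        (fun i x => (U i).sub_starProjection_mem_orthogonal x) hQU
        (fun i j _ x hx => map_mem_orthogonal (fun u hu => by
          rw [(isSelfAdjoint_iff'.1 (isSelfAdjoint_starProjection (U i)))]
          exact hQU i j u hu) hx)
    rw [htop, eq_top_iff]
    exact Submodule.le_topologicalClosure _
  · exact fun α i hi ξ hξ => (hpure i ξ).1 (((hLmem α ξ).1 hξ).1 i hi)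
  · intro α i hi s
    refine le_antisymm (Submodule.map_le_iff_le_comap.2 fun x hx => (hLred α _ x hx).1)
      fun x hx => ?_
    obtain ⟨y, rfl⟩ := mem_unitaryPart.1 (((hLmem α x).1 hx).2 i hi) s
    refine ⟨y, ?_, rfl⟩
    have := (hLred α (Pi.single i s) _ hx).2
    rwa [adjoint_apply_map_of_norm_map (hT i s)] at this
  · rintro K ⟨hKclosed, -, hKspan, -, hKpure, hKunitary⟩
    refine eq_of_le_of_pairwise_orthogonal hKclosed hKspan hLorth fun α x hx => ?_
    refine (hLmem α x).2 ⟨fun i hi => (hpure i x).2 (hKpure α i hi x hx), fun i hi => ?_⟩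
    refine mem_unitaryPart.2 fun s => ?_
    rw [← hKunitary α i hi s] at hx
    obtain ⟨y, -, hy⟩ := hx
    exact ⟨y, hy⟩
end
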